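/- arXiv:1703.09372 — 5 statements merged into one kernel-verified Lean document; each statement's English description precedes it below -/
import Mathlib

section
/- Let H ∈ (0, 1/2) and θ > 0. Then the limit as T → ∞ of (2/T) ∫_{[0,T]^4} [θ·sgn(s₁-t₁)·e^{-θ|s₁-t₁|}] · [-θ·sgn(s₂-t₂)·e^{-θ|s₂-t₂|}] · [H(s₁^{2H-1} - sgn(s₁-s₂)|s₁-s₂|^{2H-1})] · [H(t₂^{2H-1} + sgn(t₁-t₂)|t₁-t₂|^{2H-1})] ds₁ ds₂ dt₁ dt₂ equals 4H² θ^{1-4H} Γ(2H)² ( (4H-1) + 2Γ(2-4H)Γ(4H) / (Γ(2H)Γ(1-2H)) ), where Γ is the Gamma function. -/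
open MeasureTheory

section ExplicitIntegrals

open Real Set

/-- The integrand of the Gaussian representation of `x ^ p * (m ^ 2 + x ^ 2) ^ (-k)`. -/
lemma integrable_rpow_mul_gaussian {p k m : ℝ} (hp : -1 < p) (hk : p + 1 < 2 * k) (hm : 0 < m) :
    Integrable (fun z : ℝ × ℝ => z.1 ^ p * (z.2 ^ (k - 1) * exp (-((m ^ 2 + z.1 ^ 2) * z.2))))
      ((volume.restrict (Ioi 0)).prod (volume.restrict (Ioi 0))) := by
  have hmeas : Measurable
      (fun z : ℝ × ℝ => z.1 ^ p * (z.2 ^ (k - 1) * exp (-((m ^ 2 + z.1 ^ 2) * z.2)))) := by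
    fun_prop
  rw [integrable_prod_iff' hmeas.aestronglyMeasurable]
  have key : ∀ s : ℝ, 0 < s → ∀ x : ℝ,
      x ^ p * (s ^ (k - 1) * exp (-((m ^ 2 + x ^ 2) * s)))
        = s ^ (k - 1) * exp (-(m ^ 2 * s)) * (x ^ p * exp (-s * x ^ (2 : ℝ))) := by
    intro s hs x
    have : exp (-((m ^ 2 + x ^ 2) * s)) = exp (-(m ^ 2 * s)) * exp (-s * x ^ (2 : ℝ)) := by
      rw [← exp_add, rpow_two]; ring_nf
    rw [this]; ring
  constructor
  · refine (ae_restrict_iff' measurableSet_Ioi).2 (ae_of_all _ fun s (hs : 0 < s) => ?_)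
    simp only [key s hs]
    exact (integrableOn_rpow_mul_exp_neg_mul_rpow hp two_pos hs).const_mul _
  · have h2 : IntegrableOn (fun s : ℝ => (2⁻¹ * Gamma ((p + 1) / 2)) *
        (s ^ (k - 1 - (p + 1) / 2) * exp (-(m ^ 2) * s ^ (1 : ℝ)))) (Ioi 0) := by
      refine (integrableOn_rpow_mul_exp_neg_mul_rpow ?_ one_pos (by positivity)).const_mul _
      linarith
    refine h2.congr_fun (fun s (hs : 0 < s) => ?_) measurableSet_Ioi
    have h3 : ∀ x ∈ Ioi (0 : ℝ), ‖x ^ p * (s ^ (k - 1) * exp (-((m ^ 2 + x ^ 2) * s)))‖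
        = s ^ (k - 1) * exp (-(m ^ 2 * s)) * (x ^ p * exp (-s * x ^ (2 : ℝ))) := by
      intro x (hx : 0 < x)
      rw [← key s hs, norm_of_nonneg (by positivity)]
    simp only
    rw [setIntegral_congr_fun measurableSet_Ioi h3, integral_const_mul,
      integral_rpow_mul_exp_neg_mul_rpow two_pos hp hs,
      show k - 1 - (p + 1) / 2 = (k - 1) + (-(p + 1) / 2) by ring, rpow_add hs, rpow_one]
    ring_nf

lemma integral_rpow_mul_gaussian_right {k m : ℝ} (p : ℝ) (hk : 0 < k) (hm : 0 < m) {x : ℝ}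
    (hx : 0 < x) :
    ∫ s in Ioi (0 : ℝ), x ^ p * (s ^ (k - 1) * exp (-((m ^ 2 + x ^ 2) * s)))
      = Gamma k * (x ^ p * (m ^ 2 + x ^ 2) ^ (-k)) := by
  rw [integral_const_mul, integral_rpow_mul_exp_neg_mul_Ioi hk (by positivity), one_div,
    inv_rpow (by positivity), ← rpow_neg (by positivity)]
  ring

lemma integrableOn_rpow_mul_sq_add_sq_rpow {p k m : ℝ} (hp : -1 < p) (hk : p + 1 < 2 * k)
    (hm : 0 < m) :
    IntegrableOn (fun x : ℝ => x ^ p * (m ^ 2 + x ^ 2) ^ (-k)) (Ioi 0) := by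
  have hk0 : 0 < k := by linarith
  have h1 := (integrable_rpow_mul_gaussian hp hk hm).integral_prod_left.const_mul (Gamma k)⁻¹
  refine IntegrableOn.congr_fun h1 (fun x hx => ?_) measurableSet_Ioi
  simp only
  rw [integral_rpow_mul_gaussian_right p hk0 hm hx,
    inv_mul_cancel_left₀ (Gamma_pos_of_pos hk0).ne']

lemma integral_rpow_mul_sq_add_sq_rpow {p k m : ℝ} (hp : -1 < p) (hk : p + 1 < 2 * k)
    (hm : 0 < m) :
    ∫ x in Ioi (0 : ℝ), x ^ p * (m ^ 2 + x ^ 2) ^ (-k)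
      = m ^ (p + 1 - 2 * k) * Gamma ((p + 1) / 2) * Gamma (k - (p + 1) / 2) / (2 * Gamma k) := by
  have hk0 : 0 < k := by linarith
  have hG : Gamma k ≠ 0 := (Gamma_pos_of_pos hk0).ne'
  have h := integral_integral_swap
    (f := fun x s : ℝ => x ^ p * (s ^ (k - 1) * exp (-((m ^ 2 + x ^ 2) * s))))
    (integrable_rpow_mul_gaussian hp hk hm)
  rw [setIntegral_congr_fun measurableSet_Ioi
    (fun x hx => integral_rpow_mul_gaussian_right p hk0 hm hx), integral_const_mul] at h
  have h4 : ∀ s ∈ Ioi (0 : ℝ),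
      ∫ x in Ioi (0 : ℝ), x ^ p * (s ^ (k - 1) * exp (-((m ^ 2 + x ^ 2) * s)))
        = (2⁻¹ * Gamma ((p + 1) / 2)) *
          (s ^ (k - (p + 1) / 2 - 1) * exp (-(m ^ 2 * s))) := by
    intro s (hs : 0 < s)
    have h3 : ∀ x ∈ Ioi (0 : ℝ), x ^ p * (s ^ (k - 1) * exp (-((m ^ 2 + x ^ 2) * s)))
        = s ^ (k - 1) * exp (-(m ^ 2 * s)) * (x ^ p * exp (-s * x ^ (2 : ℝ))) := by
      intro x _
      have : exp (-((m ^ 2 + x ^ 2) * s)) = exp (-(m ^ 2 * s)) * exp (-s * x ^ (2 : ℝ)) := by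
        rw [← exp_add, rpow_two]; ring_nf
      rw [this]; ring
    rw [setIntegral_congr_fun measurableSet_Ioi h3, integral_const_mul,
      integral_rpow_mul_exp_neg_mul_rpow two_pos hp hs,
      show k - (p + 1) / 2 - 1 = (k - 1) + (-(p + 1) / 2) by ring, rpow_add hs]
    ring_nf
  rw [setIntegral_congr_fun measurableSet_Ioi h4, integral_const_mul,
    integral_rpow_mul_exp_neg_mul_Ioi (by linarith) (by positivity), one_div,
    inv_rpow (by positivity), ← rpow_neg (by positivity)] at h
  have h5 : (m ^ 2) ^ (-(k - (p + 1) / 2)) = m ^ (p + 1 - 2 * k) := by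
    rw [← rpow_two, ← rpow_mul hm.le]
    ring_nf
  rw [h5] at h
  rw [eq_div_iff (by positivity)]
  linear_combination 2 * h

lemma integrable_comp_abs_of_integrableOn_Ioi {f : ℝ → ℝ} (hf : IntegrableOn f (Ioi 0)) :
    Integrable (fun x => f |x|) := by
  have h1 : IntegrableOn (fun x => f |x|) (Ioi 0) :=
    hf.congr_fun (fun x (hx : 0 < x) => by simp only [abs_of_pos hx]) measurableSet_Ioi
  have h2 : IntegrableOn (fun x => f |x|) (Iic 0) := by
    rw [← Measure.map_neg_eq_self (volume : Measure ℝ)]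
    let m : MeasurableEmbedding fun x : ℝ => -x := (Homeomorph.neg ℝ).measurableEmbedding
    rw [m.integrableOn_map_iff]
    simp_rw [Function.comp_def, abs_neg, neg_preimage, neg_Iic, neg_zero]
    exact Iff.mpr integrableOn_Ici_iff_integrableOn_Ioi h1
  rw [← integrableOn_univ, ← Iic_union_Ioi (a := (0 : ℝ))]
  exact h2.union h1

lemma integral_exp_neg_abs_mul_exp_neg_abs {l m : ℝ} (hl : 0 < l) (hm : 0 < m) :
    Integrable (fun x : ℝ => exp (-l * |x|) * exp (-m * |x|)) ∧
      ∫ x : ℝ, exp (-l * |x|) * exp (-m * |x|) = 2 / (l + m) := by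
  have h0 : ∀ x : ℝ, exp (-l * |x|) * exp (-m * |x|) = exp (-(l + m) * |x|) := by
    intro x; rw [← exp_add]; ring_nf
  simp only [h0]
  refine ⟨?_, ?_⟩
  · have := integrableOn_exp_mul_Ioi (a := -(l + m)) (by linarith) 0
    exact integrable_comp_abs_of_integrableOn_Ioi this
  · rw [integral_comp_abs (f := fun x => exp (-(l + m) * x)),
      integral_exp_mul_Ioi (by linarith)]
    simp only [mul_zero, exp_zero]
    rw [neg_div_neg_eq]
    ring

lemma integrable_and_integral_inv_sq_add_sq {m : ℝ} (hm : 0 < m) :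
    Integrable (fun x : ℝ => (m ^ 2 + x ^ 2)⁻¹) ∧ ∫ x : ℝ, (m ^ 2 + x ^ 2)⁻¹ = π / m := by
  have h0 : ∀ x : ℝ, (m ^ 2 + x ^ 2)⁻¹ = m⁻¹ ^ 2 * (1 + (x / m) ^ 2)⁻¹ := by
    intro x; field_simp
  simp only [h0]
  refine ⟨(integrable_inv_one_add_sq.comp_div hm.ne').const_mul _, ?_⟩
  rw [integral_const_mul, Measure.integral_comp_div (fun y => (1 + y ^ 2)⁻¹),
    integral_univ_inv_one_add_sq, abs_of_pos hm, smul_eq_mul]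
  field_simp

lemma integrable_and_integral_inv_sq_add_sq_mul {l m : ℝ} (hl : 0 < l) (hm : 0 < m) :
    Integrable (fun x : ℝ => (l ^ 2 + x ^ 2)⁻¹ * (m ^ 2 + x ^ 2)⁻¹) ∧
      ∫ x : ℝ, (l ^ 2 + x ^ 2)⁻¹ * (m ^ 2 + x ^ 2)⁻¹ = π / (l * m * (l + m)) := by
  obtain ⟨il, el⟩ := integrable_and_integral_inv_sq_add_sq hl
  obtain ⟨im, em⟩ := integrable_and_integral_inv_sq_add_sq hm
  rcases eq_or_ne l m with rfl | hne
  · have h1 : ∀ x : ℝ, (l ^ 2 + x ^ 2)⁻¹ * (l ^ 2 + x ^ 2)⁻¹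
        = |x| ^ (0 : ℝ) * (l ^ 2 + |x| ^ 2) ^ (-2 : ℝ) := by
      intro x
      rw [rpow_zero, one_mul, sq_abs, rpow_neg (by positivity), rpow_two, ← mul_inv, ← sq]
    simp only [h1]
    refine ⟨integrable_comp_abs_of_integrableOn_Ioi
      (integrableOn_rpow_mul_sq_add_sq_rpow (p := 0) (k := 2) (by norm_num) (by norm_num) hl), ?_⟩
    rw [integral_comp_abs (f := fun x => x ^ (0 : ℝ) * (l ^ 2 + x ^ 2) ^ (-2 : ℝ)),
      integral_rpow_mul_sq_add_sq_rpow (by norm_num) (by norm_num) hl,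
      show (2 : ℝ) - (0 + 1) / 2 = 1 / 2 + 1 by norm_num, Gamma_add_one (by norm_num),
      show ((0 : ℝ) + 1) / 2 = 1 / 2 by norm_num, Gamma_one_half_eq, Gamma_two,
      show (0 : ℝ) + 1 - 2 * 2 = -(3 : ℕ) by norm_num, rpow_neg hl.le, rpow_natCast]
    have := sq_sqrt pi_pos.le
    field_simp
    linear_combination 2 * this
  · have hd : m ^ 2 - l ^ 2 ≠ 0 := by
      rw [sq_sub_sq]
      exact mul_ne_zero (by positivity) (sub_ne_zero.2 hne.symm)
    have h1 : ∀ x : ℝ, (l ^ 2 + x ^ 2)⁻¹ * (m ^ 2 + x ^ 2)⁻¹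
        = (m ^ 2 - l ^ 2)⁻¹ * ((l ^ 2 + x ^ 2)⁻¹ - (m ^ 2 + x ^ 2)⁻¹) := by
      intro x
      have : l ^ 2 + x ^ 2 ≠ 0 := by positivity
      have : m ^ 2 + x ^ 2 ≠ 0 := by positivity
      field_simp
      ring
    simp only [h1]
    refine ⟨(il.sub im).const_mul _, ?_⟩
    rw [integral_const_mul, integral_sub il im, el, em]
    have : m - l ≠ 0 := sub_ne_zero.2 hne.symm
    rw [sq_sub_sq] at *
    field_simp
    ring

end ExplicitIntegrals

section SquareIntegral

open Real Set

/-- If `f` is integrable and dominated by a function of the first variable alone, then its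
parametric integral is integrable, square integrable, and bounded, and the square can be
expanded by Fubini. -/
lemma integral_sq_integral_eq {ν μ : Measure ℝ} [SFinite ν] [SFinite μ] {f : ℝ → ℝ → ℝ}
    {b : ℝ → ℝ} (hf : Integrable (Function.uncurry f) (ν.prod μ))
    (hfm : Measurable (Function.uncurry f)) (hb : Integrable b ν)
    (hfb : ∀ᵐ l ∂ν, ∀ x, |f l x| ≤ b l) :
    Integrable (fun x => (∫ l, f l x ∂ν) ^ 2) μ ∧
      ∫ x, (∫ l, f l x ∂ν) ^ 2 ∂μ = ∫ l, ∫ m, ∫ x, f l x * f m x ∂μ ∂ν ∂ν := by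
  have hF : Integrable (fun z : (ℝ × ℝ) × ℝ => f z.1.1 z.2 * f z.1.2 z.2) ((ν.prod ν).prod μ) := by
    have hm1 : Measurable fun z : (ℝ × ℝ) × ℝ => f z.1.1 z.2 * f z.1.2 z.2 :=
      (hfm.comp (measurable_fst.fst.prodMk measurable_snd)).mul
        (hfm.comp (measurable_fst.snd.prodMk measurable_snd))
    have hb1 : ∀ᵐ p ∂(ν.prod ν), ∀ x, |f p.1 x| ≤ b p.1 :=
      Measure.quasiMeasurePreserving_fst.ae hfb
    have hi2 : ∀ᵐ p ∂(ν.prod ν), Integrable (f p.2) μ :=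
      Measure.quasiMeasurePreserving_snd.ae hf.prod_right_ae
    have hle : ∀ᵐ p ∂(ν.prod ν), ∀ x, ‖f p.1 x * f p.2 x‖ ≤ b p.1 * ‖f p.2 x‖ := by
      filter_upwards [hb1] with p hp x
      rw [norm_mul]
      exact mul_le_mul_of_nonneg_right (hp x) (norm_nonneg _)
    have hi : ∀ᵐ p ∂(ν.prod ν), Integrable (fun x => f p.1 x * f p.2 x) μ := by
      filter_upwards [hle, hi2] with p hp hp2
      refine (hp2.norm.const_mul (b p.1)).mono' ?_ (ae_of_all _ hp)
      exact (hm1.comp (measurable_const (a := p) |>.prodMk measurable_id)).aestronglyMeasurable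
    rw [integrable_prod_iff hm1.aestronglyMeasurable]
    refine ⟨hi, ?_⟩
    refine (hb.mul_prod hf.norm.integral_prod_left).mono'
      hm1.stronglyMeasurable.norm.integral_prod_right.aestronglyMeasurable ?_
    filter_upwards [hle, hi, hi2] with p hp hpi hp2
    rw [norm_of_nonneg (integral_nonneg fun x => norm_nonneg _)]
    refine (integral_mono hpi.norm (hp2.norm.const_mul (b p.1)) hp).trans_eq ?_
    rw [integral_const_mul]
    rfl
  have hF' : Integrable (Function.uncurry fun (p : ℝ × ℝ) (x : ℝ) => f p.1 x * f p.2 x)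
      ((ν.prod ν).prod μ) := hF
  have e1 : ∀ x, (∫ l, f l x ∂ν) ^ 2 = ∫ p : ℝ × ℝ, f p.1 x * f p.2 x ∂(ν.prod ν) := by
    intro x
    rw [integral_prod_mul (fun l => f l x) (fun l => f l x), sq]
  simp only [e1]
  refine ⟨hF.integral_prod_right, ?_⟩
  rw [← integral_integral_swap hF']
  exact integral_prod _ hF'.integral_prod_left

end SquareIntegral

section Kernels

open Real Set

/-- Divided difference in `l ^ 2` of `l * exp (-l * |x|)` at `l` and `θ`. -/
noncomputable def expKernel (θ l x : ℝ) : ℝ :=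
  (l * exp (-l * |x|) - θ * exp (-θ * |x|)) / (l ^ 2 - θ ^ 2)

/-- The rational counterpart of `expKernel` under the Fourier transform. -/
noncomputable def ratKernel (θ l x : ℝ) : ℝ :=
  x ^ 2 * ((θ ^ 2 + x ^ 2)⁻¹ * (l ^ 2 + x ^ 2)⁻¹)

lemma sq_sub_sq_ne_zero_of_pos {l θ : ℝ} (hl : 0 < l) (hθ : 0 < θ) (h : l ≠ θ) :
    l ^ 2 - θ ^ 2 ≠ 0 := by
  rw [sq_sub_sq]
  exact mul_ne_zero (by positivity) (sub_ne_zero.2 h)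

lemma ratKernel_eq {θ l : ℝ} (hl : 0 < l) (hθ : 0 < θ) (h : l ≠ θ) (x : ℝ) :
    ratKernel θ l x =
      (l ^ 2 - θ ^ 2)⁻¹ * (l ^ 2 * (l ^ 2 + x ^ 2)⁻¹ - θ ^ 2 * (θ ^ 2 + x ^ 2)⁻¹) := by
  have := sq_sub_sq_ne_zero_of_pos hl hθ h
  have : l ^ 2 + x ^ 2 ≠ 0 := by positivity
  have : θ ^ 2 + x ^ 2 ≠ 0 := by positivity
  rw [ratKernel]
  field_simp
  ring

lemma ratKernel_nonneg (θ l x : ℝ) : 0 ≤ ratKernel θ l x := by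
  unfold ratKernel; positivity

lemma ratKernel_le {θ l : ℝ} (hl : 0 < l) (hθ : 0 < θ) (x : ℝ) :
    ratKernel θ l x ≤ 2 / θ * (l + θ)⁻¹ := by
  have h1 : 0 < l ^ 2 + x ^ 2 := by positivity
  have h2 : 0 < θ ^ 2 + x ^ 2 := by positivity
  rw [ratKernel, ← mul_inv, ← div_eq_mul_inv, ← div_eq_mul_inv, div_div,
    div_le_div_iff₀ (by positivity) (by positivity)]
  have h3 : θ * (l + θ) ≤ 2 * (l ^ 2 + θ ^ 2) := by nlinarith [sq_nonneg (l - θ), sq_nonneg l]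
  have h4 : x ^ 2 * (l ^ 2 + θ ^ 2) ≤ (θ ^ 2 + x ^ 2) * (l ^ 2 + x ^ 2) := by
    nlinarith [sq_nonneg (l * θ), sq_nonneg (x ^ 2)]
  nlinarith [sq_nonneg x]

lemma integrable_and_integral_ratKernel {θ l : ℝ} (hl : 0 < l) (hθ : 0 < θ) (h : l ≠ θ) :
    Integrable (ratKernel θ l) ∧ ∫ x, ratKernel θ l x = π * (l + θ)⁻¹ := by
  obtain ⟨il, el⟩ := integrable_and_integral_inv_sq_add_sq hl
  obtain ⟨im, em⟩ := integrable_and_integral_inv_sq_add_sq hθ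
  have h0 : ratKernel θ l = fun x => (l ^ 2 - θ ^ 2)⁻¹ *
      (l ^ 2 * (l ^ 2 + x ^ 2)⁻¹ - θ ^ 2 * (θ ^ 2 + x ^ 2)⁻¹) :=
    funext (ratKernel_eq hl hθ h)
  rw [h0]
  refine ⟨((il.const_mul _).sub (im.const_mul _)).const_mul _, ?_⟩
  rw [integral_const_mul, integral_sub (il.const_mul _) (im.const_mul _), integral_const_mul,
    integral_const_mul, el, em]
  have := sq_sub_sq_ne_zero_of_pos hl hθ h
  have h2 : l - θ ≠ 0 := sub_ne_zero.2 h
  rw [sq_sub_sq] at *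
  field_simp

/-- The integral of a product of two differences, expanded bilinearly. -/
lemma integral_sub_mul_sub {A B C D : ℝ → ℝ} {p q r s : ℝ}
    (hAC : Integrable (fun x => A x * C x)) (hAD : Integrable (fun x => A x * D x))
    (hBC : Integrable (fun x => B x * C x)) (hBD : Integrable (fun x => B x * D x)) :
    ∫ x, (p * A x - q * B x) * (r * C x - s * D x) =
      p * r * (∫ x, A x * C x) - p * s * (∫ x, A x * D x) - q * r * (∫ x, B x * C x)
        + q * s * ∫ x, B x * D x := by
  have h : ∀ x, (p * A x - q * B x) * (r * C x - s * D x) =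
      p * r * (A x * C x) - p * s * (A x * D x) - q * r * (B x * C x) + q * s * (B x * D x) :=
    fun x => by ring
  simp only [h]
  have h1 : Integrable (fun x => p * r * (A x * C x) - p * s * (A x * D x)) :=
    (hAC.const_mul _).sub (hAD.const_mul _)
  have h2 : Integrable
      (fun x => p * r * (A x * C x) - p * s * (A x * D x) - q * r * (B x * C x)) :=
    h1.sub (hBC.const_mul _)
  rw [integral_add h2 (hBD.const_mul _), integral_sub h1 (hBC.const_mul _),
    integral_sub (hAC.const_mul _) (hAD.const_mul _)]
  simp only [integral_const_mul]

lemma integral_ratKernel_mul_ratKernel {θ l m : ℝ} (hθ : 0 < θ) (hl : 0 < l) (hm : 0 < m)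
    (hlθ : l ≠ θ) (hmθ : m ≠ θ) :
    ∫ x, ratKernel θ l x * ratKernel θ m x
      = π / 2 * ∫ x, expKernel θ l x * expKernel θ m x := by
  have h1 : ∀ x, ratKernel θ l x * ratKernel θ m x
      = ((l ^ 2 - θ ^ 2)⁻¹ * (m ^ 2 - θ ^ 2)⁻¹) *
        ((l ^ 2 * (l ^ 2 + x ^ 2)⁻¹ - θ ^ 2 * (θ ^ 2 + x ^ 2)⁻¹) *
          (m ^ 2 * (m ^ 2 + x ^ 2)⁻¹ - θ ^ 2 * (θ ^ 2 + x ^ 2)⁻¹)) := by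
    intro x
    rw [ratKernel_eq hl hθ hlθ, ratKernel_eq hm hθ hmθ]
    ring
  have h2 : ∀ x, expKernel θ l x * expKernel θ m x
      = ((l ^ 2 - θ ^ 2)⁻¹ * (m ^ 2 - θ ^ 2)⁻¹) *
        ((l * exp (-l * |x|) - θ * exp (-θ * |x|)) *
          (m * exp (-m * |x|) - θ * exp (-θ * |x|))) := by
    intro x
    simp only [expKernel, div_eq_mul_inv]
    ring
  simp only [h1, h2, integral_const_mul]
  rw [integral_sub_mul_sub (integrable_and_integral_inv_sq_add_sq_mul hl hm).1
      (integrable_and_integral_inv_sq_add_sq_mul hl hθ).1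
      (integrable_and_integral_inv_sq_add_sq_mul hθ hm).1
      (integrable_and_integral_inv_sq_add_sq_mul hθ hθ).1,
    integral_sub_mul_sub (integral_exp_neg_abs_mul_exp_neg_abs hl hm).1
      (integral_exp_neg_abs_mul_exp_neg_abs hl hθ).1
      (integral_exp_neg_abs_mul_exp_neg_abs hθ hm).1
      (integral_exp_neg_abs_mul_exp_neg_abs hθ hθ).1,
    (integrable_and_integral_inv_sq_add_sq_mul hl hm).2,
    (integrable_and_integral_inv_sq_add_sq_mul hl hθ).2,
    (integrable_and_integral_inv_sq_add_sq_mul hθ hm).2,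
    (integrable_and_integral_inv_sq_add_sq_mul hθ hθ).2,
    (integral_exp_neg_abs_mul_exp_neg_abs hl hm).2,
    (integral_exp_neg_abs_mul_exp_neg_abs hl hθ).2,
    (integral_exp_neg_abs_mul_exp_neg_abs hθ hm).2,
    (integral_exp_neg_abs_mul_exp_neg_abs hθ hθ).2]
  have key : ∀ u v : ℝ, 0 < u → 0 < v →
      u ^ 2 * v ^ 2 * (π / (u * v * (u + v))) = π / 2 * (u * v * (2 / (u + v))) := by
    intro u v hu hv
    field_simp
  rw [key l m hl hm, key l θ hl hθ, key θ m hθ hm, key θ θ hθ hθ]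
  ring

lemma expKernel_comm (θ l x : ℝ) : expKernel θ l x = expKernel l θ x := by
  rw [expKernel, expKernel, ← neg_div_neg_eq]
  congr 1 <;> ring

lemma abs_weighted_exp_sub_le {θ l y : ℝ} (hθ : 0 < θ) (h : θ < l) (hy : 0 ≤ y) :
    |l * exp (-l * y) - θ * exp (-θ * y)| ≤
      (l - θ) * exp (-l * y) + θ * (exp (-θ * y) - exp (-l * y)) := by
  have h1 : exp (-l * y) ≤ exp (-θ * y) := exp_le_exp.2 (by nlinarith)
  have h2 := exp_pos (-l * y)
  rw [abs_le]
  constructor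
  · nlinarith [mul_pos (sub_pos.2 h) h2]
  · nlinarith [mul_nonneg hθ.le (sub_nonneg.2 h1)]

lemma abs_expKernel_le {θ l : ℝ} (hl : 0 < l) (hθ : 0 < θ) (x : ℝ) :
    |expKernel θ l x| ≤ (l + θ)⁻¹ := by
  wlog h : θ < l generalizing θ l
  · rcases eq_or_lt_of_le (not_lt.1 h) with rfl | h'
    · simp only [expKernel, sub_self, div_zero, abs_zero]
      positivity
    · rw [expKernel_comm, add_comm]
      exact this hθ hl h'
  have hd : l ^ 2 - θ ^ 2 = (l - θ) * (l + θ) := by ring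
  have hp : 0 < l - θ := sub_pos.2 h
  rw [expKernel, abs_div, hd, abs_of_pos (a := (l - θ) * (l + θ)) (by positivity),
    div_le_iff₀ (by positivity), mul_comm (l - θ), inv_mul_cancel_left₀ (by positivity)]
  set y := |x|
  have hy : 0 ≤ y := abs_nonneg x
  have h1 : exp (-l * y) ≤ exp (-θ * y) := exp_le_exp.2 (by nlinarith)
  have h1' : exp (-θ * y) ≤ 1 := exp_le_one_iff.2 (by nlinarith)
  have h2 := exp_pos (-l * y)
  have h3 : exp (-θ * y) - exp (-l * y) ≤ (l - θ) * y * exp (-θ * y) := by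
    have : exp (-l * y) = exp (-θ * y) * exp (-((l - θ) * y)) := by rw [← exp_add]; ring_nf
    have h4 := add_one_le_exp (-((l - θ) * y))
    rw [this]
    nlinarith [exp_pos (-θ * y)]
  have h5 : θ * y * exp (-θ * y) ≤ 1 := by
    have h6 := add_one_le_exp (θ * y)
    have h7 : exp (θ * y) * exp (-θ * y) = 1 := by rw [← exp_add]; simp
    nlinarith [exp_pos (-θ * y)]
  rw [abs_le]
  constructor
  · have h8 : θ * (exp (-θ * y) - exp (-l * y)) ≤ (l - θ) * (θ * y * exp (-θ * y)) := by
      nlinarith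
    nlinarith [mul_le_mul_of_nonneg_left h5 hp.le]
  · nlinarith

lemma integrable_and_integral_exp_neg_abs {l : ℝ} (hl : 0 < l) :
    Integrable (fun x : ℝ => exp (-l * |x|)) ∧ ∫ x : ℝ, exp (-l * |x|) = 2 / l := by
  have h := integral_exp_neg_abs_mul_exp_neg_abs (l := l / 2) (m := l / 2) (by positivity)
    (by positivity)
  have e : ∀ x : ℝ, exp (-(l / 2) * |x|) * exp (-(l / 2) * |x|) = exp (-l * |x|) := by
    intro x; rw [← exp_add]; ring_nf
  simpa only [e, add_halves] using h

lemma integrable_and_integral_abs_expKernel_le {θ l : ℝ} (hl : 0 < l) (hθ : 0 < θ) :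
    Integrable (expKernel θ l) ∧ ∫ x, |expKernel θ l x| ≤ 4 / θ * (l + θ)⁻¹ := by
  obtain ⟨il, el⟩ := integrable_and_integral_exp_neg_abs hl
  obtain ⟨it, et⟩ := integrable_and_integral_exp_neg_abs hθ
  have hint : Integrable (expKernel θ l) :=
    ((il.const_mul _).sub (it.const_mul _)).div_const _
  refine ⟨hint, ?_⟩
  suffices ∫ x, |expKernel θ l x| ≤ 4 / max l θ * (l + θ)⁻¹ by
    refine this.trans ?_
    gcongr
    exact le_max_right _ _
  wlog h : θ < l generalizing θ l
  · rcases eq_or_lt_of_le (not_lt.1 h) with rfl | h'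
    · simp only [expKernel, sub_self, div_zero, abs_zero, integral_zero]
      positivity
    · simp only [expKernel_comm θ l]
      rw [add_comm, max_comm]
      refine this hθ hl it et il el ?_ h'
      exact ((it.const_mul _).sub (il.const_mul _)).div_const _
  have hp : 0 < l - θ := sub_pos.2 h
  have hd : l ^ 2 - θ ^ 2 = (l - θ) * (l + θ) := by ring
  have hpt : ∀ x, |expKernel θ l x| ≤ ((l - θ) * (l + θ))⁻¹ *
      ((l - θ) * exp (-l * |x|) + θ * (exp (-θ * |x|) - exp (-l * |x|))) := by
    intro x
    rw [expKernel, abs_div, hd, abs_of_pos (a := (l - θ) * (l + θ)) (by positivity),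
      div_eq_inv_mul]
    gcongr
    exact abs_weighted_exp_sub_le hθ h (abs_nonneg x)
  have i1 : Integrable (fun x : ℝ => θ * (exp (-θ * |x|) - exp (-l * |x|))) :=
    (it.sub il).const_mul _
  refine (integral_mono hint.abs (((il.const_mul _).add i1).const_mul _) hpt).trans_eq ?_
  simp only [Pi.add_apply]
  rw [integral_const_mul, integral_add (il.const_mul _) i1,
    integral_const_mul, integral_const_mul, integral_sub it il, el, et, max_eq_left h.le]
  field_simp
  ring

end Kernels

section Profile

open Real Set

lemma integrableOn_rpow_neg_mul_inv_add {a θ : ℝ} (ha : 0 < a) (ha1 : a < 1) (hθ : 0 < θ) :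
    IntegrableOn (fun l : ℝ => l ^ (-a) * (l + θ)⁻¹) (Ioi 0) := by
  rw [← Ioc_union_Ioi_eq_Ioi zero_le_one]
  have hm : Measurable (fun l : ℝ => l ^ (-a) * (l + θ)⁻¹) := by fun_prop
  refine IntegrableOn.union ?_ ?_
  · have h1 : IntegrableOn (fun l : ℝ => l ^ (-a)) (Ioc 0 1) :=
      (intervalIntegrable_iff_integrableOn_Ioc_of_le zero_le_one).1
        (intervalIntegral.intervalIntegrable_rpow' (by linarith))
    refine (h1.mul_const θ⁻¹).mono' hm.aestronglyMeasurable ?_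
    refine (ae_restrict_iff' measurableSet_Ioc).2 (ae_of_all _ fun l hl => ?_)
    have hl0 : 0 < l := hl.1
    rw [norm_of_nonneg (by positivity)]
    gcongr
    linarith
  · have h1 : IntegrableOn (fun l : ℝ => l ^ (-a - 1)) (Ioi 1) :=
      integrableOn_Ioi_rpow_of_lt (by linarith) one_pos
    refine h1.mono' hm.aestronglyMeasurable ?_
    refine (ae_restrict_iff' measurableSet_Ioi).2 (ae_of_all _ fun l (hl : 1 < l) => ?_)
    have hl0 : 0 < l := by linarith
    rw [norm_of_nonneg (by positivity), rpow_sub_one hl0.ne', div_eq_mul_inv]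
    gcongr
    linarith

/-- Up to the factor `2 * θ / Γ(1 - a)`, the stationary limit of the covariance kernel. -/
noncomputable def profile (a θ x : ℝ) : ℝ :=
  ∫ l in Ioi (0 : ℝ), l ^ (-a) * expKernel θ l x

lemma ae_restrict_Ioi_pos_ne (θ : ℝ) : ∀ᵐ l ∂(volume.restrict (Ioi (0 : ℝ))), 0 < l ∧ l ≠ θ := by
  have h1 : ∀ᵐ l ∂(volume.restrict (Ioi (0 : ℝ))), l ∈ Ioi (0 : ℝ) :=
    ae_restrict_mem measurableSet_Ioi
  have h2 : ∀ᵐ l ∂(volume.restrict (Ioi (0 : ℝ))), l ≠ θ := Measure.ae_ne _ θ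
  filter_upwards [h1, h2] with l hl hl' using ⟨hl, hl'⟩

lemma measurable_weighted_expKernel (a θ : ℝ) :
    Measurable (Function.uncurry fun l x : ℝ => l ^ (-a) * expKernel θ l x) := by
  unfold expKernel Function.uncurry
  fun_prop

lemma measurable_weighted_ratKernel (a θ : ℝ) :
    Measurable (Function.uncurry fun l x : ℝ => l ^ (-a) * ratKernel θ l x) := by
  unfold ratKernel Function.uncurry
  fun_prop

lemma ae_abs_weighted_expKernel_le {a θ : ℝ} (hθ : 0 < θ) :
    ∀ᵐ l ∂(volume.restrict (Ioi (0 : ℝ))), ∀ x,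
      |l ^ (-a) * expKernel θ l x| ≤ l ^ (-a) * (l + θ)⁻¹ := by
  filter_upwards [ae_restrict_Ioi_pos_ne θ] with l hl x
  have := hl.1
  rw [abs_mul, abs_of_nonneg (by positivity)]
  gcongr
  exact abs_expKernel_le hl.1 hθ x

lemma ae_abs_weighted_ratKernel_le {a θ : ℝ} (hθ : 0 < θ) :
    ∀ᵐ l ∂(volume.restrict (Ioi (0 : ℝ))), ∀ x,
      |l ^ (-a) * ratKernel θ l x| ≤ 2 / θ * (l ^ (-a) * (l + θ)⁻¹) := by
  filter_upwards [ae_restrict_Ioi_pos_ne θ] with l hl x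
  have := hl.1
  rw [abs_mul, abs_of_nonneg (by positivity), abs_of_nonneg (ratKernel_nonneg θ l x),
    mul_left_comm]
  gcongr
  exact ratKernel_le hl.1 hθ x

/-- A jointly measurable weighted kernel whose `L¹` norm in the second variable decays like
`(l + θ)⁻¹` is integrable on the product. -/
lemma integrable_weighted_kernel {a θ C : ℝ} (ha : 0 < a) (ha1 : a < 1) (hθ : 0 < θ)
    {K : ℝ → ℝ → ℝ} (hm : Measurable (Function.uncurry fun l x : ℝ => l ^ (-a) * K l x))
    (hK : ∀ᵐ l ∂(volume.restrict (Ioi (0 : ℝ))),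
      Integrable (K l) ∧ ∫ x, |K l x| ≤ C * (l + θ)⁻¹) :
    Integrable (Function.uncurry fun l x : ℝ => l ^ (-a) * K l x)
      ((volume.restrict (Ioi 0)).prod volume) := by
  rw [integrable_prod_iff hm.aestronglyMeasurable]
  refine ⟨?_, ?_⟩
  · filter_upwards [hK] with l hl using hl.1.const_mul (l ^ (-a))
  · refine ((integrableOn_rpow_neg_mul_inv_add ha ha1 hθ).const_mul C).mono'
      hm.stronglyMeasurable.norm.integral_prod_right.aestronglyMeasurable ?_
    filter_upwards [hK, ae_restrict_Ioi_pos_ne θ] with l hl hl0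
    have := hl0.1
    rw [norm_of_nonneg (integral_nonneg fun x => norm_nonneg _)]
    simp only [Function.uncurry_apply_pair, norm_mul, norm_eq_abs]
    rw [integral_const_mul, abs_of_nonneg (by positivity), mul_left_comm]
    gcongr
    exact hl.2

lemma integrable_weighted_expKernel {a θ : ℝ} (ha : 0 < a) (ha1 : a < 1) (hθ : 0 < θ) :
    Integrable (Function.uncurry fun l x : ℝ => l ^ (-a) * expKernel θ l x)
      ((volume.restrict (Ioi 0)).prod volume) := by
  refine integrable_weighted_kernel ha ha1 hθ (C := 4 / θ) (measurable_weighted_expKernel a θ) ?_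
  filter_upwards [ae_restrict_Ioi_pos_ne θ] with l hl
  exact integrable_and_integral_abs_expKernel_le hl.1 hθ

lemma integrable_weighted_ratKernel {a θ : ℝ} (ha : 0 < a) (ha1 : a < 1) (hθ : 0 < θ) :
    Integrable (Function.uncurry fun l x : ℝ => l ^ (-a) * ratKernel θ l x)
      ((volume.restrict (Ioi 0)).prod volume) := by
  refine integrable_weighted_kernel ha ha1 hθ (C := π) (measurable_weighted_ratKernel a θ) ?_
  filter_upwards [ae_restrict_Ioi_pos_ne θ] with l hl
  have h := integrable_and_integral_ratKernel hl.1 hθ hl.2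
  refine ⟨h.1, ?_⟩
  simp only [abs_of_nonneg (ratKernel_nonneg θ l _), h.2, le_refl]

lemma measurable_profile (a θ : ℝ) : Measurable (profile a θ) :=
  (measurable_weighted_expKernel a θ).stronglyMeasurable.integral_prod_left.measurable

lemma profile_neg (a θ x : ℝ) : profile a θ (-x) = profile a θ x := by
  simp only [profile, expKernel, abs_neg]

lemma integrable_profile {a θ : ℝ} (ha : 0 < a) (ha1 : a < 1) (hθ : 0 < θ) :
    Integrable (profile a θ) :=
  (integrable_weighted_expKernel ha ha1 hθ).integral_prod_right

lemma integral_weighted_ratKernel {a θ : ℝ} (ha : 0 < a) (ha1 : a < 1) {x : ℝ} (hx : x ≠ 0) :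
    ∫ l in Ioi (0 : ℝ), l ^ (-a) * ratKernel θ l x
      = Gamma ((1 - a) / 2) * Gamma ((1 + a) / 2) / 2 *
        (|x| ^ (1 - a) * (θ ^ 2 + |x| ^ 2)⁻¹) := by
  have hx0 : 0 < |x| := abs_pos.2 hx
  have h1 : ∀ l : ℝ, l ^ (-a) * ratKernel θ l x =
      (|x| ^ 2 * (θ ^ 2 + |x| ^ 2)⁻¹) * (l ^ (-a) * (|x| ^ 2 + l ^ 2) ^ (-1 : ℝ)) := by
    intro l
    rw [ratKernel, rpow_neg_one, sq_abs, add_comm (x ^ 2) (l ^ 2)]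
    ring
  simp only [h1]
  rw [integral_const_mul, integral_rpow_mul_sq_add_sq_rpow (by linarith) (by linarith) hx0,
    Gamma_one, show (1 : ℝ) - (-a + 1) / 2 = (1 + a) / 2 by ring,
    show -a + 1 - 2 * 1 = (1 - a) - (2 : ℕ) by push_cast; ring, rpow_sub_natCast hx0.ne',
    show (-a + 1) / 2 = (1 - a) / 2 by ring]
  field_simp

lemma integrable_and_integral_profile_sq {a θ : ℝ} (ha : 0 < a) (ha1 : a < 1) (hθ : 0 < θ) :
    Integrable (fun x => profile a θ x ^ 2) ∧ ∫ x, profile a θ x ^ 2 =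
      2 / π * (Gamma ((1 - a) / 2) * Gamma ((1 + a) / 2) / 2) ^ 2 *
        (θ ^ (-1 - 2 * a) * Gamma (3 / 2 - a) * Gamma (1 / 2 + a)) := by
  have hE := integral_sq_integral_eq (integrable_weighted_expKernel ha ha1 hθ)
    (measurable_weighted_expKernel a θ) (integrableOn_rpow_neg_mul_inv_add ha ha1 hθ)
    (ae_abs_weighted_expKernel_le hθ)
  have hR := integral_sq_integral_eq (integrable_weighted_ratKernel ha ha1 hθ)
    (measurable_weighted_ratKernel a θ)
    ((integrableOn_rpow_neg_mul_inv_add ha ha1 hθ).const_mul (2 / θ))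
    (ae_abs_weighted_ratKernel_le hθ)
  refine ⟨hE.1, ?_⟩
  have hER : ∫ x, (∫ l in Ioi (0 : ℝ), l ^ (-a) * ratKernel θ l x) ^ 2
      = π / 2 * ∫ x, profile a θ x ^ 2 := by
    unfold profile
    rw [hE.2, hR.2, ← integral_const_mul]
    refine integral_congr_ae ?_
    filter_upwards [ae_restrict_Ioi_pos_ne θ] with l hl
    rw [← integral_const_mul]
    refine integral_congr_ae ?_
    filter_upwards [ae_restrict_Ioi_pos_ne θ] with m hm
    have e : ∀ K : ℝ → ℝ → ℝ, ∀ x, l ^ (-a) * K l x * (m ^ (-a) * K m x)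
        = l ^ (-a) * m ^ (-a) * (K l x * K m x) := fun K x => by ring
    simp only [e, integral_const_mul]
    rw [integral_ratKernel_mul_ratKernel hθ hl.1 hm.1 hl.2 hm.2]
    ring
  have hsq : ∫ x, (∫ l in Ioi (0 : ℝ), l ^ (-a) * ratKernel θ l x) ^ 2
      = ∫ x : ℝ, (Gamma ((1 - a) / 2) * Gamma ((1 + a) / 2) / 2) ^ 2 *
        (|x| ^ (1 - a) * (θ ^ 2 + |x| ^ 2)⁻¹) ^ 2 := by
    refine integral_congr_ae ?_
    filter_upwards [Measure.ae_ne volume (0 : ℝ)] with x hx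
    rw [integral_weighted_ratKernel ha ha1 hx, mul_pow]
  have hI : ∫ x in Ioi (0 : ℝ), (x ^ (1 - a) * (θ ^ 2 + x ^ 2)⁻¹) ^ 2
      = θ ^ (-1 - 2 * a) * Gamma (3 / 2 - a) * Gamma (1 / 2 + a) / 2 := by
    have h2 : ∀ x ∈ Ioi (0 : ℝ), (x ^ (1 - a) * (θ ^ 2 + x ^ 2)⁻¹) ^ 2
        = x ^ (2 - 2 * a) * (θ ^ 2 + x ^ 2) ^ (-2 : ℝ) := by
      intro x (hx : 0 < x)
      rw [mul_pow, rpow_neg (by positivity), rpow_two, inv_pow, ← rpow_natCast (x ^ (1 - a)),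
        ← rpow_mul hx.le]
      congr 2
      push_cast
      ring
    rw [setIntegral_congr_fun measurableSet_Ioi h2,
      integral_rpow_mul_sq_add_sq_rpow (by linarith) (by linarith) hθ, Gamma_two]
    ring_nf
  rw [hsq, integral_const_mul,
    integral_comp_abs (f := fun x => (x ^ (1 - a) * (θ ^ 2 + x ^ 2)⁻¹) ^ 2), hI] at hER
  have hX : ∀ X : ℝ, X = 2 / π * (π / 2 * X) := fun X => by field_simp
  rw [hX (∫ x, profile a θ x ^ 2), ← hER]
  ring

end Profile

section Constant

open Real

/-- Reflection formula in the form needed for `a ∈ (0, 1)`; both sides are continuous at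
`a = 1 / 2`, where the generic formula degenerates. -/
lemma gamma_three_halves_sub_mul_gamma_half_add {a : ℝ} (ha : 0 < a) (ha1 : a < 1) :
    8 * sin (π * a / 2) ^ 2 * (Gamma (3 / 2 - a) * Gamma (1 / 2 + a)) =
      2 * π * (2 * a - 1) + 4 * sin (π * a) * (Gamma (2 - 2 * a) * Gamma (2 * a)) := by
  have hsin : 0 < sin (π * a) :=
    sin_pos_of_pos_of_lt_pi (by positivity) (by nlinarith [pi_pos])
  have hcos2 : cos (π * a) = 1 - 2 * sin (π * a / 2) ^ 2 := by
    have := cos_two_mul (π * a / 2)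
    rw [show 2 * (π * a / 2) = π * a by ring] at this
    rw [this, cos_sq']
    ring
  rcases eq_or_ne a (1 / 2) with rfl | hne
  · norm_num at hcos2 ⊢
    rw [show π * (1 / 2) = π / 2 by ring, cos_pi_div_two] at hcos2
    rw [show π * (1 / 2) = π / 2 by ring, sin_pi_div_two]
    linarith
  · have hc : cos (π * a) ≠ 0 := by
      intro h
      rw [← sin_pi_div_two_sub] at h
      rw [sin_eq_zero_iff_of_lt_of_lt (by nlinarith [pi_pos]) (by nlinarith [pi_pos])] at h
      have h' : π * (1 / 2 - a) = 0 := by linarith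
      rcases mul_eq_zero.1 h' with h'' | h''
      · exact pi_ne_zero h''
      · exact hne (by linarith)
    have h1 : Gamma (3 / 2 - a) * Gamma (1 / 2 + a) = (1 / 2 - a) * (π / cos (π * a)) := by
      have h := Gamma_mul_Gamma_one_sub (1 / 2 + a)
      rw [show π * (1 / 2 + a) = π * a + π / 2 by ring, sin_add_pi_div_two,
        show (1 : ℝ) - (1 / 2 + a) = 1 / 2 - a by ring] at h
      rw [show (3 : ℝ) / 2 - a = (1 / 2 - a) + 1 by ring,
        Gamma_add_one (by intro h'; apply hne; linarith), ← h]
      ring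
    have h2 : Gamma (2 - 2 * a) * Gamma (2 * a) = (1 - 2 * a) * (π / sin (2 * (π * a))) := by
      have h := Gamma_mul_Gamma_one_sub (2 * a)
      rw [show π * (2 * a) = 2 * (π * a) by ring] at h
      rw [show (2 : ℝ) - 2 * a = (1 - 2 * a) + 1 by ring,
        Gamma_add_one (by intro h'; apply hne; linarith), ← h]
      ring
    rw [h1, h2, sin_two_mul]
    have h3 : sin (π * a / 2) ^ 2 = (1 - cos (π * a)) / 2 := by linarith
    rw [h3]
    field_simp
    ring

lemma limit_constant_eq {a θ : ℝ} (ha : 0 < a) (ha1 : a < 1) (hθ : 0 < θ) :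
    2 * ((2 * θ / Gamma (1 - a)) ^ 2 *
        (2 / π * (Gamma ((1 - a) / 2) * Gamma ((1 + a) / 2) / 2) ^ 2 *
          (θ ^ (-1 - 2 * a) * Gamma (3 / 2 - a) * Gamma (1 / 2 + a)))) =
      4 * θ ^ (1 - 2 * a) * Gamma a ^ 2 *
        ((2 * a - 1) + 2 * Gamma (2 - 2 * a) * Gamma (2 * a) / (Gamma a * Gamma (1 - a))) := by
  have hsin : 0 < sin (π * a) :=
    sin_pos_of_pos_of_lt_pi (by positivity) (by nlinarith [pi_pos])
  have hC : 0 < cos (π * a / 2) := cos_pos_of_mem_Ioo ⟨by nlinarith [pi_pos], by nlinarith [pi_pos]⟩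
  have hG : 0 < Gamma a := Gamma_pos_of_pos ha
  have hS2 : sin (π * a) = 2 * sin (π * a / 2) * cos (π * a / 2) := by
    rw [← sin_two_mul]; ring_nf
  have h1 : Gamma ((1 - a) / 2) * Gamma ((1 + a) / 2) = π / cos (π * a / 2) := by
    have h := Gamma_mul_Gamma_one_sub ((1 - a) / 2)
    rw [show (1 : ℝ) - (1 - a) / 2 = (1 + a) / 2 by ring,
      show π * ((1 - a) / 2) = π / 2 - π * a / 2 by ring, sin_pi_div_two_sub] at h
    exact h
  have h2 : Gamma (1 - a) = π / (sin (π * a) * Gamma a) := by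
    have h := Gamma_mul_Gamma_one_sub a
    field_simp
    field_simp at h
    linarith
  have hθ2 : θ ^ (1 - 2 * a) = θ ^ 2 * θ ^ (-1 - 2 * a) := by
    rw [show 1 - 2 * a = (-1 - 2 * a) + (2 : ℕ) by push_cast; ring, rpow_add_natCast hθ.ne']
    ring
  have h3 := gamma_three_halves_sub_mul_gamma_half_add ha ha1
  rw [h1, h2, hθ2]
  set X := Gamma (3 / 2 - a)
  set Y := Gamma (1 / 2 + a)
  set U := Gamma (2 - 2 * a)
  set V := Gamma (2 * a)
  have hπ := pi_ne_zero
  have h4 : (2 * a - 1) + 2 * U * V / (Gamma a * (π / (sin (π * a) * Gamma a)))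
      = (2 * π * (2 * a - 1) + 4 * sin (π * a) * (U * V)) / (2 * π) := by
    field_simp
    ring
  rw [h4, ← h3, hS2]
  field_simp
  ring

end Constant

section PrelimitKernel

open Real Set

/-- Derivative kernel of `exp (-θ * |x|)`, up to sign. -/
noncomputable def signedExp (θ x : ℝ) : ℝ := θ * Real.sign x * exp (-θ * |x|)

/-- Odd extension of `x ^ (a - 1)`. -/
noncomputable def signedPow (a x : ℝ) : ℝ := Real.sign x * |x| ^ (a - 1)

lemma measurable_real_sign : Measurable Real.sign := by
  unfold Real.sign
  exact Measurable.ite measurableSet_Iio measurable_const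
    (Measurable.ite measurableSet_Ioi measurable_const measurable_const)

lemma abs_real_sign_le_one (x : ℝ) : |Real.sign x| ≤ 1 := by
  rcases Real.sign_apply_eq x with h | h | h <;> simp [h]

lemma measurable_signedExp (θ : ℝ) : Measurable (signedExp θ) := by
  have := measurable_real_sign
  unfold signedExp
  fun_prop

lemma measurable_signedPow (a : ℝ) : Measurable (signedPow a) := by
  have := measurable_real_sign
  unfold signedPow
  fun_prop

lemma signedExp_neg (θ x : ℝ) : signedExp θ (-x) = -signedExp θ x := by
  simp [signedExp, Real.sign_neg]

lemma signedPow_neg (a x : ℝ) : signedPow a (-x) = -signedPow a x := by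
  simp [signedPow, Real.sign_neg]

lemma abs_signedExp_le {θ : ℝ} (hθ : 0 < θ) (x : ℝ) : |signedExp θ x| ≤ θ := by
  rw [signedExp, abs_mul, abs_mul, abs_of_pos hθ, abs_of_pos (exp_pos _)]
  have h1 := abs_real_sign_le_one x
  have h2 : exp (-θ * |x|) ≤ 1 := exp_le_one_iff.2 (by nlinarith [abs_nonneg x])
  calc θ * |Real.sign x| * exp (-θ * |x|) ≤ θ * 1 * 1 := by gcongr
    _ = θ := by ring

lemma abs_signedPow_le (a x : ℝ) : |signedPow a x| ≤ |x| ^ (a - 1) := by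
  rw [signedPow, abs_mul, abs_of_nonneg (rpow_nonneg (abs_nonneg x) _)]
  exact mul_le_of_le_one_left (rpow_nonneg (abs_nonneg x) _) (abs_real_sign_le_one x)

lemma integral_exp_mul_add {c : ℝ} (hc : c ≠ 0) (d x y : ℝ) :
    ∫ u in x..y, exp (c * u + d) = (exp (c * y + d) - exp (c * x + d)) / c := by
  rw [intervalIntegral.integral_comp_mul_add (fun v => exp v) hc, integral_exp, smul_eq_mul,
    inv_mul_eq_div]

lemma intervalIntegrable_signedExp_mul {θ l : ℝ} (hθ : 0 < θ) (hl : 0 < l) (s t x y : ℝ) :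
    IntervalIntegrable (fun u => signedExp θ (s - u) * signedExp l (t - u)) volume x y := by
  have hm : Measurable (fun u => signedExp θ (s - u) * signedExp l (t - u)) :=
    ((measurable_signedExp θ).comp (measurable_const.sub measurable_id)).mul
      ((measurable_signedExp l).comp (measurable_const.sub measurable_id))
  refine (intervalIntegrable_const (c := θ * l)).mono_fun hm.aestronglyMeasurable ?_
  refine ae_of_all _ fun u => ?_
  beta_reduce
  rw [norm_mul, norm_of_nonneg (mul_pos hθ hl).le]
  exact mul_le_mul (abs_signedExp_le hθ _) (abs_signedExp_le hl _) (norm_nonneg _) hθ.le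

lemma signedExp_of_pos (θ : ℝ) {x : ℝ} (hx : 0 < x) : signedExp θ x = θ * exp (-θ * x) := by
  rw [signedExp, Real.sign_of_pos hx, abs_of_pos hx, mul_one]

lemma signedExp_of_neg (θ : ℝ) {x : ℝ} (hx : x < 0) : signedExp θ x = -(θ * exp (θ * x)) := by
  rw [signedExp, Real.sign_of_neg hx, abs_of_neg hx]
  ring_nf

lemma integral_signedExp_mul_signedExp {θ l s t T : ℝ} (hθ : 0 < θ) (hl : 0 < l) (hne : l ≠ θ)
    (hs : s ∈ Icc 0 T) (ht : t ∈ Icc 0 T) :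
    ∫ u in (0 : ℝ)..T, signedExp θ (s - u) * signedExp l (t - u) =
      l * (2 * θ * expKernel θ l (t - s) -
        θ * (l + θ)⁻¹ * (exp (-θ * s - l * t) + exp (-θ * (T - s) - l * (T - t)))) := by
  have hi := intervalIntegrable_signedExp_mul hθ hl s t
  have hp : θ + l ≠ 0 := by positivity
  have hd := sq_sub_sq_ne_zero_of_pos hl hθ hne
  have hd1 : l - θ ≠ 0 := sub_ne_zero.2 hne
  have hd2 : θ - l ≠ 0 := sub_ne_zero.2 hne.symm
  rcases le_total s t with hst | hst
  · have e1 : ∫ u in (0 : ℝ)..s, signedExp θ (s - u) * signedExp l (t - u)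
        = ∫ u in (0 : ℝ)..s, θ * l * exp ((θ + l) * u + (-θ * s - l * t)) := by
      refine intervalIntegral.integral_congr_Ioo_of_le hs.1 fun u hu => ?_
      rw [signedExp_of_pos θ (by linarith [hu.2]), signedExp_of_pos l (by linarith [hu.2]),
        mul_mul_mul_comm, ← exp_add]
      ring_nf
    have e2 : ∫ u in s..t, signedExp θ (s - u) * signedExp l (t - u)
        = ∫ u in s..t, -(θ * l) * exp ((l - θ) * u + (θ * s - l * t)) := by
      refine intervalIntegral.integral_congr_Ioo_of_le hst fun u hu => ?_
      rw [signedExp_of_neg θ (by linarith [hu.1]), signedExp_of_pos l (by linarith [hu.2]),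
        neg_mul, mul_mul_mul_comm, ← exp_add]
      ring_nf
    have e3 : ∫ u in t..T, signedExp θ (s - u) * signedExp l (t - u)
        = ∫ u in t..T, θ * l * exp (-(θ + l) * u + (θ * s + l * t)) := by
      refine intervalIntegral.integral_congr_Ioo_of_le ht.2 fun u hu => ?_
      rw [signedExp_of_neg θ (by linarith [hu.1]), signedExp_of_neg l (by linarith [hu.1]),
        neg_mul_neg, mul_mul_mul_comm, ← exp_add]
      ring_nf
    rw [← intervalIntegral.integral_add_adjacent_intervals (hi 0 t) (hi t T),
      ← intervalIntegral.integral_add_adjacent_intervals (hi 0 s) (hi s t), e1, e2, e3]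
    simp only [intervalIntegral.integral_const_mul]
    rw [integral_exp_mul_add hp, integral_exp_mul_add hd1, integral_exp_mul_add (neg_ne_zero.2 hp),
      expKernel, abs_of_nonneg (sub_nonneg.2 hst),
      show (θ + l) * s + (-θ * s - l * t) = -l * (t - s) by ring,
      show (θ + l) * 0 + (-θ * s - l * t) = -θ * s - l * t by ring,
      show (l - θ) * t + (θ * s - l * t) = -θ * (t - s) by ring,
      show (l - θ) * s + (θ * s - l * t) = -l * (t - s) by ring,
      show -(θ + l) * T + (θ * s + l * t) = -θ * (T - s) - l * (T - t) by ring,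
      show -(θ + l) * t + (θ * s + l * t) = -θ * (t - s) by ring]
    rw [sq_sub_sq] at *
    rw [add_comm θ l] at *
    field_simp
    ring
  · have e1 : ∫ u in (0 : ℝ)..t, signedExp θ (s - u) * signedExp l (t - u)
        = ∫ u in (0 : ℝ)..t, θ * l * exp ((θ + l) * u + (-θ * s - l * t)) := by
      refine intervalIntegral.integral_congr_Ioo_of_le ht.1 fun u hu => ?_
      rw [signedExp_of_pos θ (by linarith [hu.2]), signedExp_of_pos l (by linarith [hu.2]),
        mul_mul_mul_comm, ← exp_add]
      ring_nf
    have e2 : ∫ u in t..s, signedExp θ (s - u) * signedExp l (t - u)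
        = ∫ u in t..s, -(θ * l) * exp (-(l - θ) * u + (-θ * s + l * t)) := by
      refine intervalIntegral.integral_congr_Ioo_of_le hst fun u hu => ?_
      rw [signedExp_of_pos θ (by linarith [hu.2]), signedExp_of_neg l (by linarith [hu.1]),
        mul_neg, mul_mul_mul_comm, ← exp_add]
      ring_nf
    have e3 : ∫ u in s..T, signedExp θ (s - u) * signedExp l (t - u)
        = ∫ u in s..T, θ * l * exp (-(θ + l) * u + (θ * s + l * t)) := by
      refine intervalIntegral.integral_congr_Ioo_of_le hs.2 fun u hu => ?_
      rw [signedExp_of_neg θ (by linarith [hu.1]), signedExp_of_neg l (by linarith [hu.1]),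
        neg_mul_neg, mul_mul_mul_comm, ← exp_add]
      ring_nf
    rw [← intervalIntegral.integral_add_adjacent_intervals (hi 0 s) (hi s T),
      ← intervalIntegral.integral_add_adjacent_intervals (hi 0 t) (hi t s), e1, e2, e3]
    simp only [intervalIntegral.integral_const_mul]
    rw [integral_exp_mul_add hp, integral_exp_mul_add (neg_ne_zero.2 hd1),
      integral_exp_mul_add (neg_ne_zero.2 hp),
      expKernel, abs_of_nonpos (sub_nonpos.2 hst),
      show (θ + l) * t + (-θ * s - l * t) = -θ * -(t - s) by ring,
      show (θ + l) * 0 + (-θ * s - l * t) = -θ * s - l * t by ring,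
      show -(l - θ) * s + (-θ * s + l * t) = -l * -(t - s) by ring,
      show -(l - θ) * t + (-θ * s + l * t) = -θ * -(t - s) by ring,
      show -(θ + l) * T + (θ * s + l * t) = -θ * (T - s) - l * (T - t) by ring,
      show -(θ + l) * s + (θ * s + l * t) = -l * -(t - s) by ring]
    rw [sq_sub_sq] at *
    rw [add_comm θ l] at *
    field_simp
    ring

end PrelimitKernel

section PrelimitBound

open Real Set

/-- The even extension of `x ^ (a - 1)`, cut off at distance `T` from the origin. -/
noncomputable def truncPow (a T x : ℝ) : ℝ := (Ioc 0 T).indicator (fun y => y ^ (a - 1)) |x|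

lemma truncPow_nonneg (a T x : ℝ) : 0 ≤ truncPow a T x :=
  indicator_nonneg (fun _ hy => rpow_nonneg hy.1.le _) _

lemma truncPow_neg (a T x : ℝ) : truncPow a T (-x) = truncPow a T x := by
  simp only [truncPow, abs_neg]

lemma measurable_truncPow (a T : ℝ) : Measurable (truncPow a T) := by
  have h : Measurable ((Ioc 0 T).indicator (fun y : ℝ => y ^ (a - 1))) :=
    Measurable.indicator (by fun_prop) measurableSet_Ioc
  exact h.comp (by fun_prop)

lemma abs_rpow_eq_truncPow {a T x : ℝ} (ha1 : a < 1) (hx : |x| ≤ T) :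
    |x| ^ (a - 1) = truncPow a T x := by
  rcases eq_or_ne x 0 with rfl | h
  · simp [truncPow, zero_rpow (by linarith : a - 1 ≠ 0)]
  · rw [truncPow, indicator_of_mem (show |x| ∈ Ioc 0 T from ⟨abs_pos.2 h, hx⟩)]

lemma integrable_truncPow {a : ℝ} (ha : 0 < a) (T : ℝ) : Integrable (truncPow a T) := by
  refine integrable_comp_abs_of_integrableOn_Ioi
    (f := (Ioc 0 T).indicator (fun y => y ^ (a - 1))) ?_
  rcases le_total 0 T with hT | hT
  · refine Integrable.integrableOn ((integrable_indicator_iff measurableSet_Ioc).2 ?_)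
    exact (intervalIntegrable_iff_integrableOn_Ioc_of_le hT).1
      (intervalIntegral.intervalIntegrable_rpow' (by linarith))
  · simp [Ioc_eq_empty (not_lt.2 hT)]

lemma abs_sub_le_of_mem_Icc {T s t : ℝ} (hs : s ∈ Icc 0 T) (ht : t ∈ Icc 0 T) : |s - t| ≤ T :=
  abs_sub_le_iff.2 ⟨by linarith [hs.2, ht.1], by linarith [hs.1, ht.2]⟩

lemma integrableOn_abs_sub_rpow {a T t : ℝ} (ha : 0 < a) (ha1 : a < 1) (ht : t ∈ Icc 0 T) :
    IntegrableOn (fun u => |t - u| ^ (a - 1)) (Ioc 0 T) := by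
  refine IntegrableOn.congr_fun ((integrable_truncPow ha T).comp_sub_left t).integrableOn
    (fun u hu => ?_) measurableSet_Ioc
  exact (abs_rpow_eq_truncPow ha1 (abs_sub_le_of_mem_Icc ht (Ioc_subset_Icc_self hu))).symm

lemma integral_weighted_exp {a r : ℝ} (ha1 : a < 1) (hr : 0 < r) :
    ∫ l in Ioi (0 : ℝ), l ^ (-a) * exp (-l * r) = Gamma (1 - a) * r ^ (a - 1) := by
  have h := integral_rpow_mul_exp_neg_mul_Ioi (a := 1 - a) (by linarith) hr
  rw [show (1 - a - 1 : ℝ) = -a by ring] at h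
  rw [one_div, inv_rpow hr.le, ← rpow_neg hr.le, neg_sub] at h
  rw [mul_comm (Gamma _), ← h]
  simp only [neg_mul, mul_comm r]

lemma integrableOn_weighted_exp {a r : ℝ} (ha1 : a < 1) (hr : 0 < r) :
    IntegrableOn (fun l : ℝ => l ^ (-a) * exp (-l * r)) (Ioi 0) := by
  refine not_imp_comm.1 integral_undef ?_
  rw [integral_weighted_exp ha1 hr]
  exact (mul_pos (Gamma_pos_of_pos (by linarith)) (rpow_pos_of_pos hr _)).ne'

/-- Convolution-type kernel on `[0, T]` whose stationary limit is `profile`. -/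
noncomputable def prelimit (a θ T s t : ℝ) : ℝ :=
  ∫ u in (0 : ℝ)..T, signedExp θ (s - u) * signedPow a (t - u)

/-- Distance to the stationary regime near the two endpoints of `[0, T]`. -/
noncomputable def boundaryDecay (θ T s : ℝ) : ℝ := exp (-θ * s) + exp (-θ * (T - s))

lemma integrable_laplace_integrand {a θ T s t : ℝ} (ha : 0 < a) (ha1 : a < 1) (hθ : 0 < θ)
    (ht : t ∈ Icc 0 T) :
    Integrable (Function.uncurry fun u l : ℝ => signedExp θ (s - u) *
      (l ^ (-a) * (Real.sign (t - u) * exp (-l * |t - u|))))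
      ((volume.restrict (Ioc 0 T)).prod (volume.restrict (Ioi 0))) := by
  have hm : Measurable (Function.uncurry fun u l : ℝ => signedExp θ (s - u) *
      (l ^ (-a) * (Real.sign (t - u) * exp (-l * |t - u|)))) := by
    have h1 := measurable_real_sign
    have h2 := measurable_signedExp θ
    unfold Function.uncurry
    fun_prop
  have hne : ∀ᵐ u ∂(volume.restrict (Ioc 0 T)), u ≠ t := Measure.ae_ne _ t
  rw [integrable_prod_iff hm.aestronglyMeasurable]
  have hpos : ∀ u, u ≠ t → 0 < |t - u| := fun u hu => abs_pos.2 (sub_ne_zero.2 hu.symm)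
  refine ⟨?_, ?_⟩
  · filter_upwards [hne] with u hu
    have h := (integrableOn_weighted_exp ha1 (hpos u hu)).const_mul
      (signedExp θ (s - u) * Real.sign (t - u))
    refine h.congr (ae_of_all _ fun l => ?_)
    simp only [Function.uncurry_apply_pair]
    ring
  · refine ((integrableOn_abs_sub_rpow ha ha1 ht).const_mul (θ * Gamma (1 - a))).mono'
      hm.stronglyMeasurable.norm.integral_prod_right.aestronglyMeasurable ?_
    filter_upwards [hne] with u hu
    rw [norm_of_nonneg (integral_nonneg fun x => norm_nonneg _), mul_assoc,
      ← integral_weighted_exp ha1 (hpos u hu), ← integral_const_mul]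
    refine integral_mono_of_nonneg (ae_of_all _ fun l => norm_nonneg _)
      ((integrableOn_weighted_exp ha1 (hpos u hu)).const_mul _) ?_
    refine (ae_restrict_iff' measurableSet_Ioi).2 (ae_of_all _ fun l (hl : 0 < l) => ?_)
    simp only [Function.uncurry_apply_pair, norm_mul, norm_eq_abs, abs_exp]
    rw [abs_of_nonneg (rpow_nonneg hl.le (-a))]
    have h1 := abs_signedExp_le hθ (s - u)
    have h2 := abs_real_sign_le_one (t - u)
    have h3 : 0 ≤ l ^ (-a) := rpow_nonneg hl.le _
    gcongr
    exact mul_le_of_le_one_left (exp_pos _).le h2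

lemma gamma_mul_prelimit {a θ T s t : ℝ} (ha : 0 < a) (ha1 : a < 1) (hθ : 0 < θ)
    (hs : s ∈ Icc 0 T) (ht : t ∈ Icc 0 T) :
    Gamma (1 - a) * prelimit a θ T s t = ∫ l in Ioi (0 : ℝ), l ^ (-a) *
      (2 * θ * expKernel θ l (t - s) -
        θ * (l + θ)⁻¹ * (exp (-θ * s - l * t) + exp (-θ * (T - s) - l * (T - t)))) := by
  have hT : 0 ≤ T := hs.1.trans hs.2
  have h1 : Gamma (1 - a) * prelimit a θ T s t = ∫ u in Ioc 0 T, ∫ l in Ioi (0 : ℝ),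
      signedExp θ (s - u) * (l ^ (-a) * (Real.sign (t - u) * exp (-l * |t - u|))) := by
    rw [prelimit, intervalIntegral.integral_of_le hT, ← integral_const_mul]
    refine integral_congr_ae ?_
    filter_upwards [(Measure.ae_ne _ t : ∀ᵐ u ∂(volume.restrict (Ioc 0 T)), u ≠ t)] with u hu
    have e : ∀ l : ℝ,
        signedExp θ (s - u) * (l ^ (-a) * (Real.sign (t - u) * exp (-l * |t - u|)))
          = signedExp θ (s - u) * Real.sign (t - u) * (l ^ (-a) * exp (-l * |t - u|)) :=
      fun l => by ring
    simp only [e]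
    rw [integral_const_mul, integral_weighted_exp ha1 (abs_pos.2 (sub_ne_zero.2 hu.symm)),
      signedPow]
    ring
  rw [h1, integral_integral_swap (integrable_laplace_integrand ha ha1 hθ ht)]
  refine integral_congr_ae ?_
  filter_upwards [ae_restrict_Ioi_pos_ne θ] with l hl
  have hl0 := hl.1
  have e : ∀ u : ℝ,
      signedExp θ (s - u) * (l ^ (-a) * (Real.sign (t - u) * exp (-l * |t - u|)))
        = l ^ (-a) * l⁻¹ * (signedExp θ (s - u) * signedExp l (t - u)) := by
    intro u
    rw [signedExp.eq_1 l]
    field_simp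
  simp only [e]
  rw [integral_const_mul, ← intervalIntegral.integral_of_le hT,
    integral_signedExp_mul_signedExp hθ hl.1 hl.2 hs ht]
  field_simp

lemma abs_prelimit_sub_profile_le {a θ T s t : ℝ} (ha : 0 < a) (ha1 : a < 1) (hθ : 0 < θ)
    (hs : s ∈ Icc 0 T) (ht : t ∈ Icc 0 T) :
    |prelimit a θ T s t - 2 * θ / Gamma (1 - a) * profile a θ (t - s)| ≤
      θ / Gamma (1 - a) * (∫ l in Ioi (0 : ℝ), l ^ (-a) * (l + θ)⁻¹) * boundaryDecay θ T s := by
  have hG : 0 < Gamma (1 - a) := Gamma_pos_of_pos (by linarith)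
  have hM := integrableOn_rpow_neg_mul_inv_add ha ha1 hθ
  have hE : IntegrableOn (fun l : ℝ => l ^ (-a) * expKernel θ l (t - s)) (Ioi 0) := by
    have hm : Measurable (fun l : ℝ => l ^ (-a) * expKernel θ l (t - s)) := by
      unfold expKernel
      fun_prop
    refine hM.mono' hm.aestronglyMeasurable ?_
    filter_upwards [ae_abs_weighted_expKernel_le hθ] with l hl using hl _
  have hbound : ∀ᵐ l ∂(volume.restrict (Ioi (0 : ℝ))),
      ‖l ^ (-a) * (θ * (l + θ)⁻¹ * (exp (-θ * s - l * t) + exp (-θ * (T - s) - l * (T - t))))‖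
        ≤ θ * boundaryDecay θ T s * (l ^ (-a) * (l + θ)⁻¹) := by
    refine (ae_restrict_iff' measurableSet_Ioi).2 (ae_of_all _ fun l (hl : 0 < l) => ?_)
    rw [norm_of_nonneg (by positivity)]
    have h1 : exp (-θ * s - l * t) ≤ exp (-θ * s) := exp_le_exp.2 (by nlinarith [ht.1])
    have h2 : exp (-θ * (T - s) - l * (T - t)) ≤ exp (-θ * (T - s)) :=
      exp_le_exp.2 (by nlinarith [ht.2])
    calc _ ≤ l ^ (-a) * (θ * (l + θ)⁻¹ * (exp (-θ * s) + exp (-θ * (T - s)))) := by gcongr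
      _ = _ := by rw [boundaryDecay]; ring
  have hm : Measurable (fun l : ℝ => l ^ (-a) * (θ * (l + θ)⁻¹ *
      (exp (-θ * s - l * t) + exp (-θ * (T - s) - l * (T - t))))) := by fun_prop
  have hR := (hM.const_mul (θ * boundaryDecay θ T s)).mono' hm.aestronglyMeasurable hbound
  have hP := gamma_mul_prelimit ha ha1 hθ hs ht
  have e : ∀ l : ℝ, l ^ (-a) * (2 * θ * expKernel θ l (t - s) - θ * (l + θ)⁻¹ *
      (exp (-θ * s - l * t) + exp (-θ * (T - s) - l * (T - t))))
      = 2 * θ * (l ^ (-a) * expKernel θ l (t - s)) - l ^ (-a) * (θ * (l + θ)⁻¹ *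
      (exp (-θ * s - l * t) + exp (-θ * (T - s) - l * (T - t)))) := fun l => by ring
  simp only [e] at hP
  rw [integral_sub (hE.const_mul _) hR, integral_const_mul, ← profile.eq_1] at hP
  have hle := norm_integral_le_of_norm_le (hM.const_mul (θ * boundaryDecay θ T s)) hbound
  rw [integral_const_mul, norm_eq_abs] at hle
  set R := ∫ l in Ioi (0 : ℝ), l ^ (-a) * (θ * (l + θ)⁻¹ *
      (exp (-θ * s - l * t) + exp (-θ * (T - s) - l * (T - t))))
  have h3 : prelimit a θ T s t - 2 * θ / Gamma (1 - a) * profile a θ (t - s)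
      = -(R / Gamma (1 - a)) := by
    field_simp
    linarith
  rw [h3, abs_neg, abs_div, abs_of_pos hG, div_le_iff₀ hG]
  refine hle.trans_eq ?_
  field_simp

lemma abs_integral_signedExp_le {θ T s : ℝ} (hθ : 0 < θ) (hs : s ∈ Icc 0 T) :
    |∫ u in (0 : ℝ)..T, signedExp θ (s - u)| ≤ boundaryDecay θ T s := by
  have hm : Measurable (fun u => signedExp θ (s - u)) :=
    (measurable_signedExp θ).comp (measurable_const.sub measurable_id)
  have hi : ∀ x y, IntervalIntegrable (fun u => signedExp θ (s - u)) volume x y := fun x y =>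
    (intervalIntegrable_const (c := θ)).mono_fun hm.aestronglyMeasurable
      (ae_of_all _ fun u => (abs_signedExp_le hθ _).trans (le_abs_self _))
  have e1 : ∫ u in (0 : ℝ)..s, signedExp θ (s - u)
      = ∫ u in (0 : ℝ)..s, θ * exp (θ * u + -θ * s) := by
    refine intervalIntegral.integral_congr_Ioo_of_le hs.1 fun u hu => ?_
    rw [signedExp_of_pos θ (by linarith [hu.2])]
    ring_nf
  have e2 : ∫ u in s..T, signedExp θ (s - u)
      = ∫ u in s..T, -θ * exp (-θ * u + θ * s) := by
    refine intervalIntegral.integral_congr_Ioo_of_le hs.2 fun u hu => ?_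
    rw [signedExp_of_neg θ (by linarith [hu.1])]
    ring_nf
  rw [← intervalIntegral.integral_add_adjacent_intervals (hi 0 s) (hi s T), e1, e2]
  simp only [intervalIntegral.integral_const_mul]
  rw [integral_exp_mul_add hθ.ne', integral_exp_mul_add (neg_ne_zero.2 hθ.ne'),
    mul_div_cancel₀ _ hθ.ne', mul_div_cancel₀ _ (neg_ne_zero.2 hθ.ne'),
    show θ * s + -θ * s = 0 by ring, show -θ * s + θ * s = 0 by ring,
    show θ * 0 + -θ * s = -θ * s by ring, show -θ * T + θ * s = -θ * (T - s) by ring,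
    boundaryDecay, abs_le]
  have h1 := exp_pos (-θ * s)
  have h2 := exp_pos (-θ * (T - s))
  constructor <;> linarith

end PrelimitBound

section Fubini

open Real Set

/-- Fubini rearrangement of a fourfold integral with two convolution-type factors. -/
lemma integral_four_fold_eq {ν : Measure ℝ} [SFinite ν] {e : ℝ → ℝ} {A : ℝ → ℝ → ℝ} {C : ℝ}
    (he : Measurable e) (hC : ∀ x, |e x| ≤ C) (hodd : ∀ x, e (-x) = -e x)
    (hA : Integrable (Function.uncurry A) (ν.prod ν)) :
    ∫ s₁, ∫ s₂, ∫ t₁, ∫ t₂, e (s₁ - t₁) * -e (s₂ - t₂) * A s₁ s₂ * A t₂ t₁ ∂ν ∂ν ∂ν ∂ν =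
      ∫ s, ∫ t, (∫ u, e (s - u) * A t u ∂ν) * (∫ u, e (t - u) * A s u ∂ν) ∂ν ∂ν := by
  refine integral_congr_ae ?_
  filter_upwards [hA.prod_right_ae] with s hs
  have hswap : Integrable (fun p : ℝ × ℝ => A p.2 p.1) (ν.prod ν) := hA.swap
  have hq : Integrable (fun t => ∫ u, e (s - u) * A t u ∂ν) ν := by
    have h : Integrable (fun p : ℝ × ℝ => e (s - p.2) * A p.1 p.2) (ν.prod ν) :=
      hA.bdd_mul (c := C) (Measurable.aestronglyMeasurable (by fun_prop))
        (ae_of_all _ fun p => hC _)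
    exact h.integral_prod_left
  have h1 : ∀ v, ∫ t₁, ∫ t₂, e (s - t₁) * -e (v - t₂) * A s v * A t₂ t₁ ∂ν ∂ν
      = ∫ t, e (t - v) * (A s v * ∫ u, e (s - u) * A t u ∂ν) ∂ν := by
    intro v
    have hi : Integrable (Function.uncurry fun t₁ t₂ : ℝ =>
        e (s - t₁) * -e (v - t₂) * A s v * A t₂ t₁) (ν.prod ν) := by
      refine hswap.bdd_mul (c := C * C * |A s v|)
        (f := fun p : ℝ × ℝ => e (s - p.1) * -e (v - p.2) * A s v)
        (Measurable.aestronglyMeasurable (by fun_prop)) (ae_of_all _ fun p => ?_)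
      rw [norm_mul, norm_mul, norm_neg]
      have := hC (s - p.1)
      have := hC (v - p.2)
      have : 0 ≤ C := (abs_nonneg _).trans (hC 0)
      simp only [norm_eq_abs]
      gcongr
    rw [integral_integral_swap hi]
    congr 1
    ext t
    rw [← neg_sub t v, hodd, neg_neg, ← integral_const_mul, ← integral_const_mul]
    congr 1
    ext u
    ring
  simp only [h1]
  have hi : Integrable (Function.uncurry fun v t : ℝ =>
      e (t - v) * (A s v * ∫ u, e (s - u) * A t u ∂ν)) (ν.prod ν) :=
    (hs.mul_prod hq).bdd_mul (c := C) (f := fun p : ℝ × ℝ => e (p.2 - p.1))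
      (Measurable.aestronglyMeasurable (by fun_prop)) (ae_of_all _ fun p => hC _)
  rw [integral_integral_swap hi]
  congr 1
  ext t
  rw [← integral_const_mul]
  congr 1
  ext v
  ring

/-- A translation kernel with integrable profile is integrable on a finite square. -/
lemma integrable_comp_sub_prod {f : ℝ → ℝ} (hf : Measurable f) (hi : Integrable f) (T : ℝ) :
    Integrable (fun p : ℝ × ℝ => f (p.2 - p.1))
      ((volume.restrict (Ioc 0 T)).prod (volume.restrict (Ioc 0 T))) := by
  have hm : Measurable (fun p : ℝ × ℝ => f (p.2 - p.1)) := by fun_prop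
  rw [integrable_prod_iff hm.aestronglyMeasurable]
  refine ⟨ae_of_all _ fun s => (hi.comp_sub_right s).restrict, ?_⟩
  refine (integrable_const (∫ x, ‖f x‖)).mono'
    hm.stronglyMeasurable.norm.integral_prod_right'.aestronglyMeasurable (ae_of_all _ fun s => ?_)
  rw [norm_of_nonneg (integral_nonneg fun x => norm_nonneg _)]
  refine (setIntegral_le_integral (hi.comp_sub_right s).norm
    (ae_of_all _ fun x => norm_nonneg _)).trans_eq ?_
  exact integral_sub_right_eq_self (fun x => ‖f x‖) s

/-- Normalized partial derivative of the fractional covariance. -/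
noncomputable def covDeriv (a t u : ℝ) : ℝ := t ^ (a - 1) - signedPow a (t - u)

lemma measurable_covDeriv (a : ℝ) : Measurable (Function.uncurry (covDeriv a)) := by
  have := measurable_signedPow a
  unfold covDeriv Function.uncurry
  fun_prop

lemma integrableOn_rpow_sub_one {a : ℝ} (ha : 0 < a) (T : ℝ) :
    IntegrableOn (fun t : ℝ => t ^ (a - 1)) (Ioc 0 T) :=
  (intervalIntegral.intervalIntegrable_rpow' (by linarith)).1

lemma integrable_covDeriv {a : ℝ} (ha : 0 < a) (ha1 : a < 1) (T : ℝ) :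
    Integrable (Function.uncurry (covDeriv a))
      ((volume.restrict (Ioc 0 T)).prod (volume.restrict (Ioc 0 T))) := by
  have h1 := (integrableOn_rpow_sub_one ha T).comp_fst (volume.restrict (Ioc 0 T))
  have h2 := integrable_comp_sub_prod (measurable_truncPow a T) (integrable_truncPow ha T) T
  refine (h1.add h2).mono' (measurable_covDeriv a).aestronglyMeasurable ?_
  rw [Measure.prod_restrict]
  refine (ae_restrict_iff' (measurableSet_Ioc.prod measurableSet_Ioc)).2
    (ae_of_all _ fun p hp => ?_)
  have h3 : |p.1 - p.2| ≤ T :=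
    abs_sub_le_of_mem_Icc (Ioc_subset_Icc_self hp.1) (Ioc_subset_Icc_self hp.2)
  have h4 := abs_signedPow_le a (p.1 - p.2)
  rw [abs_rpow_eq_truncPow ha1 h3, ← truncPow_neg, neg_sub] at h4
  have h5 : 0 ≤ p.1 ^ (a - 1) := rpow_nonneg hp.1.1.le _
  simp only [Pi.add_apply, Function.uncurry, covDeriv, norm_eq_abs]
  refine (abs_sub _ _).trans ?_
  rw [abs_of_nonneg h5]
  gcongr

/-- Inner integral of the rearranged fourfold integral. -/
noncomputable def innerKernel (a θ T s t : ℝ) : ℝ :=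
  ∫ u in (0 : ℝ)..T, signedExp θ (s - u) * covDeriv a t u

lemma measurable_innerKernel (a θ : ℝ) {T : ℝ} (hT : 0 ≤ T) :
    Measurable (fun p : ℝ × ℝ => innerKernel a θ T p.1 p.2) := by
  have h1 := measurable_signedExp θ
  have h2 := measurable_signedPow a
  have hm : Measurable (fun q : (ℝ × ℝ) × ℝ =>
      signedExp θ (q.1.1 - q.2) * covDeriv a q.1.2 q.2) := by
    unfold covDeriv
    fun_prop
  simp only [innerKernel, intervalIntegral.integral_of_le hT]
  exact (hm.stronglyMeasurable.integral_prod_right' (ν := volume.restrict (Ioc 0 T))).measurable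

lemma innerKernel_eq {a θ T s t : ℝ} (ha : 0 < a) (ha1 : a < 1) (hθ : 0 < θ) (ht : t ∈ Icc 0 T) :
    innerKernel a θ T s t =
      t ^ (a - 1) * (∫ u in (0 : ℝ)..T, signedExp θ (s - u)) - prelimit a θ T s t := by
  have hT : 0 ≤ T := ht.1.trans ht.2
  have hm : Measurable (fun u => signedExp θ (s - u)) :=
    (measurable_signedExp θ).comp (measurable_const.sub measurable_id)
  have hm2 : Measurable (fun u => signedPow a (t - u)) :=
    (measurable_signedPow a).comp (measurable_const.sub measurable_id)
  have h1 : IntervalIntegrable (fun u => signedExp θ (s - u)) volume 0 T :=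
    (intervalIntegrable_const (c := θ)).mono_fun hm.aestronglyMeasurable
      (ae_of_all _ fun u => (abs_signedExp_le hθ _).trans (le_abs_self _))
  have h2 : IntervalIntegrable (fun u => signedExp θ (s - u) * signedPow a (t - u)) volume 0 T := by
    refine (intervalIntegrable_iff_integrableOn_Ioc_of_le hT).2 ?_
    refine Integrable.bdd_mul (c := θ) ?_ hm.aestronglyMeasurable
      (ae_of_all _ fun u => abs_signedExp_le hθ _)
    exact (integrableOn_abs_sub_rpow ha ha1 ht).mono' hm2.aestronglyMeasurable
      (ae_of_all _ fun u => abs_signedPow_le _ _)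
  rw [innerKernel, prelimit, ← intervalIntegral.integral_const_mul,
    ← intervalIntegral.integral_sub (h1.const_mul _) h2]
  congr 1
  ext u
  rw [covDeriv]
  ring

lemma exists_abs_innerKernel_add_profile_le {a θ : ℝ} (ha : 0 < a) (ha1 : a < 1) (hθ : 0 < θ) :
    ∃ K, 0 ≤ K ∧ ∀ T, ∀ s ∈ Ioc 0 T, ∀ t ∈ Ioc 0 T,
      |innerKernel a θ T s t + 2 * θ / Gamma (1 - a) * profile a θ (t - s)| ≤
        K * (boundaryDecay θ T s * (1 + t ^ (a - 1))) := by
  set L := θ / Gamma (1 - a) * ∫ l in Ioi (0 : ℝ), l ^ (-a) * (l + θ)⁻¹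
  have hG : 0 < Gamma (1 - a) := Gamma_pos_of_pos (by linarith)
  have hL : 0 ≤ L := by
    refine mul_nonneg (by positivity) (setIntegral_nonneg measurableSet_Ioi fun l hl => ?_)
    have : 0 < l := hl
    positivity
  refine ⟨1 + L, by positivity, fun T s hs t ht => ?_⟩
  have hs' := Ioc_subset_Icc_self hs
  have ht' := Ioc_subset_Icc_self ht
  have h1 := abs_prelimit_sub_profile_le ha ha1 hθ hs' ht'
  have h2 := abs_integral_signedExp_le hθ hs'
  have h3 : 0 ≤ t ^ (a - 1) := rpow_nonneg ht.1.le _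
  have h4 : 0 ≤ boundaryDecay θ T s := (abs_nonneg _).trans h2
  rw [innerKernel_eq ha ha1 hθ ht',
    show ∀ x y z : ℝ, x - y + z = x - (y - z) from fun x y z => by ring]
  refine (abs_sub _ _).trans ?_
  rw [abs_mul, abs_of_nonneg h3]
  have h5 := mul_le_mul_of_nonneg_left h2 h3
  nlinarith [mul_nonneg (mul_nonneg hL h4) h3]

end Fubini

section Asymptotics

open Real Set Filter Topology

/-- Averages of a translation kernel over growing squares converge to its total integral. -/
lemma tendsto_average_comp_sub {f : ℝ → ℝ} (hf : Measurable f) (hi : Integrable f) :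
    Tendsto (fun T : ℝ => T⁻¹ * ∫ s in (0 : ℝ)..T, ∫ t in (0 : ℝ)..T, f (t - s)) atTop
      (𝓝 (∫ x, f x)) := by
  have h1 : ∀ᶠ T : ℝ in atTop, ∫ r in (0 : ℝ)..1, ∫ t in (0 : ℝ)..T, f (t - T * r)
      = T⁻¹ * ∫ s in (0 : ℝ)..T, ∫ t in (0 : ℝ)..T, f (t - s) := by
    filter_upwards [eventually_gt_atTop 0] with T hT
    rw [intervalIntegral.integral_comp_mul_left (fun s => ∫ t in (0 : ℝ)..T, f (t - s)) hT.ne',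
      mul_zero, mul_one, smul_eq_mul]
  refine Tendsto.congr' h1 ?_
  have h2 : ∫ x, f x = ∫ _ in (0 : ℝ)..1, ∫ x, f x := by simp
  rw [h2]
  refine intervalIntegral.tendsto_integral_filter_of_dominated_convergence
    (fun _ => ∫ x, ‖f x‖) ?_ ?_ intervalIntegrable_const ?_
  · filter_upwards [eventually_ge_atTop 0] with T hT
    simp only [intervalIntegral.integral_of_le hT]
    have hm : Measurable (fun p : ℝ × ℝ => f (p.2 - T * p.1)) := by fun_prop
    exact (hm.stronglyMeasurable.integral_prod_right'
      (ν := volume.restrict (Ioc 0 T))).aestronglyMeasurable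
  · filter_upwards [eventually_ge_atTop 0] with T hT
    refine ae_of_all _ fun r _ => ?_
    rw [intervalIntegral.integral_of_le hT]
    refine (norm_integral_le_integral_norm _).trans ?_
    refine (setIntegral_le_integral (hi.comp_sub_right (T * r)).norm
      (ae_of_all _ fun x => norm_nonneg _)).trans_eq ?_
    exact integral_sub_right_eq_self (fun x => ‖f x‖) (T * r)
  · filter_upwards [Measure.ae_ne volume (1 : ℝ)] with r hr1 hr
    rw [uIoc_of_le zero_le_one] at hr
    have hr2 : 0 < 1 - r := sub_pos.2 (lt_of_le_of_ne hr.2 hr1)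
    simp only [intervalIntegral.integral_comp_sub_right]
    refine intervalIntegral_tendsto_integral hi ?_ ?_
    · simp only [zero_sub]
      exact tendsto_neg_atTop_atBot.comp (tendsto_id.atTop_mul_const hr.1)
    · have : (fun T : ℝ => T - T * r) = fun T => T * (1 - r) := by ext; ring
      rw [this]
      exact tendsto_id.atTop_mul_const hr2

lemma boundaryDecay_nonneg (θ T s : ℝ) : 0 ≤ boundaryDecay θ T s := by
  unfold boundaryDecay; positivity

lemma boundaryDecay_le_two {θ T s : ℝ} (hθ : 0 < θ) (hs : s ∈ Ioc 0 T) :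
    boundaryDecay θ T s ≤ 2 := by
  have h1 : exp (-θ * s) ≤ 1 := exp_le_one_iff.2 (by nlinarith [hs.1])
  have h2 : exp (-θ * (T - s)) ≤ 1 := exp_le_one_iff.2 (by nlinarith [hs.2])
  unfold boundaryDecay
  linarith

lemma integral_boundaryDecay_le {θ T : ℝ} (hθ : 0 < θ) (hT : 0 ≤ T) :
    ∫ s in Ioc 0 T, boundaryDecay θ T s ≤ 2 / θ := by
  have i1 : IntervalIntegrable (fun s => exp (-θ * s + 0)) volume 0 T :=
    Continuous.intervalIntegrable (by fun_prop) _ _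
  have i2 : IntervalIntegrable (fun s => exp (θ * s + -θ * T)) volume 0 T :=
    Continuous.intervalIntegrable (by fun_prop) _ _
  have e : ∀ s, boundaryDecay θ T s = exp (-θ * s + 0) + exp (θ * s + -θ * T) := by
    intro s
    rw [boundaryDecay]
    ring_nf
  simp only [e]
  rw [← intervalIntegral.integral_of_le hT, intervalIntegral.integral_add i1 i2,
    integral_exp_mul_add (neg_ne_zero.2 hθ.ne'), integral_exp_mul_add hθ.ne',
    show -θ * 0 + 0 = 0 by ring, show θ * T + -θ * T = 0 by ring, exp_zero, div_neg, ← neg_div,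
    ← add_div]
  gcongr
  linarith [exp_pos (-θ * T + 0), exp_pos (θ * 0 + -θ * T)]

/-- Integrable majorant of the boundary effects, with `L¹` norm bounded uniformly in `T`. -/
noncomputable def boundaryMajorant (a θ T s : ℝ) : ℝ :=
  2 * boundaryDecay θ T s + 2 * truncPow a 1 s

lemma rpow_sub_one_le_add_truncPow {a s : ℝ} (ha1 : a < 1) (hs : 0 < s) :
    s ^ (a - 1) ≤ 1 + truncPow a 1 s := by
  rcases le_total s 1 with h | h
  · rw [← abs_rpow_eq_truncPow ha1 (by rwa [abs_of_pos hs]), abs_of_pos hs]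
    linarith
  · have := rpow_le_one_of_one_le_of_nonpos h (by linarith : a - 1 ≤ 0)
    linarith [truncPow_nonneg a 1 s]

lemma boundaryMajorant_nonneg (a θ T s : ℝ) : 0 ≤ boundaryMajorant a θ T s := by
  have := boundaryDecay_nonneg θ T s
  have := truncPow_nonneg a 1 s
  unfold boundaryMajorant
  positivity

lemma boundaryDecay_mul_le {a θ T s t : ℝ} (ha1 : a < 1) (hθ : 0 < θ) (hs : s ∈ Ioc 0 T)
    (ht : t ∈ Ioc 0 T) :
    boundaryDecay θ T s * (1 + t ^ (a - 1)) ≤ 2 * boundaryDecay θ T s + 2 * truncPow a 1 t := by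
  have h1 := boundaryDecay_nonneg θ T s
  have h2 := boundaryDecay_le_two hθ hs
  have h3 := rpow_sub_one_le_add_truncPow ha1 ht.1
  have h4 := truncPow_nonneg a 1 t
  nlinarith

lemma integrable_boundaryMajorant {a : ℝ} (ha : 0 < a) (θ T : ℝ) :
    IntegrableOn (boundaryMajorant a θ T) (Ioc 0 T) := by
  have h1 : IntegrableOn (boundaryDecay θ T) (Ioc 0 T) := by
    have : Continuous (boundaryDecay θ T) := by unfold boundaryDecay; fun_prop
    exact this.integrableOn_Ioc
  exact (h1.const_mul 2).add ((integrable_truncPow ha 1).integrableOn.const_mul 2)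

lemma integral_boundaryMajorant_le {a θ T : ℝ} (ha : 0 < a) (hθ : 0 < θ) (hT : 0 ≤ T) :
    ∫ s in Ioc 0 T, boundaryMajorant a θ T s ≤ 4 / θ + 2 * ∫ x, truncPow a 1 x := by
  have h1 : IntegrableOn (boundaryDecay θ T) (Ioc 0 T) := by
    have : Continuous (boundaryDecay θ T) := by unfold boundaryDecay; fun_prop
    exact this.integrableOn_Ioc
  have h2 := integrable_truncPow ha 1
  unfold boundaryMajorant
  rw [integral_add (h1.const_mul 2) (h2.integrableOn.const_mul 2), integral_const_mul,
    integral_const_mul]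
  have h3 := integral_boundaryDecay_le hθ hT
  have h4 : ∫ s in Ioc 0 T, truncPow a 1 s ≤ ∫ x, truncPow a 1 x :=
    setIntegral_le_integral h2 (ae_of_all _ (truncPow_nonneg a 1))
  have h5 : 4 / θ = 2 * (2 / θ) := by ring
  linarith

lemma exists_abs_innerKernel_mul_sub_le {a θ : ℝ} (ha : 0 < a) (ha1 : a < 1) (hθ : 0 < θ) :
    ∃ K, 0 ≤ K ∧ ∀ T, ∀ s ∈ Ioc 0 T, ∀ t ∈ Ioc 0 T,
      |innerKernel a θ T s t * innerKernel a θ T t s -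
        (2 * θ / Gamma (1 - a)) ^ 2 * profile a θ (t - s) ^ 2| ≤
      K * (boundaryMajorant a θ T s * boundaryMajorant a θ T t +
        |profile a θ (t - s)| * boundaryMajorant a θ T s +
        |profile a θ (t - s)| * boundaryMajorant a θ T t) := by
  obtain ⟨K, hK, h⟩ := exists_abs_innerKernel_add_profile_le ha ha1 hθ
  have hG : 0 < Gamma (1 - a) := Gamma_pos_of_pos (by linarith)
  set c := 2 * θ / Gamma (1 - a)
  have hc0 : 0 ≤ c := by positivity
  refine ⟨K ^ 2 + c * K, by positivity, fun T s hs t ht => ?_⟩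
  have h1 := h T s hs t ht
  have h2 := h T t ht s hs
  rw [← neg_sub t s, profile_neg] at h2
  have b1 := boundaryDecay_mul_le ha1 hθ hs ht
  have b2 := boundaryDecay_mul_le ha1 hθ ht hs
  have b3 : boundaryDecay θ T s * (1 + t ^ (a - 1)) + boundaryDecay θ T t * (1 + s ^ (a - 1)) ≤
      boundaryMajorant a θ T s + boundaryMajorant a θ T t := by
    unfold boundaryMajorant
    linarith
  have m1 := boundaryMajorant_nonneg a θ T s
  have m2 := boundaryMajorant_nonneg a θ T t
  have d1 := boundaryDecay_nonneg θ T s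
  have d2 := boundaryDecay_nonneg θ T t
  have k1 := truncPow_nonneg a 1 s
  have k2 := truncPow_nonneg a 1 t
  have r1 : 0 ≤ s ^ (a - 1) := rpow_nonneg hs.1.le _
  have r2 : 0 ≤ t ^ (a - 1) := rpow_nonneg ht.1.le _
  set p := profile a θ (t - s)
  set w := innerKernel a θ T s t + c * p
  set v := innerKernel a θ T t s + c * p
  have hx : innerKernel a θ T s t * innerKernel a θ T t s - c ^ 2 * p ^ 2
      = w * v - c * p * (w + v) := by ring
  have b1' : boundaryDecay θ T s * (1 + s ^ (a - 1)) ≤ boundaryMajorant a θ T s :=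
    boundaryDecay_mul_le ha1 hθ hs hs
  have b2' : boundaryDecay θ T t * (1 + t ^ (a - 1)) ≤ boundaryMajorant a θ T t :=
    boundaryDecay_mul_le ha1 hθ ht ht
  have hwv : |w| * |v| ≤ K ^ 2 * (boundaryMajorant a θ T s * boundaryMajorant a θ T t) := by
    calc |w| * |v| ≤ K * (boundaryDecay θ T s * (1 + t ^ (a - 1))) *
          (K * (boundaryDecay θ T t * (1 + s ^ (a - 1)))) := by gcongr
      _ = K ^ 2 * ((boundaryDecay θ T s * (1 + s ^ (a - 1))) *
          (boundaryDecay θ T t * (1 + t ^ (a - 1)))) := by ring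
      _ ≤ _ := by gcongr
  have hsum : |w| + |v| ≤ K * (boundaryMajorant a θ T s + boundaryMajorant a θ T t) := by
    have := mul_le_mul_of_nonneg_left b3 hK
    linarith
  rw [hx]
  have hp := abs_nonneg p
  calc |w * v - c * p * (w + v)| ≤ |w * v| + |c * p * (w + v)| := abs_sub _ _
    _ = |w| * |v| + c * |p| * |w + v| := by rw [abs_mul, abs_mul, abs_mul, abs_of_nonneg hc0]
    _ ≤ |w| * |v| + c * |p| * (|w| + |v|) := by gcongr; exact abs_add_le _ _
    _ ≤ K ^ 2 * (boundaryMajorant a θ T s * boundaryMajorant a θ T t) +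
        c * |p| * (K * (boundaryMajorant a θ T s + boundaryMajorant a θ T t)) := by gcongr
    _ ≤ _ := by
      have q1 := mul_nonneg (mul_nonneg hc0 hK) (mul_nonneg m1 m2)
      have q2 := mul_nonneg (sq_nonneg K) (mul_nonneg hp (add_nonneg m1 m2))
      nlinarith

/-- `L¹` bound for a translation kernel weighted by a function of the first variable. -/
lemma integrable_and_integral_comp_sub_mul_le {f g : ℝ → ℝ} {T : ℝ} (hf : Measurable f)
    (hi : Integrable f) (hg : IntegrableOn g (Ioc 0 T)) (hg0 : ∀ x, 0 ≤ g x) (hgm : Measurable g) :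
    Integrable (fun p : ℝ × ℝ => |f (p.2 - p.1)| * g p.1)
        ((volume.restrict (Ioc 0 T)).prod (volume.restrict (Ioc 0 T))) ∧
      ∫ p, |f (p.2 - p.1)| * g p.1
        ∂((volume.restrict (Ioc 0 T)).prod (volume.restrict (Ioc 0 T))) ≤
      (∫ x, |f x|) * ∫ x in Ioc 0 T, g x := by
  have hm : Measurable (fun p : ℝ × ℝ => |f (p.2 - p.1)| * g p.1) := by fun_prop
  have hle : ∀ s, ∫ t in Ioc 0 T, |f (t - s)| * g s ≤ (∫ x, |f x|) * g s := by
    intro s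
    rw [integral_mul_const]
    refine mul_le_mul_of_nonneg_right ?_ (hg0 s)
    refine (setIntegral_le_integral (hi.comp_sub_right s).norm
      (ae_of_all _ fun x => norm_nonneg _)).trans_eq ?_
    exact integral_sub_right_eq_self (fun x => ‖f x‖) s
  have hint : Integrable (fun p : ℝ × ℝ => |f (p.2 - p.1)| * g p.1)
      ((volume.restrict (Ioc 0 T)).prod (volume.restrict (Ioc 0 T))) := by
    rw [integrable_prod_iff hm.aestronglyMeasurable]
    refine ⟨ae_of_all _ fun s => ((hi.comp_sub_right s).abs.restrict).mul_const (g s), ?_⟩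
    refine (hg.const_mul (∫ x, |f x|)).mono'
      hm.stronglyMeasurable.norm.integral_prod_right'.aestronglyMeasurable
      (ae_of_all _ fun s => ?_)
    rw [norm_of_nonneg (integral_nonneg fun x => norm_nonneg _)]
    simp only [norm_mul, norm_eq_abs, abs_abs, abs_of_nonneg (hg0 s)]
    exact hle s
  refine ⟨hint, ?_⟩
  rw [integral_prod _ hint, ← integral_const_mul]
  exact integral_mono hint.integral_prod_left (hg.const_mul _) hle

lemma measurable_boundaryMajorant (a θ T : ℝ) : Measurable (boundaryMajorant a θ T) := by
  have := measurable_truncPow a 1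
  unfold boundaryMajorant boundaryDecay
  fun_prop

lemma exists_abs_integral_innerKernel_sub_le {a θ : ℝ} (ha : 0 < a) (ha1 : a < 1) (hθ : 0 < θ) :
    ∃ K, ∀ T, 0 ≤ T →
      |(∫ s in (0 : ℝ)..T, ∫ t in (0 : ℝ)..T, innerKernel a θ T s t * innerKernel a θ T t s) -
        (2 * θ / Gamma (1 - a)) ^ 2 *
          ∫ s in (0 : ℝ)..T, ∫ t in (0 : ℝ)..T, profile a θ (t - s) ^ 2| ≤ K := by
  obtain ⟨K, hK, h⟩ := exists_abs_innerKernel_mul_sub_le ha ha1 hθ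
  set G := 4 / θ + 2 * ∫ x, truncPow a 1 x
  set N := ∫ x, |profile a θ x|
  have hN : 0 ≤ N := integral_nonneg fun _ => abs_nonneg _
  refine ⟨K * (G * G + N * G + N * G), fun T hT => ?_⟩
  set ν := volume.restrict (Ioc 0 T)
  set c := 2 * θ / Gamma (1 - a)
  have hpm := measurable_profile a θ
  have hgi := integrable_boundaryMajorant ha θ T
  have hg0 := boundaryMajorant_nonneg a θ T
  have hgm := measurable_boundaryMajorant a θ T
  have hgG := integral_boundaryMajorant_le ha hθ hT
  have hg00 : 0 ≤ ∫ s in Ioc 0 T, boundaryMajorant a θ T s := integral_nonneg hg0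
  obtain ⟨i1, l1⟩ := integrable_and_integral_comp_sub_mul_le hpm (integrable_profile ha ha1 hθ)
    hgi hg0 hgm
  have i2 : Integrable (fun p : ℝ × ℝ => |profile a θ (p.2 - p.1)| * boundaryMajorant a θ T p.2)
      (ν.prod ν) := by
    refine i1.swap.congr (ae_of_all _ fun p => ?_)
    simp only [Function.comp_apply, Prod.fst_swap, Prod.snd_swap]
    rw [← neg_sub, profile_neg]
  have l2 : ∫ p, |profile a θ (p.2 - p.1)| * boundaryMajorant a θ T p.2 ∂(ν.prod ν) ≤
      N * ∫ s in Ioc 0 T, boundaryMajorant a θ T s := by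
    refine le_of_eq_of_le ?_ l1
    rw [← integral_prod_swap]
    refine integral_congr_ae (ae_of_all _ fun p => ?_)
    simp only [Prod.fst_swap, Prod.snd_swap]
    rw [← neg_sub, profile_neg]
  have i3 : Integrable (fun p : ℝ × ℝ => boundaryMajorant a θ T p.1 * boundaryMajorant a θ T p.2)
      (ν.prod ν) := hgi.mul_prod hgi
  have l3 : ∫ p, boundaryMajorant a θ T p.1 * boundaryMajorant a θ T p.2 ∂(ν.prod ν) =
      (∫ s in Ioc 0 T, boundaryMajorant a θ T s) * ∫ s in Ioc 0 T, boundaryMajorant a θ T s :=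
    integral_prod_mul _ _
  have isq : Integrable (fun p : ℝ × ℝ => profile a θ (p.2 - p.1) ^ 2) (ν.prod ν) :=
    integrable_comp_sub_prod (hpm.pow_const 2) (integrable_and_integral_profile_sq ha ha1 hθ).1 T
  have hbound : ∀ᵐ p ∂(ν.prod ν),
      ‖innerKernel a θ T p.1 p.2 * innerKernel a θ T p.2 p.1 -
        c ^ 2 * profile a θ (p.2 - p.1) ^ 2‖ ≤
      K * (boundaryMajorant a θ T p.1 * boundaryMajorant a θ T p.2 +
        |profile a θ (p.2 - p.1)| * boundaryMajorant a θ T p.1 +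
        |profile a θ (p.2 - p.1)| * boundaryMajorant a θ T p.2) := by
    rw [Measure.prod_restrict]
    exact (ae_restrict_iff' (measurableSet_Ioc.prod measurableSet_Ioc)).2
      (ae_of_all _ fun p hp => h T p.1 hp.1 p.2 hp.2)
  have hQ := measurable_innerKernel a θ hT
  have hQ' : Measurable (fun p : ℝ × ℝ => innerKernel a θ T p.2 p.1) := hQ.comp measurable_swap
  have hm : Measurable (fun p : ℝ × ℝ => innerKernel a θ T p.1 p.2 * innerKernel a θ T p.2 p.1 -
      c ^ 2 * profile a θ (p.2 - p.1) ^ 2) := by fun_prop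
  have ib := ((i3.add i1).add i2).const_mul K
  have idiff := ib.mono' hm.aestronglyMeasurable hbound
  have iQ : Integrable (fun p : ℝ × ℝ => innerKernel a θ T p.1 p.2 * innerKernel a θ T p.2 p.1)
      (ν.prod ν) := by
    refine (idiff.add (isq.const_mul (c ^ 2))).congr (ae_of_all _ fun p => ?_)
    simp only [Pi.add_apply, sub_add_cancel]
  simp only [intervalIntegral.integral_of_le hT]
  rw [← integral_prod (fun p : ℝ × ℝ => innerKernel a θ T p.1 p.2 * innerKernel a θ T p.2 p.1) iQ,
    ← integral_prod (fun p : ℝ × ℝ => profile a θ (p.2 - p.1) ^ 2) isq, ← integral_const_mul,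
    ← integral_sub iQ (isq.const_mul _), ← norm_eq_abs]
  refine (norm_integral_le_of_norm_le ib hbound).trans ?_
  simp only [Pi.add_apply]
  have i31 : Integrable (fun p : ℝ × ℝ => boundaryMajorant a θ T p.1 * boundaryMajorant a θ T p.2 +
      |profile a θ (p.2 - p.1)| * boundaryMajorant a θ T p.1) (ν.prod ν) := i3.add i1
  rw [integral_const_mul, integral_add i31 i2, integral_add i3 i1, l3]
  refine mul_le_mul_of_nonneg_left ?_ hK
  have hNG := mul_le_mul_of_nonneg_left hgG hN
  have hGG := mul_le_mul hgG hgG hg00 (hg00.trans hgG)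
  linarith

lemma tendsto_average_innerKernel {a θ : ℝ} (ha : 0 < a) (ha1 : a < 1) (hθ : 0 < θ) :
    Tendsto (fun T : ℝ => T⁻¹ * ∫ s in (0 : ℝ)..T, ∫ t in (0 : ℝ)..T,
        innerKernel a θ T s t * innerKernel a θ T t s) atTop
      (𝓝 ((2 * θ / Gamma (1 - a)) ^ 2 * ∫ x, profile a θ x ^ 2)) := by
  obtain ⟨K, hK⟩ := exists_abs_integral_innerKernel_sub_le ha ha1 hθ
  have h1 := (tendsto_average_comp_sub ((measurable_profile a θ).pow_const 2)
    (integrable_and_integral_profile_sq ha ha1 hθ).1).const_mul ((2 * θ / Gamma (1 - a)) ^ 2)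
  have h2 : Tendsto (fun T : ℝ => T⁻¹ * ((∫ s in (0 : ℝ)..T, ∫ t in (0 : ℝ)..T,
      innerKernel a θ T s t * innerKernel a θ T t s) - (2 * θ / Gamma (1 - a)) ^ 2 *
          ∫ s in (0 : ℝ)..T, ∫ t in (0 : ℝ)..T, profile a θ (t - s) ^ 2)) atTop (𝓝 0) := by
    refine squeeze_zero_norm' (a := fun T => T⁻¹ * K) ?_ ?_
    · filter_upwards [eventually_gt_atTop 0] with T hT
      rw [norm_mul, norm_of_nonneg (inv_nonneg.2 hT.le)]
      exact mul_le_mul_of_nonneg_left (hK T hT.le) (inv_nonneg.2 hT.le)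
    · simpa using tendsto_inv_atTop_zero.mul_const K
  have h3 := h2.add h1
  rw [zero_add] at h3
  refine h3.congr fun T => ?_
  ring

end Asymptotics

/-- Limiting variance `lim_{T→∞} (1/T) E[F_T²]` expressed as the limit of a deterministic
fourfold integral, for Hurst parameter `H ∈ (0, 1/2)`. -/
theorem limit_variance_FT_small_H (H θ : ℝ) (hH : H ∈ Set.Ioo (0:ℝ) (1/2)) (hθ : 0 < θ) :
    Filter.Tendsto (fun T : ℝ =>
      (2 / T) * ∫ s₁ in (0:ℝ)..T, ∫ s₂ in (0:ℝ)..T, ∫ t₁ in (0:ℝ)..T, ∫ t₂ in (0:ℝ)..T,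
        (θ * Real.sign (s₁ - t₁) * Real.exp (-θ * |s₁ - t₁|)) *
        (-θ * Real.sign (s₂ - t₂) * Real.exp (-θ * |s₂ - t₂|)) *
        (H * (s₁ ^ (2*H - 1) - Real.sign (s₁ - s₂) * |s₁ - s₂| ^ (2*H - 1))) *
        (H * (t₂ ^ (2*H - 1) + Real.sign (t₁ - t₂) * |t₁ - t₂| ^ (2*H - 1))))
      Filter.atTop
      (nhds (4 * H^2 * θ ^ (1 - 4*H) * Real.Gamma (2*H) ^ 2 *
        ((4*H - 1) + 2 * Real.Gamma (2 - 4*H) * Real.Gamma (4*H) /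
          (Real.Gamma (2*H) * Real.Gamma (1 - 2*H))))) := by
  have ha : 0 < 2 * H := by linarith [hH.1]
  have ha1 : 2 * H < 1 := by linarith [hH.2]
  have hlim := (tendsto_average_innerKernel ha ha1 hθ).const_mul (2 * H ^ 2)
  have hconst := limit_constant_eq ha ha1 hθ
  rw [← (integrable_and_integral_profile_sq ha ha1 hθ).2] at hconst
  have hval : 2 * H ^ 2 * ((2 * θ / Real.Gamma (1 - 2 * H)) ^ 2 * ∫ x, profile (2 * H) θ x ^ 2)
      = 4 * H^2 * θ ^ (1 - 4*H) * Real.Gamma (2*H) ^ 2 *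
        ((4*H - 1) + 2 * Real.Gamma (2 - 4*H) * Real.Gamma (4*H) /
          (Real.Gamma (2*H) * Real.Gamma (1 - 2*H))) := by
    rw [show (2 : ℝ) * (2 * H) = 4 * H by ring] at hconst
    rw [mul_comm 2 (H ^ 2), mul_assoc, hconst]
    ring
  rw [hval] at hlim
  refine hlim.congr' ?_
  filter_upwards [Filter.eventually_gt_atTop 0] with T hT
  have hcov := integrable_covDeriv ha ha1 T
  have key := integral_four_fold_eq (measurable_signedExp θ) (abs_signedExp_le hθ)
    (signedExp_neg θ) hcov
  have e : ∀ s₁ s₂ t₁ t₂ : ℝ,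
      (θ * Real.sign (s₁ - t₁) * Real.exp (-θ * |s₁ - t₁|)) *
        (-θ * Real.sign (s₂ - t₂) * Real.exp (-θ * |s₂ - t₂|)) *
        (H * (s₁ ^ (2*H - 1) - Real.sign (s₁ - s₂) * |s₁ - s₂| ^ (2*H - 1))) *
        (H * (t₂ ^ (2*H - 1) + Real.sign (t₁ - t₂) * |t₁ - t₂| ^ (2*H - 1)))
      = H ^ 2 * (signedExp θ (s₁ - t₁) * -signedExp θ (s₂ - t₂) * covDeriv (2 * H) s₁ s₂ *
        covDeriv (2 * H) t₂ t₁) := by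
    intro s₁ s₂ t₁ t₂
    rw [covDeriv, covDeriv, ← neg_sub t₁ t₂, signedPow_neg, signedExp, signedExp, signedPow,
      signedPow]
    ring
  simp only [e, innerKernel, intervalIntegral.integral_of_le hT.le, integral_const_mul]
  rw [key]
  ring
end

section
/- Let H ∈ (0,1), θ > 0 and T > 0. Define γ^α_S = ∫_0^S e^{-x} x^{α-1} dx (the lower incomplete Gamma function) and m(T) = Hθ ∫_0^T ∫_0^t e^{-θ(t-s)} (t^{2H-1} - (t-s)^{2H-1}) ds dt. Then m(T) = (1/2) γ^1_{θT} T^{2H} + θ^{-2H} γ^{2H+1}_{θT} (H - 1/2) - T H θ^{1-2H} γ^{2H}_{θT}. -/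
open MeasureTheory

/-- The lower incomplete Gamma function `γ^α_S = ∫_0^S e^{-x} x^{α-1} dx`. -/
noncomputable def lowerGamma (α S : ℝ) : ℝ := ∫ x in (0:ℝ)..S, Real.exp (-x) * x ^ (α - 1)

theorem intervalIntegrable_exp_mul_rpow {a : ℝ} (ha : -1 < a) (c x y : ℝ) :
    IntervalIntegrable (fun u : ℝ => Real.exp (-c * u) * u ^ a) volume x y :=
  (intervalIntegral.intervalIntegrable_rpow' ha).continuousOn_mul (by fun_prop)

theorem hasDerivAt_integral_exp_mul_rpow {a : ℝ} (ha : -1 < a) (c : ℝ) {t : ℝ} (ht : 0 < t) :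
    HasDerivAt (fun t => ∫ u in (0:ℝ)..t, Real.exp (-c * u) * u ^ a)
      (Real.exp (-c * t) * t ^ a) t := by
  refine intervalIntegral.integral_hasDerivAt_right (intervalIntegrable_exp_mul_rpow ha c 0 t) ?_ ?_
  · exact (Measurable.stronglyMeasurable (by fun_prop)).stronglyMeasurableAtFilter
  · exact ContinuousAt.mul (by fun_prop) (Real.continuousAt_rpow_const _ _ (Or.inl ht.ne'))

theorem continuous_integral_exp_mul_rpow {a : ℝ} (ha : -1 < a) (c : ℝ) :
    Continuous (fun t => ∫ u in (0:ℝ)..t, Real.exp (-c * u) * u ^ a) :=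
  intervalIntegral.continuous_primitive (fun x y => intervalIntegrable_exp_mul_rpow ha c x y) 0

theorem lowerGamma_mul {c : ℝ} (hc : 0 < c) (α : ℝ) {T : ℝ} (hT : 0 ≤ T) :
    lowerGamma α (c * T) = c ^ α * ∫ u in (0:ℝ)..T, Real.exp (-c * u) * u ^ (α - 1) := by
  have h := intervalIntegral.mul_integral_comp_mul_left (a := 0) (b := T)
    (f := fun x : ℝ => Real.exp (-x) * x ^ (α - 1)) c
  rw [mul_zero] at h
  rw [lowerGamma, ← h, ← intervalIntegral.integral_const_mul, ← intervalIntegral.integral_const_mul]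
  refine intervalIntegral.integral_congr fun u hu => ?_
  rw [Set.uIcc_of_le hT] at hu
  have hα : c ^ α = c * c ^ (α - 1) := by
    rw [Real.rpow_sub_one hc.ne']
    field_simp
  simp only [Real.mul_rpow hc.le hu.1, hα, neg_mul]
  ring

theorem integral_exp_neg_mul {c : ℝ} (hc : c ≠ 0) (t : ℝ) :
    ∫ u in (0:ℝ)..t, Real.exp (-c * u) = (1 - Real.exp (-c * t)) / c := by
  rw [intervalIntegral.integral_comp_mul_left _ (neg_ne_zero.mpr hc), integral_exp]
  simp only [mul_zero, Real.exp_zero, smul_eq_mul]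
  field_simp
  ring

/-- Integration by parts relating `∫ e^{-cu} u^{p-1}` and `∫ e^{-cu} u^p`. -/
theorem exp_mul_rpow_eq {p : ℝ} (hp : 0 < p) (c : ℝ) {T : ℝ} (hT : 0 ≤ T) :
    Real.exp (-c * T) * T ^ p = p * (∫ u in (0:ℝ)..T, Real.exp (-c * u) * u ^ (p - 1))
      - c * ∫ u in (0:ℝ)..T, Real.exp (-c * u) * u ^ p := by
  have i1 := (intervalIntegrable_exp_mul_rpow (a := p - 1) (by linarith) c 0 T).const_mul p
  have i2 := (intervalIntegrable_exp_mul_rpow (a := p) (by linarith) c 0 T).const_mul c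
  have h := intervalIntegral.integral_eq_sub_of_hasDerivAt_of_le hT
    (f := fun u : ℝ => Real.exp (-c * u) * u ^ p)
    (Continuous.continuousOn (by
      have := Real.continuous_rpow_const hp.le
      fun_prop)) (fun u hu => ?_) (i1.sub i2)
  · rw [intervalIntegral.integral_sub i1 i2, intervalIntegral.integral_const_mul,
      intervalIntegral.integral_const_mul, Real.zero_rpow hp.ne'] at h
    linarith
  · have hd := (((hasDerivAt_id u).const_mul (-c)).exp).mul
      (Real.hasDerivAt_rpow_const (p := p) (Or.inl hu.1.ne'))
    refine hd.congr_deriv ?_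
    simp only [id]
    ring

theorem inner_integral_eq {a c : ℝ} (ha : -1 < a) (hc : c ≠ 0) (t : ℝ) :
    ∫ s in (0:ℝ)..t, Real.exp (-c * (t - s)) * (t ^ a - (t - s) ^ a)
      = t ^ a * ((1 - Real.exp (-c * t)) / c) - ∫ u in (0:ℝ)..t, Real.exp (-c * u) * u ^ a := by
  rw [intervalIntegral.integral_comp_sub_left
    (fun u => Real.exp (-c * u) * (t ^ a - u ^ a)) t, sub_self, sub_zero,
    ← integral_exp_neg_mul hc, ← intervalIntegral.integral_const_mul,
    ← intervalIntegral.integral_sub (Continuous.intervalIntegrable (by fun_prop) _ _)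
      (intervalIntegrable_exp_mul_rpow ha c 0 t)]
  refine intervalIntegral.integral_congr fun u _ => ?_
  ring

theorem double_integral_eq {p c T : ℝ} (hp : 0 < p) (hc : c ≠ 0) (hT : 0 ≤ T) :
    ∫ t in (0:ℝ)..T, ∫ s in (0:ℝ)..t, Real.exp (-c * (t - s)) * (t ^ (p - 1) - (t - s) ^ (p - 1))
      = T ^ p / (p * c) - (1 / c + T) * (∫ u in (0:ℝ)..T, Real.exp (-c * u) * u ^ (p - 1))
        + ∫ u in (0:ℝ)..T, Real.exp (-c * u) * u ^ p := by
  have ha : -1 < p - 1 := by linarith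
  have hb : -1 < p := by linarith
  have cG := continuous_integral_exp_mul_rpow ha c
  have cG' := continuous_integral_exp_mul_rpow hb c
  have cp := Real.continuous_rpow_const hp.le
  simp only [inner_integral_eq ha hc]
  refine (intervalIntegral.integral_eq_sub_of_hasDerivAt_of_le hT
    (f := fun t : ℝ => t ^ p / (p * c)
      - (1 / c + t) * (∫ u in (0:ℝ)..t, Real.exp (-c * u) * u ^ (p - 1))
        + ∫ u in (0:ℝ)..t, Real.exp (-c * u) * u ^ p)
    (Continuous.continuousOn (by fun_prop)) (fun t ht => ?_) ?_).trans ?_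
  · have hd := (((Real.hasDerivAt_rpow_const (p := p) (Or.inl ht.1.ne')).div_const (p * c)).sub
      (((hasDerivAt_id t).const_add (1 / c)).mul (hasDerivAt_integral_exp_mul_rpow ha c ht.1))).add
        (hasDerivAt_integral_exp_mul_rpow hb c ht.1)
    refine hd.congr_deriv ?_
    have ht' : t ≠ 0 := ht.1.ne'
    have : t ^ p = t * t ^ (p - 1) := by
      rw [Real.rpow_sub_one ht']
      field_simp
    simp only [id, this]
    field_simp
    ring
  · exact ((intervalIntegral.intervalIntegrable_rpow' ha).mul_continuousOn (by fun_prop)).sub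
      (cG.intervalIntegrable _ _)
  · simp [Real.zero_rpow hp.ne']

/-- Closed form for `m(T)` in terms of lower incomplete Gamma functions. -/
theorem mT_closed_form (H θ T : ℝ) (hH : H ∈ Set.Ioo (0:ℝ) 1) (hθ : 0 < θ) (hT : 0 < T) :
    H * θ * (∫ t in (0:ℝ)..T, ∫ s in (0:ℝ)..t,
        Real.exp (-θ * (t - s)) * (t ^ (2*H - 1) - (t - s) ^ (2*H - 1)))
    = (1/2) * lowerGamma 1 (θ*T) * T ^ (2*H)
      + θ ^ (-(2*H)) * lowerGamma (2*H + 1) (θ*T) * (H - 1/2)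
      - T * H * θ ^ (1 - 2*H) * lowerGamma (2*H) (θ*T) := by
  have hH0 : 0 < H := hH.1
  have hp : 0 < 2 * H := by linarith
  have hparts := exp_mul_rpow_eq hp θ hT.le
  rw [double_integral_eq hp hθ.ne' hT.le, lowerGamma_mul hθ 1 hT.le,
    lowerGamma_mul hθ (2 * H + 1) hT.le, lowerGamma_mul hθ (2 * H) hT.le]
  simp only [sub_self, Real.rpow_zero, mul_one, Real.rpow_one, add_sub_cancel_right]
  rw [integral_exp_neg_mul hθ.ne', Real.rpow_neg hθ.le, Real.rpow_sub hθ, Real.rpow_add hθ,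
    Real.rpow_one]
  have hθp : θ ^ (2 * H) ≠ 0 := (Real.rpow_pos_of_pos hθ _).ne'
  set G := ∫ u in (0:ℝ)..T, Real.exp (-θ * u) * u ^ (2 * H - 1)
  set G' := ∫ u in (0:ℝ)..T, Real.exp (-θ * u) * u ^ (2 * H)
  generalize Real.exp (-θ * T) = E at *
  generalize T ^ (2 * H) = P at *
  generalize θ ^ (2 * H) = Q at *
  field_simp
  linear_combination hparts
end

section
/- Let H ∈ (0,1) and θ > 0, and let m(T) = Hθ ∫_0^T ∫_0^t e^{-θ(t-s)} (t^{2H-1} - (t-s)^{2H-1}) ds dt. Then lim_{T → ∞} T^{-1} ( (1/2) T^{2H} - m(T) ) = H θ^{1-2H} Γ(2H), where Γ is the Gamma function. -/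
open MeasureTheory

/-- The unnormalised density of the gamma distribution with shape `a` and rate `θ`. -/
noncomputable def gammaKernel (θ a x : ℝ) : ℝ := x ^ (a - 1) * Real.exp (-(θ * x))

namespace gammaKernel

variable {θ a : ℝ}

lemma integrableOn_Ioi (hθ : 0 < θ) (ha : 0 < a) :
    IntegrableOn (gammaKernel θ a) (Set.Ioi 0) := by
  refine .of_integral_ne_zero ?_
  have hΓ := Real.Gamma_pos_of_pos ha
  simp only [gammaKernel]
  rw [Real.integral_rpow_mul_exp_neg_mul_Ioi ha hθ]
  positivity

lemma intervalIntegrable (θ : ℝ) (ha : 0 < a) (b c : ℝ) :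
    IntervalIntegrable (gammaKernel θ a) volume b c :=
  (intervalIntegral.intervalIntegrable_rpow' (by linarith)).mul_continuousOn (by fun_prop)

lemma continuousAt {x : ℝ} (hx : 0 < x) : ContinuousAt (gammaKernel θ a) x :=
  (Real.continuousAt_rpow_const _ _ (Or.inl hx.ne')).mul (by fun_prop)

lemma continuous_primitive (θ : ℝ) (ha : 0 < a) :
    Continuous fun t => ∫ x in (0 : ℝ)..t, gammaKernel θ a x :=
  intervalIntegral.continuous_primitive (intervalIntegrable θ ha) 0

lemma hasDerivAt_primitive (ha : 0 < a) {t : ℝ} (ht : 0 < t) :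
    HasDerivAt (fun t => ∫ x in (0 : ℝ)..t, gammaKernel θ a x) (gammaKernel θ a t) t :=
  intervalIntegral.integral_hasDerivAt_right (intervalIntegrable θ ha 0 t)
    (ContinuousAt.stronglyMeasurableAtFilter isOpen_Ioi (fun _ hx => continuousAt hx) t ht)
    (continuousAt ht)

lemma mul_self (ha : 0 < a) {x : ℝ} (hx : 0 ≤ x) :
    gammaKernel θ a x * x = gammaKernel θ (a + 1) x := by
  have h : x ^ (a + 1 - 1) = x ^ (a - 1) * x := by
    rw [show a + 1 - 1 = a - 1 + 1 by ring, Real.rpow_add_one' hx (by linarith)]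
  rw [gammaKernel, gammaKernel, h]
  ring

lemma tendsto_primitive (hθ : 0 < θ) (ha : 0 < a) :
    Filter.Tendsto (fun t => ∫ x in (0 : ℝ)..t, gammaKernel θ a x) Filter.atTop
      (nhds (θ ^ (-a) * Real.Gamma a)) := by
  have h := intervalIntegral_tendsto_integral_Ioi 0 (integrableOn_Ioi hθ ha) Filter.tendsto_id
  have e : ∫ x in Set.Ioi 0, gammaKernel θ a x = θ ^ (-a) * Real.Gamma a := by
    simp only [gammaKernel]
    rw [Real.integral_rpow_mul_exp_neg_mul_Ioi ha hθ, one_div, Real.inv_rpow hθ.le,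
      Real.rpow_neg hθ.le]
  rwa [e] at h

lemma integral_primitive (θ : ℝ) (ha : 0 < a) {T : ℝ} (hT : 0 < T) :
    ∫ t in (0 : ℝ)..T, ∫ x in (0 : ℝ)..t, gammaKernel θ a x =
      T * (∫ x in (0 : ℝ)..T, gammaKernel θ a x) - ∫ x in (0 : ℝ)..T, gammaKernel θ (a + 1) x := by
  have h := intervalIntegral.integral_mul_deriv_eq_deriv_mul_of_hasDerivAt
    (a := 0) (b := T) (v := fun x => x) (v' := fun _ => 1)
    (continuous_primitive θ ha).continuousOn continuousOn_id
    (fun x hx => hasDerivAt_primitive ha (by simpa [hT.le] using hx.1))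
    (fun x _ => hasDerivAt_id x) (intervalIntegrable θ ha 0 T) intervalIntegrable_const
  have e : ∫ x in (0 : ℝ)..T, gammaKernel θ a x * x = ∫ x in (0 : ℝ)..T, gammaKernel θ (a + 1) x :=
    intervalIntegral.integral_congr fun x hx =>
      mul_self ha (by rw [Set.uIcc_of_le hT.le] at hx; exact hx.1)
  simp only [mul_one, e, intervalIntegral.integral_same, zero_mul, sub_zero] at h
  rw [h, mul_comm T]

end gammaKernel

lemma integral_exp_mul_rpow_sub_rpow {θ a : ℝ} (hθ : 0 < θ) (ha : 0 < a) (t : ℝ) :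
    ∫ s in (0 : ℝ)..t, Real.exp (-θ * (t - s)) * (t ^ (a - 1) - (t - s) ^ (a - 1)) =
      (t ^ (a - 1) - gammaKernel θ a t) / θ - ∫ x in (0 : ℝ)..t, gammaKernel θ a x := by
  have hexp : ∫ u in (0 : ℝ)..t, Real.exp (-θ * u) = (1 - Real.exp (-(θ * t))) / θ := by
    rw [intervalIntegral.integral_comp_mul_left _ (neg_ne_zero.mpr hθ.ne')]
    simp
    field_simp
    ring
  rw [intervalIntegral.integral_comp_sub_left
    (fun u => Real.exp (-θ * u) * (t ^ (a - 1) - u ^ (a - 1))) t, sub_self, sub_zero]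
  have e : ∀ u, Real.exp (-θ * u) * (t ^ (a - 1) - u ^ (a - 1)) =
      t ^ (a - 1) * Real.exp (-θ * u) - gammaKernel θ a u := fun u => by
    rw [gammaKernel, neg_mul]; ring
  simp only [e]
  rw [intervalIntegral.integral_sub
    (Continuous.intervalIntegrable (by fun_prop) _ _) (gammaKernel.intervalIntegrable θ ha _ _),
    intervalIntegral.integral_const_mul, hexp, gammaKernel]
  ring

lemma integral_integral_exp_mul_rpow_sub_rpow {θ a T : ℝ} (hθ : 0 < θ) (ha : 0 < a) :
    ∫ t in (0 : ℝ)..T, ∫ s in (0 : ℝ)..t,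
        Real.exp (-θ * (t - s)) * (t ^ (a - 1) - (t - s) ^ (a - 1)) =
      (T ^ a / a - ∫ x in (0 : ℝ)..T, gammaKernel θ a x) / θ -
        ∫ t in (0 : ℝ)..T, ∫ x in (0 : ℝ)..t, gammaKernel θ a x := by
  have hr : IntervalIntegrable (fun x : ℝ => x ^ (a - 1)) volume 0 T :=
    intervalIntegral.intervalIntegrable_rpow' (by linarith)
  have hk := gammaKernel.intervalIntegrable θ ha 0 T
  simp only [integral_exp_mul_rpow_sub_rpow hθ ha]
  rw [intervalIntegral.integral_sub ((hr.sub hk).div_const θ)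
    ((gammaKernel.continuous_primitive θ ha).intervalIntegrable _ _),
    intervalIntegral.integral_div, intervalIntegral.integral_sub hr hk,
    integral_rpow (Or.inl (by linarith)), sub_add_cancel, Real.zero_rpow ha.ne', sub_zero]

/-- `lim_{T→∞} T⁻¹ ((1/2) T^{2H} - m(T)) = H θ^{1-2H} Γ(2H)`. -/
theorem limit_ellT (H θ : ℝ) (hH : H ∈ Set.Ioo (0:ℝ) 1) (hθ : 0 < θ) :
    Filter.Tendsto (fun T : ℝ =>
      T⁻¹ * ((1/2) * T ^ (2*H) -
        H * θ * ∫ t in (0:ℝ)..T, ∫ s in (0:ℝ)..t,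
          Real.exp (-θ * (t - s)) * (t ^ (2*H - 1) - (t - s) ^ (2*H - 1))))
      Filter.atTop (nhds (H * θ ^ (1 - 2*H) * Real.Gamma (2*H))) := by
  have hH0 : 0 < H := hH.1
  have ha : 0 < 2 * H := by linarith
  have h₁ := gammaKernel.tendsto_primitive hθ ha
  have h₂ := gammaKernel.tendsto_primitive hθ (add_pos ha one_pos)
  have hinv := tendsto_inv_atTop_zero (𝕜 := ℝ)
  have key := ((hinv.mul h₁).const_mul H).add ((h₁.sub (hinv.mul h₂)).const_mul (H * θ))
  have hlim : H * (0 * (θ ^ (-(2 * H)) * Real.Gamma (2 * H))) +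
      H * θ * (θ ^ (-(2 * H)) * Real.Gamma (2 * H) -
        0 * (θ ^ (-(2 * H + 1)) * Real.Gamma (2 * H + 1))) =
      H * θ ^ (1 - 2 * H) * Real.Gamma (2 * H) := by
    rw [sub_eq_add_neg 1, Real.rpow_add hθ, Real.rpow_one]
    ring
  rw [hlim] at key
  refine key.congr' ?_
  filter_upwards [Filter.eventually_gt_atTop 0] with T hT
  rw [integral_integral_exp_mul_rpow_sub_rpow hθ ha, gammaKernel.integral_primitive θ ha hT]
  field_simp
  ring
end

section
/- Let H ∈ (0,1) and θ > 0, and let R_H(s,r) = (1/2)(s^{2H} + r^{2H} - |s-r|^{2H}) for s, r ≥ 0. Then θ² ∫_0^∞ ∫_0^∞ e^{-θ(s+r)} R_H(s,r) ds dr = θ^{-2H} H Γ(2H), where Γ is the Gamma function. -/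
open MeasureTheory Set

/-- The integral of `|s - r| ^ a` against the product of two unnormalised exponential densities
reduces to a one-dimensional integral. -/
theorem integral_exp_neg_mul_abs_sub_rpow {a θ : ℝ} (hθ : 0 < θ)
    (hint : Integrable (fun z : ℝ × ℝ ↦ Real.exp (-θ * (z.1 + z.2)) * |z.1 - z.2| ^ a)
      ((volume.restrict (Ioi 0)).prod (volume.restrict (Ioi 0)))) :
    ∫ z : ℝ × ℝ, Real.exp (-θ * (z.1 + z.2)) * |z.1 - z.2| ^ a
      ∂((volume.restrict (Ioi 0)).prod (volume.restrict (Ioi 0)))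
      = θ⁻¹ * ∫ u in Ioi (0 : ℝ), u ^ a * Real.exp (-θ * u) := by
  set f : ℝ × ℝ → ℝ := fun z ↦ Real.exp (-θ * (z.1 + z.2)) * |z.1 - z.2| ^ a with hf
  set S : Set (ℝ × ℝ) := Ioi 0 ×ˢ Ioi 0 with hS
  have hSm : MeasurableSet S := measurableSet_Ioi.prod measurableSet_Ioi
  rw [Measure.prod_restrict] at hint ⊢
  rw [← integral_indicator hSm]
  have hemb := (MeasurableEquiv.shearAddRight ℝ).measurableEmbedding
  have hmp : MeasurePreserving (MeasurableEquiv.shearAddRight ℝ)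
      ((volume : Measure ℝ).prod volume) (volume.prod volume) :=
    measurePreserving_prod_add volume volume
  have hcomp : Integrable (fun z ↦ S.indicator f (MeasurableEquiv.shearAddRight ℝ z))
      ((volume : Measure ℝ).prod volume) :=
    (hmp.integrable_comp_emb hemb).2 ((integrable_indicator_iff hSm).2 hint)
  rw [← hmp.integral_comp hemb, integral_prod_symm _ hcomp]
  have hslice (u : ℝ) :
      ∫ s, S.indicator f (MeasurableEquiv.shearAddRight ℝ (s, u))
        = (2 * θ)⁻¹ * (|u| ^ a * Real.exp (-θ * |u|)) := by
    have heq : (fun s ↦ S.indicator f (MeasurableEquiv.shearAddRight ℝ (s, u)))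
        = (Ioi (max 0 (-u))).indicator
          (fun s ↦ |u| ^ a * Real.exp (-θ * u) * Real.exp (-(2 * θ) * s)) := by
      ext s
      have h1 : MeasurableEquiv.shearAddRight ℝ (s, u) = (s, s + u) := rfl
      have h2 : (s, s + u) ∈ S ↔ s ∈ Ioi (max 0 (-u)) := by
        simp only [hS, mem_prod, mem_Ioi, max_lt_iff]
        exact and_congr_right fun _ ↦ by constructor <;> intro h <;> linarith
      rw [h1]
      by_cases h : s ∈ Ioi (max 0 (-u))
      · rw [indicator_of_mem h, indicator_of_mem (h2.2 h), hf, mul_assoc, ← Real.exp_add]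
        simp only [sub_add_cancel_left, abs_neg]
        rw [mul_comm]
        ring_nf
      · rw [indicator_of_notMem h, indicator_of_notMem (mt h2.1 h)]
    rw [heq, integral_indicator measurableSet_Ioi, integral_const_mul,
      integral_exp_mul_Ioi (by linarith)]
    have hexp : Real.exp (-θ * |u|)
        = Real.exp (-θ * u) * Real.exp (-(2 * θ) * max 0 (-u)) := by
      rw [← Real.exp_add]
      congr 1
      rcases le_total 0 u with h | h
      · rw [abs_of_nonneg h, max_eq_left (by linarith)]; ring
      · rw [abs_of_nonpos h, max_eq_right (by linarith)]; ring
    rw [hexp]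
    field_simp
  simp_rw [hslice]
  rw [integral_const_mul, integral_comp_abs (f := fun u ↦ u ^ a * Real.exp (-θ * u))]
  field_simp

/-- Stationary variance of the fractional Ornstein–Uhlenbeck process:
`θ² ∫_0^∞ ∫_0^∞ e^{-θ(s+r)} R_H(s,r) ds dr = θ^{-2H} H Γ(2H)`. -/
theorem stationary_variance_fOU (H θ : ℝ) (hH : H ∈ Set.Ioo (0:ℝ) 1) (hθ : 0 < θ) :
    θ^2 * ∫ s in Set.Ioi (0:ℝ), ∫ r in Set.Ioi (0:ℝ),
        Real.exp (-θ * (s + r)) * ((1/2) * (s ^ (2*H) + r ^ (2*H) - |s - r| ^ (2*H)))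
    = θ ^ (-(2*H)) * H * Real.Gamma (2*H) := by
  have hH0 := hH.1
  obtain ⟨a, ha⟩ : ∃ a, a = 2 * H := ⟨_, rfl⟩
  rw [← ha]
  have ha0 : 0 < a := by linarith
  set μ : Measure ℝ := volume.restrict (Ioi 0) with hμ
  have hpow : Integrable (fun u : ℝ ↦ u ^ a * Real.exp (-θ * u)) μ := by
    simpa [IntegrableOn] using integrableOn_rpow_mul_exp_neg_mul_rpow (p := 1) (s := a) (by linarith) one_pos hθ
  have hexp : Integrable (fun u : ℝ ↦ Real.exp (-θ * u)) μ := exp_neg_integrableOn_Ioi 0 hθ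
  have hpow_val : ∫ u, u ^ a * Real.exp (-θ * u) ∂μ = θ ^ (-a) * θ⁻¹ * (a * Real.Gamma a) := by
    have h := integral_rpow_mul_exp_neg_mul_rpow (p := 1) (q := a) one_pos (by linarith) hθ
    simp only [Real.rpow_one, div_one] at h
    rw [hμ, h, Real.Gamma_add_one ha0.ne', neg_add, Real.rpow_add hθ, Real.rpow_neg_one]
    simp
  have hexp_val : ∫ u, Real.exp (-θ * u) ∂μ = θ⁻¹ := by
    rw [hμ, integral_exp_mul_Ioi (by linarith)]
    simp
  have hfst := hpow.mul_prod hexp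
  have hsnd := hexp.mul_prod hpow
  have hsum : Integrable (fun z : ℝ × ℝ ↦ z.1 ^ a * Real.exp (-θ * z.1) * Real.exp (-θ * z.2)
      + Real.exp (-θ * z.1) * (z.2 ^ a * Real.exp (-θ * z.2))) (μ.prod μ) := hfst.add hsnd
  have habs : Integrable (fun z : ℝ × ℝ ↦ Real.exp (-θ * (z.1 + z.2)) * |z.1 - z.2| ^ a)
      (μ.prod μ) := by
    refine hsum.mono' (by fun_prop) ?_
    rw [hμ, Measure.prod_restrict]
    refine (ae_restrict_mem (measurableSet_Ioi.prod measurableSet_Ioi)).mono ?_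
    rintro ⟨s, r⟩ ⟨hs, hr⟩
    simp only [mem_Ioi] at hs hr
    have hle : |s - r| ^ a ≤ s ^ a + r ^ a := by
      have hs' := Real.rpow_nonneg hs.le a
      have hr' := Real.rpow_nonneg hr.le a
      rcases le_total r s with h | h
      · have := Real.rpow_le_rpow (abs_nonneg (s - r))
          (show |s - r| ≤ s by rw [abs_of_nonneg] <;> linarith) ha0.le
        linarith
      · have := Real.rpow_le_rpow (abs_nonneg (s - r))
          (show |s - r| ≤ r by rw [abs_of_nonpos] <;> linarith) ha0.le
        linarith
    rw [Real.norm_of_nonneg (by positivity)]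
    simp only [mul_add, Real.exp_add]
    nlinarith [mul_le_mul_of_nonneg_left hle
      (mul_pos (Real.exp_pos (-θ * s)) (Real.exp_pos (-θ * r))).le]
  have hsplit (s r : ℝ) :
      Real.exp (-θ * (s + r)) * ((1/2) * (s ^ a + r ^ a - |s - r| ^ a))
        = 1 / 2 * (s ^ a * Real.exp (-θ * s) * Real.exp (-θ * r)
            + Real.exp (-θ * s) * (r ^ a * Real.exp (-θ * r))
            - Real.exp (-θ * (s + r)) * |s - r| ^ a) := by
    rw [mul_add, Real.exp_add]
    ring
  simp_rw [hsplit]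
  rw [← integral_prod (fun z : ℝ × ℝ ↦ 1 / 2 *
        (z.1 ^ a * Real.exp (-θ * z.1) * Real.exp (-θ * z.2)
            + Real.exp (-θ * z.1) * (z.2 ^ a * Real.exp (-θ * z.2))
            - Real.exp (-θ * (z.1 + z.2)) * |z.1 - z.2| ^ a))
      ((hsum.sub habs).const_mul _),
    integral_const_mul, integral_sub hsum habs, integral_add hfst hsnd,
    integral_prod_mul (fun u : ℝ ↦ u ^ a * Real.exp (-θ * u)) (fun u ↦ Real.exp (-θ * u)),
    integral_prod_mul (fun u ↦ Real.exp (-θ * u)) (fun u : ℝ ↦ u ^ a * Real.exp (-θ * u)),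
    integral_exp_neg_mul_abs_sub_rpow hθ habs, hpow_val, hexp_val]
  rw [show H = a / 2 by linarith]
  field_simp
  ring
end

section
/- Let H = 3/4 and θ > 0. Then lim_{T → ∞} (1/(T log T)) ∫_{[0,T]^4} e^{-θ|s₂-u₂| - θ|s₁-u₁|} |s₂-s₁|^{-1/2} |u₂-u₁|^{-1/2} du₁ du₂ ds₁ ds₂ = 8 θ^{-2}. -/
open MeasureTheory

/-- The integral over `[0, T]` of `|u - b|^{-1/2}` against the kernel `e^{-θ|a - u|}`. -/
noncomputable def smoothedInvSqrt (θ T a b : ℝ) : ℝ :=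
  ∫ u in (0:ℝ)..T, Real.exp (-θ * |a - u|) * (√|u - b|)⁻¹

/-- The result of smoothing `|u - v|^{-1/2}` by `e^{-θ|·|}` in both variables over `[0, T]`. -/
noncomputable def doublySmoothedInvSqrt (θ T a b : ℝ) : ℝ :=
  ∫ u in (0:ℝ)..T, Real.exp (-θ * |a - u|) * smoothedInvSqrt θ T b u

theorem integrable_comp_abs {f : ℝ → ℝ} (hf : IntegrableOn f (Set.Ioi 0)) :
    Integrable (fun x : ℝ => f |x|) := by
  have hpos : IntegrableOn (fun x : ℝ => f |x|) (Set.Ioi 0) :=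
    hf.congr_fun (fun x hx => by simp [abs_of_pos (Set.mem_Ioi.mp hx)]) measurableSet_Ioi
  have hneg : IntegrableOn (fun x : ℝ => f |x|) (Set.Iic 0) := by
    rw [integrableOn_Iic_iff_integrableOn_Iio]
    simpa using (show IntegrableOn (fun x : ℝ => f |x|) (Set.Ioi (-0)) by simpa).comp_neg_Iio
  rw [← integrableOn_univ, ← Set.Iic_union_Ioi (a := (0:ℝ))]
  exact hneg.union hpos

theorem integrable_exp_neg_mul_abs {θ : ℝ} (hθ : 0 < θ) :
    Integrable (fun x : ℝ => Real.exp (-θ * |x|)) :=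
  integrable_comp_abs (f := fun x => Real.exp (-θ * x))
    (integrableOn_exp_mul_Ioi (by linarith) 0)

theorem integral_exp_neg_mul_abs {θ : ℝ} (hθ : 0 < θ) :
    ∫ x : ℝ, Real.exp (-θ * |x|) = 2 / θ := by
  rw [integral_comp_abs (f := fun x => Real.exp (-θ * x)), integral_exp_mul_Ioi (by linarith)]
  simp; ring

theorem integrable_inv_sqrt_mul_inv_one_add :
    Integrable (fun x : ℝ => (√|x|)⁻¹ * (1 + |x|)⁻¹) := by
  refine integrable_comp_abs (f := fun x => (√x)⁻¹ * (1 + x)⁻¹) ?_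
  have hmeas : Measurable (fun x : ℝ => (√x)⁻¹ * (1 + x)⁻¹) := by fun_prop
  have hnorm : ∀ x : ℝ, 0 < x → ‖(√x)⁻¹ * (1 + x)⁻¹‖ = (√x)⁻¹ * (1 + x)⁻¹ := fun x hx => by
    rw [Real.norm_of_nonneg]; positivity
  rw [← Set.Ioc_union_Ioi_eq_Ioi zero_le_one]
  refine IntegrableOn.union ?_ ?_
  · have h : IntegrableOn (fun x : ℝ => x ^ (-(1/2) : ℝ)) (Set.Ioc 0 1) :=
      (intervalIntegrable_iff_integrableOn_Ioc_of_le zero_le_one).mp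
        (intervalIntegral.intervalIntegrable_rpow' (by norm_num))
    refine Integrable.mono' h hmeas.aestronglyMeasurable
      ((ae_restrict_iff' measurableSet_Ioc).mpr (.of_forall fun x hx => ?_))
    rw [hnorm x hx.1, Real.rpow_neg hx.1.le, ← Real.sqrt_eq_rpow]
    exact mul_le_of_le_one_right (by positivity) (inv_le_one_of_one_le₀ (by linarith [hx.1]))
  · have h := integrableOn_Ioi_rpow_of_lt (a := -(3/2)) (by norm_num) (zero_lt_one' ℝ)
    refine Integrable.mono' h hmeas.aestronglyMeasurable
      ((ae_restrict_iff' measurableSet_Ioi).mpr (.of_forall fun x hx => ?_))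
    have hx0 : (0:ℝ) < x := zero_lt_one.trans hx
    rw [hnorm x hx0, show (-(3/2) : ℝ) = -(1/2) + -1 by norm_num, Real.rpow_add hx0,
      Real.rpow_neg hx0.le, ← Real.sqrt_eq_rpow, Real.rpow_neg_one]
    gcongr
    linarith

theorem intervalIntegral_comp_sub_left_le {f : ℝ → ℝ} (hf : Integrable f) (h0 : ∀ x, 0 ≤ f x)
    {a b : ℝ} (hab : a ≤ b) (c : ℝ) : ∫ u in a..b, f (c - u) ≤ ∫ x, f x := by
  rw [intervalIntegral.integral_comp_sub_left, intervalIntegral.integral_of_le (by linarith)]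
  exact setIntegral_le_integral hf (.of_forall h0)

theorem inv_sqrt_le_one_add (x : ℝ) : (√|x|)⁻¹ ≤ 1 + (√|x|)⁻¹ * (1 + |x|)⁻¹ := by
  rcases eq_or_ne x 0 with rfl | hx
  · simp
  have hq : 0 < √|x| := Real.sqrt_pos.mpr (abs_pos.mpr hx)
  rw [← sub_nonneg]
  have hsq : √|x| ^ 2 = |x| := Real.sq_sqrt (abs_nonneg x)
  set q := √|x|
  rw [← hsq]
  have : 1 + q⁻¹ * (1 + q ^ 2)⁻¹ - q⁻¹ = (1 + q ^ 2 - q) / (1 + q ^ 2) := by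
    field_simp; ring
  rw [this]
  apply div_nonneg <;> nlinarith [sq_nonneg (q - 1)]

theorem one_add_mul_exp_neg_le {θ y : ℝ} (hθ : 0 < θ) (hy : 0 ≤ y) :
    (1 + y) * Real.exp (-θ * y) ≤ (1 + 2 / θ) * Real.exp (-(θ / 2) * y) := by
  have h1 : Real.exp (-θ * y) = Real.exp (-(θ / 2) * y) * Real.exp (-(θ / 2 * y)) := by
    rw [← Real.exp_add]; ring_nf
  have h2 : 1 + y ≤ (1 + 2 / θ) * Real.exp (θ / 2 * y) := by
    have := Real.add_one_le_exp (θ / 2 * y)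
    calc 1 + y ≤ (1 + 2 / θ) * (θ / 2 * y + 1) := by
          have : (1 + 2 / θ) * (θ / 2 * y + 1) = 1 + y + (2 / θ + θ / 2 * y) := by
            field_simp; ring
          rw [this]; have : 0 ≤ 2 / θ + θ / 2 * y := by positivity
          linarith
      _ ≤ _ := by gcongr
  rw [h1, mul_left_comm, mul_comm (1 + 2 / θ)]
  gcongr
  rw [Real.exp_neg, ← div_eq_mul_inv, div_le_iff₀ (Real.exp_pos _)]
  exact h2

/-- Transfers a decay rate from `q` to `r` when `r ≤ q + w`. -/
theorem inv_le_inv_add_div_sq {q r w : ℝ} (hq : 0 < q) (hr : 0 < r) (hw : 0 ≤ w)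
    (h : r ≤ q + w) : q⁻¹ ≤ r⁻¹ + (w + w ^ 2 * q⁻¹) / r ^ 2 := by
  have : r⁻¹ + (w + w ^ 2 * q⁻¹) / r ^ 2 - q⁻¹ = (r * q + w * q + w ^ 2 - r ^ 2) / (q * r ^ 2) := by
    field_simp; ring
  rw [← sub_nonneg, this]
  apply div_nonneg _ (by positivity)
  nlinarith [mul_nonneg hr.le (sub_nonneg.mpr h), mul_nonneg hw (sub_nonneg.mpr h)]

theorem sqrt_one_add_abs_sub_le (x y z : ℝ) : √(1 + |x - z|) ≤ √|y - z| + (1 + √|x - y|) := by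
  rw [Real.sqrt_le_left (by positivity)]
  have h1 := Real.sq_sqrt (abs_nonneg (y - z))
  have h2 := Real.sq_sqrt (abs_nonneg (x - y))
  have := abs_sub_le x y z
  have h3 := Real.sqrt_nonneg (|y - z|)
  have h4 := Real.sqrt_nonneg (|x - y|)
  nlinarith [mul_nonneg h3 h4]

theorem one_add_sqrt_sq_le {y : ℝ} (hy : 0 ≤ y) : (1 + √y) ^ 2 ≤ 2 * (1 + y) := by
  nlinarith [Real.sq_sqrt hy, sq_nonneg (√y - 1)]

/-- Bound for the integrands of `smoothedInvSqrt` and `doublySmoothedInvSqrt`, decaying in `|a - b|`. -/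
theorem exp_mul_inv_le {θ : ℝ} (hθ : 0 < θ) (a b u : ℝ) {q : ℝ} (hq : 0 < q)
    (hr : √(1 + |a - b|) ≤ q + (1 + √|a - u|)) :
    Real.exp (-θ * |a - u|) * q⁻¹ ≤ Real.exp (-θ * |a - u|) * (√(1 + |a - b|))⁻¹ +
      2 * (1 + 2 / θ) * (Real.exp (-(θ / 2) * |a - u|) * (1 + q⁻¹)) * (1 + |a - b|)⁻¹ := by
  have hr0 : 0 < √(1 + |a - b|) := by positivity
  have hr2 : √(1 + |a - b|) ^ 2 = 1 + |a - b| := Real.sq_sqrt (by positivity)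
  have h := inv_le_inv_add_div_sq hq hr0 (by positivity) hr
  rw [hr2] at h
  set w := 1 + √|a - u| with hw
  have hw1 : 1 ≤ w := by rw [hw]; linarith [Real.sqrt_nonneg |a - u|]
  have hw2 : w ^ 2 ≤ 2 * (1 + |a - u|) := one_add_sqrt_sq_le (abs_nonneg _)
  have hsum : w + w ^ 2 * q⁻¹ ≤ 2 * (1 + |a - u|) * (1 + q⁻¹) := by
    have : w + w ^ 2 * q⁻¹ ≤ w ^ 2 * (1 + q⁻¹) := by nlinarith
    exact this.trans (by gcongr)
  calc Real.exp (-θ * |a - u|) * q⁻¹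
      ≤ Real.exp (-θ * |a - u|) * ((√(1 + |a - b|))⁻¹ +
          2 * (1 + |a - u|) * (1 + q⁻¹) / (1 + |a - b|)) := by
        gcongr; exact h.trans (by gcongr)
    _ = Real.exp (-θ * |a - u|) * (√(1 + |a - b|))⁻¹ +
          2 * ((1 + |a - u|) * Real.exp (-θ * |a - u|)) * (1 + q⁻¹) * (1 + |a - b|)⁻¹ := by ring
    _ ≤ Real.exp (-θ * |a - u|) * (√(1 + |a - b|))⁻¹ +
          2 * ((1 + 2 / θ) * Real.exp (-(θ / 2) * |a - u|)) * (1 + q⁻¹) * (1 + |a - b|)⁻¹ := by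
        have := one_add_mul_exp_neg_le hθ (abs_nonneg (a - u))
        gcongr _ + 2 * ?_ * _ * _
    _ = _ := by ring

theorem intervalIntegrable_of_bounded {f : ℝ → ℝ} (hf : Measurable f) {C : ℝ}
    (hC : ∀ x, |f x| ≤ C) (a b : ℝ) : IntervalIntegrable f volume a b := by
  refine (intervalIntegrable_const (c := C)).mono_fun' hf.aestronglyMeasurable (.of_forall hC)

theorem measurable_smoothedInvSqrt (θ T : ℝ) :
    Measurable fun p : ℝ × ℝ => smoothedInvSqrt θ T p.1 p.2 := by
  have h : Measurable fun q : (ℝ × ℝ) × ℝ =>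
      Real.exp (-θ * |q.1.1 - q.2|) * (√|q.2 - q.1.2|)⁻¹ := by fun_prop
  unfold smoothedInvSqrt intervalIntegral
  exact (h.stronglyMeasurable.integral_prod_right'
    (ν := volume.restrict (Set.Ioc 0 T))).measurable.sub
    (h.stronglyMeasurable.integral_prod_right' (ν := volume.restrict (Set.Ioc T 0))).measurable

theorem measurable_doublySmoothedInvSqrt (θ T : ℝ) :
    Measurable fun p : ℝ × ℝ => doublySmoothedInvSqrt θ T p.1 p.2 := by
  have h : Measurable fun q : (ℝ × ℝ) × ℝ =>
      Real.exp (-θ * |q.1.1 - q.2|) * smoothedInvSqrt θ T q.1.2 q.2 :=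
    .mul (by fun_prop)
      ((measurable_smoothedInvSqrt θ T).comp (f := fun q : (ℝ × ℝ) × ℝ => (q.1.2, q.2))
        (by fun_prop))
  unfold doublySmoothedInvSqrt intervalIntegral
  exact (h.stronglyMeasurable.integral_prod_right'
    (ν := volume.restrict (Set.Ioc 0 T))).measurable.sub
    (h.stronglyMeasurable.integral_prod_right' (ν := volume.restrict (Set.Ioc T 0))).measurable

theorem smoothedInvSqrt_nonneg (θ : ℝ) {T : ℝ} (hT : 0 ≤ T) (a b : ℝ) :
    0 ≤ smoothedInvSqrt θ T a b :=
  intervalIntegral.integral_nonneg hT fun _ _ => by positivity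

theorem doublySmoothedInvSqrt_nonneg (θ : ℝ) {T : ℝ} (hT : 0 ≤ T) (a b : ℝ) :
    0 ≤ doublySmoothedInvSqrt θ T a b :=
  intervalIntegral.integral_nonneg hT fun _ _ =>
    mul_nonneg (Real.exp_pos _).le (smoothedInvSqrt_nonneg θ hT _ _)

theorem integrable_inv_sqrt_mul_inv_one_add_sub (b : ℝ) :
    Integrable (fun x : ℝ => (√|x - b|)⁻¹ * (1 + |x - b|)⁻¹) :=
  integrable_inv_sqrt_mul_inv_one_add.comp_sub_right b

theorem intervalIntegrable_inv_sqrt_abs_sub (b c d : ℝ) :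
    IntervalIntegrable (fun x : ℝ => (√|x - b|)⁻¹) volume c d := by
  refine (intervalIntegrable_const (c := (1:ℝ)).add
    (integrable_inv_sqrt_mul_inv_one_add_sub b).intervalIntegrable).mono_fun'
    (by fun_prop) (.of_forall fun x => ?_)
  simpa [abs_of_nonneg] using inv_sqrt_le_one_add (x - b)

theorem exp_neg_mul_abs_le_one {θ : ℝ} (hθ : 0 ≤ θ) (x : ℝ) : Real.exp (-θ * |x|) ≤ 1 :=
  Real.exp_le_one_iff.mpr (by nlinarith [abs_nonneg x])

theorem intervalIntegrable_exp_mul_inv_sqrt (θ a b c d : ℝ) :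
    IntervalIntegrable (fun u => Real.exp (-θ * |a - u|) * (√|u - b|)⁻¹) volume c d :=
  (intervalIntegrable_inv_sqrt_abs_sub b c d).continuousOn_mul
    (by fun_prop : Continuous fun u => Real.exp (-θ * |a - u|)).continuousOn

theorem intervalIntegral_inv_sqrt_mul_inv_one_add_le {T : ℝ} (hT : 0 ≤ T) (b : ℝ) :
    ∫ u in (0:ℝ)..T, (√|u - b|)⁻¹ * (1 + |u - b|)⁻¹ ≤ ∫ x : ℝ, (√|x|)⁻¹ * (1 + |x|)⁻¹ := by
  simpa only [abs_sub_comm b] using intervalIntegral_comp_sub_left_le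
    integrable_inv_sqrt_mul_inv_one_add (fun x => by positivity) hT b

theorem intervalIntegral_exp_neg_mul_abs_sub_le {θ T : ℝ} (hθ : 0 < θ) (hT : 0 ≤ T) (a : ℝ) :
    ∫ u in (0:ℝ)..T, Real.exp (-θ * |a - u|) ≤ 2 / θ :=
  (intervalIntegral_comp_sub_left_le (integrable_exp_neg_mul_abs hθ)
    (fun x => by positivity) hT a).trans_eq (integral_exp_neg_mul_abs hθ)

theorem exists_smoothedInvSqrt_le {θ : ℝ} (hθ : 0 < θ) :
    ∃ C : ℝ, 0 ≤ C ∧ ∀ T, 0 ≤ T → ∀ a b, smoothedInvSqrt θ T a b ≤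
      2 / θ * (√(1 + |a - b|))⁻¹ + C * (1 + |a - b|)⁻¹ := by
  set M := ∫ x : ℝ, (√|x|)⁻¹ * (1 + |x|)⁻¹
  have hM0 : 0 ≤ M := integral_nonneg fun x => by positivity
  refine ⟨2 * (1 + 2 / θ) * (2 * (2 / (θ / 2)) + M), by positivity, fun T hT a b => ?_⟩
  set K := 2 * (1 + 2 / θ)
  have hK0 : 0 ≤ K := by positivity
  have hi : ∀ θ : ℝ, IntervalIntegrable (fun u => Real.exp (-θ * |a - u|)) volume 0 T := fun θ =>
    (by fun_prop : Continuous fun u => Real.exp (-θ * |a - u|)).intervalIntegrable _ _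
  have hm : IntervalIntegrable (fun u : ℝ => (√|u - b|)⁻¹ * (1 + |u - b|)⁻¹) volume 0 T :=
    (integrable_inv_sqrt_mul_inv_one_add_sub b).intervalIntegrable
  calc smoothedInvSqrt θ T a b
      ≤ ∫ u in (0:ℝ)..T, (Real.exp (-θ * |a - u|) * (√(1 + |a - b|))⁻¹ +
          (2 * Real.exp (-(θ / 2) * |a - u|) + (√|u - b|)⁻¹ * (1 + |u - b|)⁻¹) *
            (K * (1 + |a - b|)⁻¹)) := by
        refine intervalIntegral.integral_mono_on hT
          (intervalIntegrable_exp_mul_inv_sqrt θ a b 0 T)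
          (((hi θ).mul_const _).add ((((hi _).const_mul 2).add hm).mul_const _)) fun u _ => ?_
        rcases eq_or_ne u b with rfl | hub
        · simp; positivity
        have hq : 0 < √|u - b| := Real.sqrt_pos.mpr (abs_pos.mpr (sub_ne_zero.mpr hub))
        refine (exp_mul_inv_le hθ a b u hq (sqrt_one_add_abs_sub_le a u b)).trans ?_
        have h1 := inv_sqrt_le_one_add (u - b)
        have h2 := exp_neg_mul_abs_le_one (half_pos hθ).le (a - u)
        have h3 : Real.exp (-(θ / 2) * |a - u|) * (1 + (√|u - b|)⁻¹) ≤
            2 * Real.exp (-(θ / 2) * |a - u|) + (√|u - b|)⁻¹ * (1 + |u - b|)⁻¹ := by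
          have h4 : 0 ≤ (√|u - b|)⁻¹ * (1 + |u - b|)⁻¹ := by positivity
          nlinarith [Real.exp_pos (-(θ / 2) * |a - u|)]
        rw [mul_right_comm K, mul_comm (K * _)]
        gcongr
    _ = (∫ u in (0:ℝ)..T, Real.exp (-θ * |a - u|)) * (√(1 + |a - b|))⁻¹ +
          (2 * (∫ u in (0:ℝ)..T, Real.exp (-(θ / 2) * |a - u|)) +
            ∫ u in (0:ℝ)..T, (√|u - b|)⁻¹ * (1 + |u - b|)⁻¹) * (K * (1 + |a - b|)⁻¹) := by
        rw [intervalIntegral.integral_add ((hi θ).mul_const _)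
          ((((hi _).const_mul 2).add hm).mul_const _), intervalIntegral.integral_mul_const,
          intervalIntegral.integral_mul_const, intervalIntegral.integral_add
          ((hi _).const_mul 2) hm, intervalIntegral.integral_const_mul]
    _ ≤ 2 / θ * (√(1 + |a - b|))⁻¹ +
          (2 * (2 / (θ / 2)) + M) * (K * (1 + |a - b|)⁻¹) := by
        gcongr
        · exact intervalIntegral_exp_neg_mul_abs_sub_le hθ hT a
        · exact intervalIntegral_exp_neg_mul_abs_sub_le (half_pos hθ) hT a
        · exact intervalIntegral_inv_sqrt_mul_inv_one_add_le hT b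
    _ = _ := by ring

theorem exists_smoothedInvSqrt_bounded {θ : ℝ} (hθ : 0 < θ) :
    ∃ C : ℝ, ∀ T, 0 ≤ T → ∀ a b, |smoothedInvSqrt θ T a b| ≤ C := by
  obtain ⟨C, hC, h⟩ := exists_smoothedInvSqrt_le hθ
  refine ⟨2 / θ + C, fun T hT a b => ?_⟩
  rw [abs_of_nonneg (smoothedInvSqrt_nonneg θ hT a b)]
  refine (h T hT a b).trans (add_le_add ?_ ?_)
  · exact mul_le_of_le_one_right (by positivity) (inv_le_one_of_one_le₀
      (Real.one_le_sqrt.mpr (by linarith [abs_nonneg (a - b)])))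
  · exact mul_le_of_le_one_right hC (inv_le_one_of_one_le₀ (by linarith [abs_nonneg (a - b)]))

theorem intervalIntegrable_exp_mul_smoothedInvSqrt {θ T : ℝ} (hθ : 0 < θ) (hT : 0 ≤ T)
    (a b c d : ℝ) :
    IntervalIntegrable (fun u => Real.exp (-θ * |a - u|) * smoothedInvSqrt θ T b u)
      volume c d := by
  obtain ⟨C, hC⟩ := exists_smoothedInvSqrt_bounded hθ
  exact (intervalIntegrable_of_bounded ((measurable_smoothedInvSqrt θ T).comp
    measurable_prodMk_left) (hC T hT b) c d).continuousOn_mul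
    (by fun_prop : Continuous fun u => Real.exp (-θ * |a - u|)).continuousOn

theorem exists_doublySmoothedInvSqrt_le {θ : ℝ} (hθ : 0 < θ) :
    ∃ C : ℝ, 0 ≤ C ∧ ∀ T, 0 ≤ T → ∀ a b, doublySmoothedInvSqrt θ T a b ≤
      (2 / θ) ^ 2 * (√(1 + |a - b|))⁻¹ + C * (1 + |a - b|)⁻¹ := by
  obtain ⟨C, hC, hsm⟩ := exists_smoothedInvSqrt_le hθ
  set K := 1 + 2 / θ
  have hK0 : 0 ≤ K := by positivity
  refine ⟨(2 / θ * (4 * K) + C * K) * (2 / (θ / 2)), by positivity, fun T hT a b => ?_⟩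
  have hi : ∀ θ : ℝ, IntervalIntegrable (fun u => Real.exp (-θ * |a - u|)) volume 0 T := fun θ =>
    (by fun_prop : Continuous fun u => Real.exp (-θ * |a - u|)).intervalIntegrable _ _
  calc doublySmoothedInvSqrt θ T a b
      ≤ ∫ u in (0:ℝ)..T, (Real.exp (-θ * |a - u|) * (2 / θ * (√(1 + |a - b|))⁻¹) +
          Real.exp (-(θ / 2) * |a - u|) *
            ((2 / θ * (4 * K) + C * K) * (1 + |a - b|)⁻¹)) := by
        refine intervalIntegral.integral_mono_on hT
          (intervalIntegrable_exp_mul_smoothedInvSqrt hθ hT a b 0 T)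
          (((hi θ).mul_const _).add ((hi _).mul_const _)) fun u _ => ?_
        have hq1 : 1 ≤ √(1 + |b - u|) := Real.one_le_sqrt.mpr (by linarith [abs_nonneg (b - u)])
        have hr : √(1 + |a - b|) ≤ √(1 + |b - u|) + (1 + √|a - u|) := by
          refine (sqrt_one_add_abs_sub_le a u b).trans ?_
          gcongr
          rw [abs_sub_comm u b]; linarith
        have h1 := exp_mul_inv_le hθ a b u (by linarith) hr
        have hqi : (√(1 + |b - u|))⁻¹ ≤ 1 := inv_le_one_of_one_le₀ hq1
        have h2 : Real.exp (-(θ / 2) * |a - u|) * (1 + (√(1 + |b - u|))⁻¹) ≤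
            Real.exp (-(θ / 2) * |a - u|) * 2 := by gcongr; linarith
        have h3 : (1 + |b - u|)⁻¹ ≤ (1 + |a - u|) * (1 + |a - b|)⁻¹ := by
          rw [← div_eq_mul_inv, inv_eq_one_div, div_le_div_iff₀ (by positivity) (by positivity)]
          have := abs_sub_le a u b
          rw [abs_sub_comm u b] at this
          nlinarith [mul_nonneg (abs_nonneg (a - u)) (abs_nonneg (b - u))]
        have h4 := one_add_mul_exp_neg_le hθ (abs_nonneg (a - u))
        have h5 : Real.exp (-θ * |a - u|) * (1 + |b - u|)⁻¹ ≤
            K * Real.exp (-(θ / 2) * |a - u|) * (1 + |a - b|)⁻¹ :=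
          calc _ ≤ Real.exp (-θ * |a - u|) * ((1 + |a - u|) * (1 + |a - b|)⁻¹) := by gcongr
            _ = (1 + |a - u|) * Real.exp (-θ * |a - u|) * (1 + |a - b|)⁻¹ := by ring
            _ ≤ _ := by gcongr ?_ * _
        calc Real.exp (-θ * |a - u|) * smoothedInvSqrt θ T b u
            ≤ Real.exp (-θ * |a - u|) *
              (2 / θ * (√(1 + |b - u|))⁻¹ + C * (1 + |b - u|)⁻¹) := by
              gcongr; exact hsm T hT b u
          _ = 2 / θ * (Real.exp (-θ * |a - u|) * (√(1 + |b - u|))⁻¹) +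
              C * (Real.exp (-θ * |a - u|) * (1 + |b - u|)⁻¹) := by ring
          _ ≤ 2 / θ * (Real.exp (-θ * |a - u|) * (√(1 + |a - b|))⁻¹ +
              2 * K * (Real.exp (-(θ / 2) * |a - u|) * 2) * (1 + |a - b|)⁻¹) +
              C * (K * Real.exp (-(θ / 2) * |a - u|) * (1 + |a - b|)⁻¹) := by
              gcongr
              exact h1.trans (by gcongr)
          _ = _ := by ring
    _ = (∫ u in (0:ℝ)..T, Real.exp (-θ * |a - u|)) * (2 / θ * (√(1 + |a - b|))⁻¹) +
          (∫ u in (0:ℝ)..T, Real.exp (-(θ / 2) * |a - u|)) *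
            ((2 / θ * (4 * K) + C * K) * (1 + |a - b|)⁻¹) := by
        rw [intervalIntegral.integral_add ((hi θ).mul_const _) ((hi _).mul_const _),
          intervalIntegral.integral_mul_const, intervalIntegral.integral_mul_const]
    _ ≤ 2 / θ * (2 / θ * (√(1 + |a - b|))⁻¹) +
          2 / (θ / 2) * ((2 / θ * (4 * K) + C * K) * (1 + |a - b|)⁻¹) := by
        gcongr
        · exact intervalIntegral_exp_neg_mul_abs_sub_le hθ hT a
        · exact intervalIntegral_exp_neg_mul_abs_sub_le (half_pos hθ) hT a
    _ = _ := by ring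

theorem exists_doublySmoothedInvSqrt_bounded {θ : ℝ} (hθ : 0 < θ) :
    ∃ C : ℝ, ∀ T, 0 ≤ T → ∀ a b, |doublySmoothedInvSqrt θ T a b| ≤ C := by
  obtain ⟨C, hC, h⟩ := exists_doublySmoothedInvSqrt_le hθ
  refine ⟨(2 / θ) ^ 2 + C, fun T hT a b => ?_⟩
  rw [abs_of_nonneg (doublySmoothedInvSqrt_nonneg θ hT a b)]
  refine (h T hT a b).trans (add_le_add ?_ ?_)
  · exact mul_le_of_le_one_right (by positivity) (inv_le_one_of_one_le₀
      (Real.one_le_sqrt.mpr (by linarith [abs_nonneg (a - b)])))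
  · exact mul_le_of_le_one_right hC (inv_le_one_of_one_le₀ (by linarith [abs_nonneg (a - b)]))

theorem intervalIntegrable_inv_sqrt_mul_doublySmoothedInvSqrt {θ T : ℝ} (hθ : 0 < θ)
    (hT : 0 ≤ T) (a c d : ℝ) :
    IntervalIntegrable (fun b => (√|b - a|)⁻¹ * doublySmoothedInvSqrt θ T a b) volume c d := by
  obtain ⟨C, hC⟩ := exists_doublySmoothedInvSqrt_bounded hθ
  have hm : Measurable fun b => doublySmoothedInvSqrt θ T a b :=
    (measurable_doublySmoothedInvSqrt θ T).comp measurable_prodMk_left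
  refine ((intervalIntegrable_inv_sqrt_abs_sub a c d).mul_const C).mono_fun'
    (Measurable.mul (by fun_prop) hm).aestronglyMeasurable (.of_forall fun b => ?_)
  simp only [norm_mul, norm_inv, Real.norm_eq_abs, abs_of_nonneg (Real.sqrt_nonneg _)]
  gcongr
  exact hC T hT a b

theorem intervalIntegrable_integral_inv_sqrt_mul_doublySmoothedInvSqrt {θ T : ℝ} (hθ : 0 < θ)
    (hT : 0 ≤ T) (c d : ℝ) :
    IntervalIntegrable (fun a => ∫ b in (0:ℝ)..T, (√|b - a|)⁻¹ * doublySmoothedInvSqrt θ T a b)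
      volume c d := by
  obtain ⟨C, hC⟩ := exists_doublySmoothedInvSqrt_bounded hθ
  have hC0 : 0 ≤ C := (abs_nonneg _).trans (hC 0 le_rfl 0 0)
  have hm : Measurable fun p : ℝ × ℝ => (√|p.2 - p.1|)⁻¹ * doublySmoothedInvSqrt θ T p.1 p.2 :=
    .mul (by fun_prop) (measurable_doublySmoothedInvSqrt θ T)
  refine intervalIntegrable_of_bounded
    (C := (T + ∫ x : ℝ, (√|x|)⁻¹ * (1 + |x|)⁻¹) * C) ?_ (fun a => ?_) c d
  · simp only [intervalIntegral.integral_of_le hT]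
    exact (hm.stronglyMeasurable.integral_prod_right'
      (ν := volume.restrict (Set.Ioc 0 T))).measurable
  have hmi := (integrable_inv_sqrt_mul_inv_one_add_sub a).intervalIntegrable (a := 0) (b := T)
  rw [abs_of_nonneg (intervalIntegral.integral_nonneg hT fun b _ =>
    mul_nonneg (by positivity) (doublySmoothedInvSqrt_nonneg θ hT a b))]
  calc ∫ b in (0:ℝ)..T, (√|b - a|)⁻¹ * doublySmoothedInvSqrt θ T a b
      ≤ ∫ b in (0:ℝ)..T, (1 + (√|b - a|)⁻¹ * (1 + |b - a|)⁻¹) * C :=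
        intervalIntegral.integral_mono_on hT
          (intervalIntegrable_inv_sqrt_mul_doublySmoothedInvSqrt hθ hT a 0 T)
          ((intervalIntegrable_const.add hmi).mul_const C) fun b _ =>
          mul_le_mul (inv_sqrt_le_one_add _) ((le_abs_self _).trans (hC T hT a b))
            (doublySmoothedInvSqrt_nonneg θ hT a b) (by positivity)
    _ ≤ _ := by
        rw [intervalIntegral.integral_mul_const, intervalIntegral.integral_add
          intervalIntegrable_const hmi]
        gcongr
        · simp
        · exact intervalIntegral_inv_sqrt_mul_inv_one_add_le hT a

theorem integral_inv_add_abs_sub {k a b y : ℝ} (hk : 0 < k) (hay : a ≤ y) (hyb : y ≤ b) :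
    ∫ x in a..b, (k + |x - y|)⁻¹ = Real.log ((k + (y - a)) / k) + Real.log ((k + (b - y)) / k) := by
  have hc : Continuous fun x : ℝ => (k + |x - y|)⁻¹ :=
    Continuous.inv₀ (by fun_prop) fun x => by positivity
  rw [← intervalIntegral.integral_add_adjacent_intervals (b := y)
    (hc.intervalIntegrable _ _) (hc.intervalIntegrable _ _)]
  congr 1
  · rw [← integral_inv_of_pos hk (by linarith)]
    have h := intervalIntegral.integral_comp_sub_left (a := a) (b := y) (fun x : ℝ => x⁻¹) (k + y)
    rw [show k + y - y = k by ring, show k + y - a = k + (y - a) by ring] at h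
    rw [← h]
    refine intervalIntegral.integral_congr fun x hx => ?_
    rw [Set.uIcc_of_le hay] at hx
    simp only [abs_of_nonpos (sub_nonpos.mpr hx.2)]
    ring_nf
  · rw [← integral_inv_of_pos hk (by linarith)]
    have h := intervalIntegral.integral_comp_add_left (a := y) (b := b) (fun x : ℝ => x⁻¹) (k - y)
    rw [show k - y + y = k by ring, show k - y + b = k + (b - y) by ring] at h
    rw [← h]
    refine intervalIntegral.integral_congr fun x hx => ?_
    rw [Set.uIcc_of_le hyb] at hx
    simp only [abs_of_nonneg (sub_nonneg.mpr hx.1)]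
    ring_nf

theorem inv_sqrt_mul_inv_sqrt_one_add_le (x : ℝ) :
    (√|x|)⁻¹ * (√(1 + |x|))⁻¹ ≤ (1 + |x|)⁻¹ + (√|x|)⁻¹ * (1 + |x|)⁻¹ := by
  rcases eq_or_ne x 0 with rfl | hx
  · simp
  have hq : 0 < √|x| := Real.sqrt_pos.mpr (abs_pos.mpr hx)
  have hr : 0 < √(1 + |x|) := by positivity
  have hr2 : √(1 + |x|) ^ 2 = 1 + |x| := Real.sq_sqrt (by positivity)
  have hrq : √(1 + |x|) ≤ √|x| + 1 := by simpa [add_comm] using sqrt_one_add_abs_sub_le 0 0 x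
  rw [show (1 + |x|)⁻¹ = (√(1 + |x|) ^ 2)⁻¹ by rw [hr2]]
  generalize √|x| = q at *
  generalize √(1 + |x|) = r at *
  calc q⁻¹ * r⁻¹ = r * (q⁻¹ * (r ^ 2)⁻¹) := by field_simp
    _ ≤ (q + 1) * (q⁻¹ * (r ^ 2)⁻¹) := by gcongr
    _ = _ := by field_simp

/-- Upper bound for the fourfold integral, sharp to leading order. -/
theorem exists_integral_inv_sqrt_mul_doublySmoothedInvSqrt_le {θ : ℝ} (hθ : 0 < θ) :
    ∃ C : ℝ, ∀ T, 1 ≤ T →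
      ∫ a in (0:ℝ)..T, ∫ b in (0:ℝ)..T, (√|b - a|)⁻¹ * doublySmoothedInvSqrt θ T a b ≤
        T * (2 * (2 / θ) ^ 2 * Real.log T + C) := by
  obtain ⟨C, hC, hD⟩ := exists_doublySmoothedInvSqrt_le hθ
  set c := (2 / θ) ^ 2
  have hc0 : 0 ≤ c := by positivity
  set M := ∫ x : ℝ, (√|x|)⁻¹ * (1 + |x|)⁻¹
  refine ⟨2 * c * Real.log 2 + (c + C) * M, fun T hT => ?_⟩
  have hT0 : 0 ≤ T := zero_le_one.trans hT
  have hlog : ∀ x, 0 ≤ x → x ≤ T → Real.log ((1 + x) / 1) ≤ Real.log 2 + Real.log T := by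
    intro x hx hxT
    rw [div_one, ← Real.log_mul two_ne_zero (by linarith)]
    exact Real.log_le_log (by linarith) (by linarith)
  have hinner : ∀ a ∈ Set.Icc 0 T,
      ∫ b in (0:ℝ)..T, (√|b - a|)⁻¹ * doublySmoothedInvSqrt θ T a b ≤
        2 * c * Real.log T + (2 * c * Real.log 2 + (c + C) * M) := by
    intro a ha
    have hmi := (integrable_inv_sqrt_mul_inv_one_add_sub a).intervalIntegrable (a := 0) (b := T)
    have hci : IntervalIntegrable (fun b : ℝ => (1 + |b - a|)⁻¹) volume 0 T :=
      (Continuous.inv₀ (by fun_prop) fun x => by positivity).intervalIntegrable _ _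
    calc ∫ b in (0:ℝ)..T, (√|b - a|)⁻¹ * doublySmoothedInvSqrt θ T a b
        ≤ ∫ b in (0:ℝ)..T, (c * (1 + |b - a|)⁻¹ + (c + C) * ((√|b - a|)⁻¹ * (1 + |b - a|)⁻¹)) := by
          refine intervalIntegral.integral_mono_on hT0
            (intervalIntegrable_inv_sqrt_mul_doublySmoothedInvSqrt hθ hT0 a 0 T)
            ((hci.const_mul _).add (hmi.const_mul _)) fun b _ => ?_
          calc (√|b - a|)⁻¹ * doublySmoothedInvSqrt θ T a b
              ≤ (√|b - a|)⁻¹ * (c * (√(1 + |b - a|))⁻¹ + C * (1 + |b - a|)⁻¹) := by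
                gcongr
                simpa only [abs_sub_comm a b] using hD T hT0 a b
            _ = c * ((√|b - a|)⁻¹ * (√(1 + |b - a|))⁻¹) +
                  C * ((√|b - a|)⁻¹ * (1 + |b - a|)⁻¹) := by ring
            _ ≤ c * ((1 + |b - a|)⁻¹ + (√|b - a|)⁻¹ * (1 + |b - a|)⁻¹) +
                  C * ((√|b - a|)⁻¹ * (1 + |b - a|)⁻¹) := by
                gcongr; exact inv_sqrt_mul_inv_sqrt_one_add_le _
            _ = _ := by ring
      _ = c * (Real.log ((1 + (a - 0)) / 1) + Real.log ((1 + (T - a)) / 1)) +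
            (c + C) * ∫ b in (0:ℝ)..T, (√|b - a|)⁻¹ * (1 + |b - a|)⁻¹ := by
          rw [intervalIntegral.integral_add (hci.const_mul _) (hmi.const_mul _),
            intervalIntegral.integral_const_mul, intervalIntegral.integral_const_mul,
            integral_inv_add_abs_sub one_pos ha.1 ha.2]
      _ ≤ c * ((Real.log 2 + Real.log T) + (Real.log 2 + Real.log T)) + (c + C) * M := by
          gcongr
          · exact hlog _ (by linarith [ha.1]) (by linarith [ha.2])
          · exact hlog _ (by linarith [ha.2]) (by linarith [ha.1])
          · exact intervalIntegral_inv_sqrt_mul_inv_one_add_le hT0 a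
      _ = _ := by ring
  refine (intervalIntegral.integral_mono_on hT0
    (intervalIntegrable_integral_inv_sqrt_mul_doublySmoothedInvSqrt hθ hT0 0 T)
    intervalIntegrable_const hinner).trans_eq ?_
  rw [intervalIntegral.integral_const, smul_eq_mul, sub_zero]

theorem mul_le_integral_exp_mul {θ T R a k : ℝ} {h : ℝ → ℝ} (hR : 0 ≤ R)
    (ha : a ∈ Set.Icc R (T - R)) (h0 : ∀ u, 0 ≤ h u)
    (hi : IntervalIntegrable (fun u => Real.exp (-θ * |a - u|) * h u) volume 0 T)
    (hk : ∀ᵐ u, |a - u| ≤ R → k ≤ h u) :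
    (∫ v in -R..R, Real.exp (-θ * |v|)) * k ≤ ∫ u in (0:ℝ)..T, Real.exp (-θ * |a - u|) * h u := by
  obtain ⟨ha1, ha2⟩ := ha
  have hT : 0 ≤ T := by linarith
  have hshift : (∫ v in -R..R, Real.exp (-θ * |v|)) * k =
      ∫ u in (a - R)..(a + R), Real.exp (-θ * |a - u|) * k := by
    rw [intervalIntegral.integral_mul_const,
      intervalIntegral.integral_comp_sub_left (fun v => Real.exp (-θ * |v|))]
    simp
  have hsub : IntervalIntegrable (fun u => Real.exp (-θ * |a - u|) * h u) volume (a - R) (a + R) :=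
    hi.mono_set (by
      rw [Set.uIcc_of_le hT, Set.uIcc_of_le (by linarith)]
      exact Set.Icc_subset_Icc (by linarith) (by linarith))
  rw [hshift]
  refine (intervalIntegral.integral_mono_ae_restrict (by linarith)
    (Continuous.intervalIntegrable (by fun_prop) _ _) hsub ?_).trans
    (intervalIntegral.integral_mono_interval (by linarith) (by linarith) (by linarith)
      (.of_forall fun u => mul_nonneg (Real.exp_pos _).le (h0 u)) hi)
  rw [Filter.EventuallyLE, ae_restrict_iff' measurableSet_Icc]
  filter_upwards [hk] with u hu hmem
  have : |a - u| ≤ R := abs_le.mpr ⟨by linarith [hmem.2], by linarith [hmem.1]⟩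
  have := hu this
  gcongr

theorem le_smoothedInvSqrt {θ T R a : ℝ} (hR : 0 ≤ R) (ha : a ∈ Set.Icc R (T - R)) (b : ℝ) :
    (∫ v in -R..R, Real.exp (-θ * |v|)) * (√(R + |a - b|))⁻¹ ≤ smoothedInvSqrt θ T a b := by
  refine mul_le_integral_exp_mul hR ha (fun u => by positivity)
    (intervalIntegrable_exp_mul_inv_sqrt θ a b 0 T) ?_
  filter_upwards [Measure.ae_ne volume b] with u hub hu
  have : 0 < |u - b| := abs_pos.mpr (sub_ne_zero.mpr hub)
  have h := abs_sub_le u a b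
  rw [abs_sub_comm u a] at h
  gcongr
  linarith

theorem le_doublySmoothedInvSqrt {θ T R a b : ℝ} (hθ : 0 < θ) (hR : 0 < R)
    (ha : a ∈ Set.Icc R (T - R)) (hb : b ∈ Set.Icc R (T - R)) :
    (∫ v in -R..R, Real.exp (-θ * |v|)) ^ 2 * (√(2 * R + |b - a|))⁻¹ ≤
      doublySmoothedInvSqrt θ T a b := by
  have hT : 0 ≤ T := by linarith [ha.1, ha.2]
  have hc0 : 0 ≤ ∫ v in -R..R, Real.exp (-θ * |v|) :=
    intervalIntegral.integral_nonneg (by linarith) fun v _ => (Real.exp_pos _).le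
  rw [sq, mul_assoc]
  refine mul_le_integral_exp_mul hR.le ha (fun u => smoothedInvSqrt_nonneg θ hT b u)
    (intervalIntegrable_exp_mul_smoothedInvSqrt hθ hT a b 0 T) (.of_forall fun u hu => ?_)
  refine le_trans ?_ (le_smoothedInvSqrt hR.le hb u)
  have h := abs_sub_le b a u
  gcongr _ * (√?_)⁻¹
  linarith

theorem integral_log_div_add_ge {R T : ℝ} (hR : 1 ≤ R) (hT : 2 * R ≤ T) :
    2 * (T - R) * (Real.log T - Real.log 2) - (2 * R * Real.log R + 2 + 2 * Real.log (2 * R)) * T ≤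
      ∫ a in R..(T - R), (Real.log ((2 * R + (a - R)) / (2 * R)) +
        Real.log ((2 * R + (T - R - a)) / (2 * R))) := by
  have hlogR : 0 ≤ Real.log R := Real.log_nonneg hR
  have hlog2R : 0 ≤ Real.log (2 * R) := Real.log_nonneg (by linarith)
  have hle : R ≤ T - R := by linarith
  have hpos : ∀ a ∈ Set.uIcc R (T - R), 0 < a ∧ 0 < T - a := fun a ha => by
    rw [Set.uIcc_of_le hle] at ha
    exact ⟨by linarith [ha.1], by linarith [ha.2]⟩
  have hi1 : IntervalIntegrable (fun a => Real.log a) volume R (T - R) :=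
    ContinuousOn.intervalIntegrable (ContinuousOn.log continuousOn_id fun a ha => (hpos a ha).1.ne')
  have hi2 : IntervalIntegrable (fun a => Real.log (T - a)) volume R (T - R) :=
    ContinuousOn.intervalIntegrable (ContinuousOn.log (by fun_prop) fun a ha => (hpos a ha).2.ne')
  have hrefl : ∫ a in R..(T - R), Real.log (T - a) = ∫ a in R..(T - R), Real.log a := by
    rw [intervalIntegral.integral_comp_sub_left Real.log]; simp
  have hint : ∫ a in R..(T - R), (Real.log a + Real.log (T - a) - 2 * Real.log (2 * R)) =
      2 * ((T - R) * Real.log (T - R) - R * Real.log R - (T - R) + R) -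
        (T - R - R) * (2 * Real.log (2 * R)) := by
    rw [intervalIntegral.integral_sub (hi1.add hi2) intervalIntegrable_const,
      intervalIntegral.integral_add hi1 hi2, hrefl, integral_log, intervalIntegral.integral_const,
      smul_eq_mul]
    ring
  have hlogT : Real.log T - Real.log 2 ≤ Real.log (T - R) := by
    rw [← Real.log_div (by linarith) two_ne_zero]
    exact Real.log_le_log (by linarith) (by linarith)
  calc _ ≤ ∫ a in R..(T - R), (Real.log a + Real.log (T - a) - 2 * Real.log (2 * R)) := by
        rw [hint]
        have h1 := mul_le_mul_of_nonneg_left hlogT (by linarith : 0 ≤ T - R)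
        have h2 : R * Real.log R ≤ R * Real.log R * T :=
          le_mul_of_one_le_right (by positivity) (by linarith)
        have h3 : (T - R - R) * (2 * Real.log (2 * R)) ≤ 2 * Real.log (2 * R) * T := by nlinarith
        linarith
    _ ≤ _ := by
        have hcont : ∀ f : ℝ → ℝ, ContinuousOn f (Set.uIcc R (T - R)) →
            (∀ a ∈ Set.uIcc R (T - R), f a ≠ 0) →
            IntervalIntegrable (fun a => Real.log (f a)) volume R (T - R) := fun f hf h0 =>
          (ContinuousOn.log hf h0).intervalIntegrable
        have hne : 2 * R ≠ 0 := by linarith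
        refine intervalIntegral.integral_mono_on hle ((hi1.add hi2).sub intervalIntegrable_const)
          ((hcont _ (by fun_prop) fun a ha => ?_).add (hcont _ (by fun_prop) fun a ha => ?_))
          fun a ha => ?_
        · have := hpos a ha
          exact (div_pos (by linarith) (by linarith)).ne'
        · have := hpos a ha
          exact (div_pos (by linarith) (by linarith)).ne'
        · rw [Real.log_div (by linarith [ha.1]) hne, Real.log_div (by linarith [ha.2]) hne]
          have h1 := Real.log_le_log (by linarith [ha.1] : 0 < a)
            (by linarith : a ≤ 2 * R + (a - R))
          have h2 := Real.log_le_log (by linarith [ha.2] : 0 < T - a)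
            (by linarith : T - a ≤ 2 * R + (T - R - a))
          linarith

/-- Lower bound for the fourfold integral, sharp to leading order as `T → ∞` and then `R → ∞`. -/
theorem le_integral_inv_sqrt_mul_doublySmoothedInvSqrt {θ R T : ℝ} (hθ : 0 < θ) (hR : 1 ≤ R)
    (hT : 2 * R ≤ T) :
    (∫ v in -R..R, Real.exp (-θ * |v|)) ^ 2 * (2 * (T - R) * (Real.log T - Real.log 2) -
        (2 * R * Real.log R + 2 + 2 * Real.log (2 * R)) * T) ≤
      ∫ a in (0:ℝ)..T, ∫ b in (0:ℝ)..T, (√|b - a|)⁻¹ * doublySmoothedInvSqrt θ T a b := by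
  have hR0 : 0 < R := by linarith
  have hT0 : 0 ≤ T := by linarith
  have hle : R ≤ T - R := by linarith
  set c := ∫ v in -R..R, Real.exp (-θ * |v|)
  have hnn : ∀ a b, 0 ≤ (√|b - a|)⁻¹ * doublySmoothedInvSqrt θ T a b := fun a b =>
    mul_nonneg (by positivity) (doublySmoothedInvSqrt_nonneg θ hT0 a b)
  have hinner : ∀ a ∈ Set.Icc R (T - R),
      c ^ 2 * ∫ b in R..(T - R), (2 * R + |b - a|)⁻¹ ≤
        ∫ b in (0:ℝ)..T, (√|b - a|)⁻¹ * doublySmoothedInvSqrt θ T a b := by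
    intro a ha
    rw [← intervalIntegral.integral_const_mul]
    refine (intervalIntegral.integral_mono_ae_restrict hle ?_
      (intervalIntegrable_inv_sqrt_mul_doublySmoothedInvSqrt hθ hT0 a _ _) ?_).trans
      (intervalIntegral.integral_mono_interval hR0.le hle (by linarith)
        (.of_forall fun b => hnn a b)
        (intervalIntegrable_inv_sqrt_mul_doublySmoothedInvSqrt hθ hT0 a _ _))
    · exact (continuous_const.mul
        (Continuous.inv₀ (by fun_prop) fun x => by positivity)).intervalIntegrable _ _
    rw [Filter.EventuallyLE, ae_restrict_iff' measurableSet_Icc]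
    filter_upwards [Measure.ae_ne volume a] with b hba hb
    have hpos : 0 < |b - a| := abs_pos.mpr (sub_ne_zero.mpr hba)
    calc c ^ 2 * (2 * R + |b - a|)⁻¹
        = (√(2 * R + |b - a|))⁻¹ * (c ^ 2 * (√(2 * R + |b - a|))⁻¹) := by
          conv_lhs => rw [← Real.mul_self_sqrt (by positivity : 0 ≤ 2 * R + |b - a|), mul_inv]
          ring
      _ ≤ (√|b - a|)⁻¹ * doublySmoothedInvSqrt θ T a b := by
          gcongr
          · linarith
          · exact le_doublySmoothedInvSqrt hθ hR0 ha hb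
  have houter := intervalIntegrable_integral_inv_sqrt_mul_doublySmoothedInvSqrt hθ hT0
  have hpar : IntervalIntegrable (fun a => ∫ b in R..(T - R), (2 * R + |b - a|)⁻¹)
      volume R (T - R) := by
    refine Continuous.intervalIntegrable ?_ _ _
    refine intervalIntegral.continuous_parametric_intervalIntegral_of_continuous' ?_ _ _
    exact Continuous.inv₀ (by fun_prop) fun x => by positivity
  calc _ ≤ c ^ 2 * ∫ a in R..(T - R), (Real.log ((2 * R + (a - R)) / (2 * R)) +
          Real.log ((2 * R + (T - R - a)) / (2 * R))) := by
        gcongr; exact integral_log_div_add_ge hR hT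
    _ = ∫ a in R..(T - R), c ^ 2 * ∫ b in R..(T - R), (2 * R + |b - a|)⁻¹ := by
        rw [intervalIntegral.integral_const_mul]
        congr 1
        refine intervalIntegral.integral_congr fun a ha => ?_
        rw [Set.uIcc_of_le hle] at ha
        exact (integral_inv_add_abs_sub (by linarith) ha.1 ha.2).symm
    _ ≤ ∫ a in R..(T - R), ∫ b in (0:ℝ)..T, (√|b - a|)⁻¹ * doublySmoothedInvSqrt θ T a b :=
        intervalIntegral.integral_mono_on hle (hpar.const_mul _) (houter _ _) hinner
    _ ≤ _ := intervalIntegral.integral_mono_interval hR0.le hle (by linarith)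
        (.of_forall fun a => intervalIntegral.integral_nonneg hT0 fun b _ => hnn a b) (houter _ _)

/-- At `H = 3/4`, the fourfold integral `I_T` grows like `8 θ^{-2} · T log T`. -/
theorem limit_IT_critical (H θ : ℝ) (hH : H = 3/4) (hθ : 0 < θ) :
    Filter.Tendsto (fun T : ℝ =>
      (1 / (T * Real.log T)) *
        ∫ s₁ in (0:ℝ)..T, ∫ s₂ in (0:ℝ)..T, ∫ u₁ in (0:ℝ)..T, ∫ u₂ in (0:ℝ)..T,
          Real.exp (-θ * |s₂ - u₂| - θ * |s₁ - u₁|) *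
            |s₂ - s₁| ^ (2*H - 2) * |u₂ - u₁| ^ (2*H - 2))
      Filter.atTop (nhds (8 / θ^2)) := by
  subst hH
  have hrpow : ∀ x : ℝ, |x| ^ (2 * (3 / 4) - 2 : ℝ) = (√|x|)⁻¹ := fun x => by
    rw [show (2 * (3 / 4) - 2 : ℝ) = -(1 / 2) by norm_num, Real.rpow_neg (abs_nonneg x),
      Real.sqrt_eq_rpow]
  have hsplit : ∀ T s₁ s₂ : ℝ, (∫ u₁ in (0:ℝ)..T, ∫ u₂ in (0:ℝ)..T,
      Real.exp (-θ * |s₂ - u₂| - θ * |s₁ - u₁|) * |s₂ - s₁| ^ (2 * (3 / 4) - 2 : ℝ) *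
        |u₂ - u₁| ^ (2 * (3 / 4) - 2 : ℝ)) =
      (√|s₂ - s₁|)⁻¹ * doublySmoothedInvSqrt θ T s₁ s₂ := by
    intro T s₁ s₂
    simp only [doublySmoothedInvSqrt, smoothedInvSqrt, ← intervalIntegral.integral_const_mul, hrpow,
      sub_eq_add_neg (-θ * _), ← neg_mul, Real.exp_add]
    congr! 4
    ring
  simp only [hsplit]
  set J : ℝ → ℝ := fun T =>
    ∫ a in (0:ℝ)..T, ∫ b in (0:ℝ)..T, (√|b - a|)⁻¹ * doublySmoothedInvSqrt θ T a b
  change Filter.Tendsto (fun T => 1 / (T * Real.log T) * J T) _ _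
  have hinvlog : Filter.Tendsto (fun T : ℝ => (Real.log T)⁻¹) Filter.atTop (nhds 0) :=
    Real.tendsto_log_atTop.inv_tendsto_atTop
  rw [tendsto_order]
  constructor
  · intro l hl
    have hc : Filter.Tendsto (fun R : ℝ => (∫ v in -R..R, Real.exp (-θ * |v|)) ^ 2 * 2)
        Filter.atTop (nhds ((2 / θ) ^ 2 * 2)) := by
      rw [← integral_exp_neg_mul_abs hθ]
      exact ((intervalIntegral_tendsto_integral (integrable_exp_neg_mul_abs hθ)
        Filter.tendsto_neg_atTop_atBot Filter.tendsto_id).pow 2).mul_const 2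
    have hl' : l < (2 / θ) ^ 2 * 2 := hl.trans_eq (by ring)
    obtain ⟨R, hRl, hR⟩ := ((hc.eventually_const_lt hl').and (Filter.eventually_ge_atTop 1)).exists
    set c := ∫ v in -R..R, Real.exp (-θ * |v|)
    set A := 2 * R * Real.log R + 2 + 2 * Real.log (2 * R)
    have hlow : Filter.Tendsto (fun T : ℝ => c ^ 2 * (2 * (1 - R * T⁻¹) *
        (1 - Real.log 2 * (Real.log T)⁻¹) - A * (Real.log T)⁻¹)) Filter.atTop
        (nhds (c ^ 2 * (2 * (1 - R * 0) * (1 - Real.log 2 * 0) - A * 0))) :=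
      ((((tendsto_inv_atTop_zero.const_mul R).const_sub 1).const_mul 2 |>.mul
        ((hinvlog.const_mul _).const_sub 1)).sub (hinvlog.const_mul A)).const_mul _
    filter_upwards [hlow.eventually_const_lt (u := l) (by simpa using hRl),
      Filter.eventually_ge_atTop (2 * R), Filter.eventually_gt_atTop 1] with T hTl hTR hT1
    have hlog : 0 < Real.log T := Real.log_pos hT1
    refine hTl.trans_le ?_
    rw [one_div, inv_mul_eq_div, le_div_iff₀ (by positivity)]
    have hJT : c ^ 2 * (2 * (T - R) * (Real.log T - Real.log 2) - A * T) ≤ J T :=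
      le_integral_inv_sqrt_mul_doublySmoothedInvSqrt hθ hR hTR
    refine le_trans (le_of_eq ?_) hJT
    clear_value c A
    have : T ≠ 0 := by linarith
    field_simp
  · intro l hl
    obtain ⟨C, hC⟩ := exists_integral_inv_sqrt_mul_doublySmoothedInvSqrt_le hθ
    have hup : Filter.Tendsto (fun T : ℝ => 2 * (2 / θ) ^ 2 + C * (Real.log T)⁻¹) Filter.atTop
        (nhds (2 * (2 / θ) ^ 2 + C * 0)) := (hinvlog.const_mul C).const_add _
    have hl' : 2 * (2 / θ) ^ 2 + C * 0 < l := lt_of_eq_of_lt (by ring) hl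
    filter_upwards [hup.eventually_lt_const hl', Filter.eventually_gt_atTop 1] with T hTl hT1
    have hlog : 0 < Real.log T := Real.log_pos hT1
    refine lt_of_le_of_lt ?_ hTl
    rw [one_div, inv_mul_eq_div, div_le_iff₀ (by positivity)]
    refine (hC T hT1.le).trans (le_of_eq ?_)
    field_simp
end
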